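/- Let K ∈ ℝ, N ∈ [1,∞) and let (X,d,m) be a CD*(K,N) metric measure space having the good transport property (GT). Then (X,d,m) satisfies the measure contraction property MCP(K,N): for every x ∈ X and every Borel set A ⊂ X with 0 < m(A) < ∞ (and, in case K > 0, with A contained in the closed ball of radius pi*sqrt((N-1)/K) around x) there exists pi ∈ OptGeo(delta_x, m(A)^{-1} m|_A) such that for every t ∈ [0,1] one has m >= (e_t)# ( tau^{(t)}_{K,N}(d(gamma_0,gamma_1))^N * m(A) * pi ) as measures on X. -/

import Mathlib

open MeasureTheory Metric Set unitInterval ENNReal NNReal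

noncomputable section

variable {X : Type*} [MetricSpace X]

/-- A constant speed minimizing geodesic parametrized on `[0,1]`. -/
def IsUnitGeodesic (γ : C(unitInterval, X)) : Prop :=
  ∀ s t : unitInterval, dist (γ s) (γ t) = |(s : ℝ) - (t : ℝ)| * dist (γ 0) (γ 1)

/-- The space of constant speed minimizing geodesics, with the sup distance. -/
def Geo (X : Type*) [MetricSpace X] : Type _ :=
  { γ : C(unitInterval, X) // IsUnitGeodesic γ }

instance : MetricSpace (Geo X) := Subtype.metricSpace
instance : MeasurableSpace (Geo X) := borel _
instance : BorelSpace (Geo X) := ⟨rfl⟩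

/-- Evaluation map `e_t`. -/
def eval (t : unitInterval) (γ : Geo X) : X := γ.1 t

/-- `(X,d)` is a geodesic space: any two points are joined by a geodesic. -/
def IsGeodesicSpace (X : Type*) [MetricSpace X] : Prop :=
  ∀ x y : X, ∃ γ : Geo X, eval 0 γ = x ∧ eval 1 γ = y

/-- The (topological) support of a measure. -/
def measSupport {Y : Type*} [TopologicalSpace Y] [MeasurableSpace Y] (μ : Measure Y) : Set Y :=
  {y | ∀ U ∈ nhds y, 0 < μ U}

variable [MeasurableSpace X]

/-- Finite second moment. -/
def HasFiniteSecondMoment (μ : Measure X) : Prop :=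
  ∃ x₀ : X, ∫⁻ x, ENNReal.ofReal (dist x x₀ ^ 2) ∂μ ≠ ⊤

/-- The transport cost of a plan on the space of geodesics. -/
def transportCost (π : Measure (Geo X)) : ℝ≥0∞ :=
  ∫⁻ γ, ENNReal.ofReal (dist (eval 0 γ) (eval 1 γ) ^ 2) ∂π

/-- `π ∈ OptGeo(μ,ν)`: an optimal geodesic plan from `μ` to `ν`. -/
def IsOptGeo (μ ν : Measure X) (π : Measure (Geo X)) : Prop :=
  IsProbabilityMeasure π ∧ π.map (eval 0) = μ ∧ π.map (eval 1) = ν ∧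
    ∀ π' : Measure (Geo X), IsProbabilityMeasure π' →
      π'.map (eval 0) = μ → π'.map (eval 1) = ν →
      transportCost π ≤ transportCost π'

/-- The distortion coefficients `σ_{K,N}^{(t)}(θ)`. -/
def sigmaCoeff (K N t θ : ℝ) : ℝ≥0∞ :=
  if N * Real.pi ^ 2 ≤ K * θ ^ 2 then ⊤
  else if 0 < K * θ ^ 2 then
    ENNReal.ofReal (Real.sin (t * θ * Real.sqrt (K / N)) / Real.sin (θ * Real.sqrt (K / N)))
  else if K * θ ^ 2 = 0 then ENNReal.ofReal t
  else ENNReal.ofReal (Real.sinh (t * θ * Real.sqrt (-K / N)) / Real.sinh (θ * Real.sqrt (-K / N)))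

/-- The distortion coefficients `τ_{K,N}^{(t)}(θ)`. -/
def tauCoeff (K N t θ : ℝ) : ℝ≥0∞ :=
  if N = 1 then
    (if K ≤ 0 then ENNReal.ofReal t else if θ = 0 then ENNReal.ofReal t else ⊤)
  else ENNReal.ofReal t ^ (1 / N) * sigmaCoeff K (N - 1) t θ ^ ((N - 1) / N)

/-- The (reduced) curvature dimension condition `CD*(K,N)`. -/
def IsCDStar (K N : ℝ) (m : Measure X) : Prop :=
  ∀ μ₀ μ₁ : Measure X, IsProbabilityMeasure μ₀ → IsProbabilityMeasure μ₁ →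
    (∃ s : Set X, Bornology.IsBounded s ∧ μ₀ sᶜ = 0 ∧ μ₁ sᶜ = 0) →
    ∃ π : Measure (Geo X), IsOptGeo μ₀ μ₁ π ∧
      ∀ t : unitInterval, ∀ N' : ℝ, N ≤ N' →
        ∫⁻ γ, (sigmaCoeff K N' (1 - (t : ℝ)) (dist (eval 0 γ) (eval 1 γ)) *
                 ((π.map (eval 0)).rnDeriv m (eval 0 γ)) ^ (-(1 / N')) +
               sigmaCoeff K N' (t : ℝ) (dist (eval 0 γ) (eval 1 γ)) *
                 ((π.map (eval 1)).rnDeriv m (eval 1 γ)) ^ (-(1 / N'))) ∂π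
          ≤ ∫⁻ x, ((π.map (eval t)).rnDeriv m x) ^ (1 - 1 / N') ∂m

/-- The good transport property (GT): between absolutely continuous measures in `P₂(X)` there is
a unique optimal geodesic plan, and it is induced by a map from every intermediate time. -/
def GoodTransport (m : Measure X) : Prop :=
  ∀ μ ν : Measure X, IsProbabilityMeasure μ → IsProbabilityMeasure ν →
    HasFiniteSecondMoment μ → HasFiniteSecondMoment ν → μ ≪ m → ν ≪ m →
    (∃! π : Measure (Geo X), IsOptGeo μ ν π) ∧
    ∀ π : Measure (Geo X), IsOptGeo μ ν π → ∀ t : unitInterval,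
      ∃ T : X → Geo X, Measurable T ∧ π = (π.map (eval t)).map T

/-- `c`-concavity (with `c = d²/2`) for functions with values in `ℝ ∪ {-∞}`. -/
def cConcave (φ : X → EReal) : Prop :=
  (∃ x, φ x ≠ ⊥) ∧ (∀ x, φ x ≠ ⊤) ∧
    ∃ ψ : X → EReal, (∀ y, ψ y ≠ ⊤) ∧
      ∀ x, φ x = ⨅ y, ((dist x y ^ 2 / 2 : ℝ) : EReal) - ψ y

/-- The `c`-transform `φᶜ`. -/
def cTransform (φ : X → EReal) : X → EReal :=
  fun y => ⨅ x, ((dist x y ^ 2 / 2 : ℝ) : EReal) - φ x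

/-- The `c`-superdifferential `∂ᶜφ`. -/
def cSuperdiff (φ : X → EReal) : Set (X × X) :=
  {p | φ p.1 + cTransform φ p.2 = ((dist p.1 p.2 ^ 2 / 2 : ℝ) : EReal)}

/-- Kantorovich potential from `μ` to `ν`. -/
def IsKantorovichPotential (μ ν : Measure X) (φ : X → EReal) : Prop :=
  cConcave φ ∧ ∀ π : Measure (Geo X), IsOptGeo μ ν π →
    measSupport (π.map (fun γ => (eval 0 γ, eval 1 γ))) ⊆ cSuperdiff φ

section Proofs
open Filter Topology
set_option linter.unusedSectionVars false
set_option linter.unusedVariables false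
set_option linter.unusedSimpArgs false

set_option linter.unusedSectionVars false
section Basics

lemma eval_uncurry_continuous : Continuous (fun p : Geo X × unitInterval => eval p.2 p.1) := by
  have h : Continuous (fun p : Geo X × unitInterval => ((p.1.1 : C(unitInterval, X)), p.2)) :=
    (continuous_subtype_val.comp continuous_fst).prodMk continuous_snd
  exact (continuous_eval (F := C(unitInterval, X))).comp h

lemma eval_continuous (t : unitInterval) : Continuous (eval t : Geo X → X) :=
  eval_uncurry_continuous.comp (continuous_id.prodMk continuous_const)

lemma eval_measurable [BorelSpace X] (t : unitInterval) : Measurable (eval t : Geo X → X) :=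
  (eval_continuous t).measurable

/-- length of a geodesic -/
def len (γ : Geo X) : ℝ := dist (eval 0 γ) (eval 1 γ)

lemma len_continuous : Continuous (len : Geo X → ℝ) :=
  (eval_continuous 0).dist (eval_continuous 1)

lemma len_measurable : Measurable (len : Geo X → ℝ) := len_continuous.measurable

lemma len_nonneg (γ : Geo X) : 0 ≤ len γ := dist_nonneg

lemma dist_eval (γ : Geo X) (s t : unitInterval) :
    dist (eval s γ) (eval t γ) = |(s : ℝ) - t| * len γ := γ.2 s t

/-- convex combination in the unit interval -/
def cmb (a b t : unitInterval) : unitInterval :=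
  ⟨(1 - t) * a + t * b, by
    have ha := a.2; have hb := b.2; have ht := t.2
    constructor
    · have := mul_nonneg (sub_nonneg.2 ht.2) ha.1
      have := mul_nonneg ht.1 hb.1
      linarith
    · have := mul_le_mul_of_nonneg_left ha.2 (sub_nonneg.2 ht.2)
      have := mul_le_mul_of_nonneg_left hb.2 ht.1
      linarith⟩

lemma coe_cmb (a b t : unitInterval) : (cmb a b t : ℝ) = (1 - t) * a + t * b := rfl

lemma cmb_continuous :
    Continuous (fun p : unitInterval × unitInterval × unitInterval => cmb p.1 p.2.1 p.2.2) := by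
  apply Continuous.subtype_mk
  fun_prop

@[simp] lemma cmb_zero (a b : unitInterval) : cmb a b 0 = a := by
  apply Subtype.ext; simp [coe_cmb]
@[simp] lemma cmb_one (a b : unitInterval) : cmb a b 1 = b := by
  apply Subtype.ext; simp [coe_cmb]

/-- sub-segment of a geodesic -/
def subseg (γ : Geo X) (a b : unitInterval) : Geo X :=
  ⟨⟨fun t => eval (cmb a b t) γ, by
      have : Continuous (fun t : unitInterval => (γ, cmb a b t)) :=
        continuous_const.prodMk (cmb_continuous.comp
          (continuous_const.prodMk (continuous_const.prodMk continuous_id)))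
      exact eval_uncurry_continuous.comp this⟩, by
    intro s t
    show dist (eval (cmb a b s) γ) (eval (cmb a b t) γ) =
      _ * dist (eval (cmb a b 0) γ) (eval (cmb a b 1) γ)
    rw [dist_eval, dist_eval, cmb_zero, cmb_one, coe_cmb, coe_cmb, ← mul_assoc, ← abs_mul,
      ← abs_neg]
    congr 2
    ring⟩

lemma eval_subseg (γ : Geo X) (a b t : unitInterval) :
    eval t (subseg γ a b) = eval (cmb a b t) γ := rfl

@[simp] lemma eval_subseg_zero (γ : Geo X) (a b : unitInterval) :
    eval 0 (subseg γ a b) = eval a γ := by rw [eval_subseg, cmb_zero]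
@[simp] lemma eval_subseg_one (γ : Geo X) (a b : unitInterval) :
    eval 1 (subseg γ a b) = eval b γ := by rw [eval_subseg, cmb_one]

lemma subseg_continuous :
    Continuous (fun p : Geo X × unitInterval × unitInterval => subseg p.1 p.2.1 p.2.2) := by
  apply Continuous.subtype_mk
  apply ContinuousMap.continuous_of_continuous_uncurry
  have : Continuous (fun q : (Geo X × unitInterval × unitInterval) × unitInterval =>
      (q.1.1, cmb q.1.2.1 q.1.2.2 q.2)) := by
    have h2 : Continuous (fun q : (Geo X × unitInterval × unitInterval) × unitInterval =>
      (q.1.2.1, q.1.2.2, q.2)) := by fun_prop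
    exact (by fun_prop : Continuous fun q : (Geo X × unitInterval × unitInterval) × unitInterval
      => q.1.1).prodMk (cmb_continuous.comp h2)
  exact eval_uncurry_continuous.comp this

/-- constant geodesic -/
def constGeo (x : X) : Geo X := ⟨ContinuousMap.const _ x, by intro s t; simp⟩

@[simp] lemma eval_constGeo (x : X) (t : unitInterval) : eval t (constGeo x) = x := rfl

instance [ProperSpace X] : SecondCountableTopology (Geo X) :=
  inferInstanceAs (SecondCountableTopology { γ : C(unitInterval, X) // IsUnitGeodesic γ })

lemma subseg_measurable [ProperSpace X] {Ω : Type*} [MeasurableSpace Ω] {G : Ω → Geo X}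
    {a b : Ω → unitInterval} (hG : Measurable G) (ha : Measurable a) (hb : Measurable b) :
    Measurable (fun ω => subseg (G ω) (a ω) (b ω)) :=
  subseg_continuous.measurable.comp (hG.prodMk (ha.prodMk hb))

lemma eval_measurable' [ProperSpace X] [BorelSpace X] {Ω : Type*} [MeasurableSpace Ω]
    {G : Ω → Geo X} {a : Ω → unitInterval} (hG : Measurable G) (ha : Measurable a) :
    Measurable (fun ω => eval (a ω) (G ω)) :=
  eval_uncurry_continuous.measurable.comp (hG.prodMk ha)

end Basics

section Plans

/-- standing hypotheses -/
structure Hyp (K N : ℝ) (m : Measure X) : Prop where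
  bdd : ∀ s : Set X, Bornology.IsBounded s → m s ≠ ⊤
  supp : ∀ x : X, ∀ r : ℝ, 0 < r → 0 < m (ball x r)
  hN : 1 ≤ N
  cd : IsCDStar K N m
  gt : GoodTransport m

/-- density at time t -/
def Dn (m : Measure X) (π : Measure (Geo X)) (t : unitInterval) : X → ℝ≥0∞ :=
  (π.map (eval t)).rnDeriv m

/-- integrand in CD -/
def cdL (K N' : ℝ) (m : Measure X) (π : Measure (Geo X)) (t : unitInterval) (γ : Geo X) : ℝ≥0∞ :=
  sigmaCoeff K N' (1 - (t : ℝ)) (len γ) * (Dn m π 0 (eval 0 γ)) ^ (-(1 / N')) +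
  sigmaCoeff K N' (t : ℝ) (len γ) * (Dn m π 1 (eval 1 γ)) ^ (-(1 / N'))

/-- good plans -/
structure GoodPlan (m : Measure X) (π : Measure (Geo X)) : Prop where
  fin : IsFiniteMeasure π
  opt : ∀ π' : Measure (Geo X), π'.map (eval 0) = π.map (eval 0) →
    π'.map (eval 1) = π.map (eval 1) → transportCost π ≤ transportCost π'
  ac0 : π.map (eval 0) ≪ m
  ac1 : π.map (eval 1) ≪ m
  bdd : ∃ s : Set X, Bornology.IsBounded s ∧ ∀ᵐ γ ∂π, eval 0 γ ∈ s ∧ eval 1 γ ∈ s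

lemma transportCost_smul (c : ℝ≥0∞) (π : Measure (Geo X)) :
    transportCost (c • π) = c * transportCost π := by
  simp [transportCost, lintegral_smul_measure]

variable [BorelSpace X] [ProperSpace X]

lemma Dn_measurable (m : Measure X) (π : Measure (Geo X)) (t : unitInterval) :
    Measurable (Dn m π t) := Measure.measurable_rnDeriv _ _

lemma map_univ_eval (π : Measure (Geo X)) (t : unitInterval) :
    (π.map (eval t)) univ = π univ := by
  rw [Measure.map_apply (eval_measurable t) MeasurableSet.univ, preimage_univ]

lemma cost_ne_top {π : Measure (Geo X)} [IsFiniteMeasure π] {s : Set X}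
    (hs : Bornology.IsBounded s) (h : ∀ᵐ γ ∂π, eval 0 γ ∈ s ∧ eval 1 γ ∈ s) :
    transportCost π ≠ ⊤ := by
  obtain ⟨C, hC⟩ := Metric.isBounded_iff.1 hs
  have : transportCost π ≤ ∫⁻ _, ENNReal.ofReal (C ^ 2) ∂π := by
    apply lintegral_mono_ae
    filter_upwards [h] with γ hγ
    apply ENNReal.ofReal_le_ofReal
    have := hC hγ.1 hγ.2
    exact pow_le_pow_left₀ dist_nonneg this 2
  refine ne_top_of_le_ne_top ?_ this
  rw [lintegral_const]
  exact ENNReal.mul_ne_top ENNReal.ofReal_ne_top (measure_ne_top _ _)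

lemma secondMoment_of_bdd {μ : Measure X} [IsFiniteMeasure μ] {s : Set X} (x₀ : X)
    (hs : Bornology.IsBounded s) (h : ∀ᵐ y ∂μ, y ∈ s) : HasFiniteSecondMoment μ := by
  obtain ⟨C, hC⟩ := hs.subset_closedBall x₀
  refine ⟨x₀, ?_⟩
  have : ∫⁻ x, ENNReal.ofReal (dist x x₀ ^ 2) ∂μ ≤ ∫⁻ _, ENNReal.ofReal (C ^ 2) ∂μ := by
    apply lintegral_mono_ae
    filter_upwards [h] with γ hγ
    apply ENNReal.ofReal_le_ofReal
    exact pow_le_pow_left₀ dist_nonneg (mem_closedBall.1 (hC hγ)) 2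
  refine ne_top_of_le_ne_top ?_ this
  rw [lintegral_const]
  exact ENNReal.mul_ne_top ENNReal.ofReal_ne_top (measure_ne_top _ _)

lemma ae_map_closure {π : Measure (Geo X)} {s : Set X} (t : unitInterval)
    (h : ∀ᵐ γ ∂π, eval t γ ∈ s) : ∀ᵐ y ∂(π.map (eval t)), y ∈ closure s := by
  refine (ae_map_iff (p := fun y => y ∈ closure s) (eval_measurable t).aemeasurable
    isClosed_closure.measurableSet).2 ?_
  filter_upwards [h] with γ hγ using subset_closure hγ

lemma cd_of_opt {K N : ℝ} {m : Measure X} [SigmaFinite m] (H : Hyp K N m)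
    {π : Measure (Geo X)} (hπ : GoodPlan m π) {N' : ℝ} (hN' : N ≤ N') (h1 : 1 < N')
    (t : unitInterval) :
    ∫⁻ γ, cdL K N' m π t γ ∂π ≤ ∫⁻ x, (Dn m π t x) ^ (1 - 1 / N') ∂m := by
  have := hπ.fin
  by_cases hc0 : π univ = 0
  · rw [Measure.measure_univ_eq_zero] at hc0
    simp [hc0]
  set c := π univ with hc
  have hct : c ≠ ⊤ := measure_ne_top _ _
  have hi0 : c⁻¹ ≠ 0 := ENNReal.inv_ne_zero.2 hct
  have hit : c⁻¹ ≠ ⊤ := ENNReal.inv_ne_top.2 hc0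
  set π₁ := c⁻¹ • π with hπ₁
  have hP : IsProbabilityMeasure π₁ := ⟨by simp [hπ₁, ← hc, ENNReal.inv_mul_cancel hc0 hct]⟩
  have hmap : ∀ t : unitInterval, π₁.map (eval t) = c⁻¹ • π.map (eval t) := fun t => by
    rw [hπ₁, Measure.map_smul]
  obtain ⟨s, hs, hss⟩ := hπ.bdd
  have hopt : IsOptGeo (c⁻¹ • π.map (eval 0)) (c⁻¹ • π.map (eval 1)) π₁ := by
    refine ⟨hP, hmap 0, hmap 1, ?_⟩
    intro π' hπ' h0 h1
    have := hπ.opt (c • π') (by rw [Measure.map_smul, h0, smul_smul,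
      ENNReal.mul_inv_cancel hc0 hct, one_smul]) (by rw [Measure.map_smul, h1, smul_smul,
      ENNReal.mul_inv_cancel hc0 hct, one_smul])
    rw [transportCost_smul] at this
    rw [hπ₁, transportCost_smul]
    calc c⁻¹ * transportCost π ≤ c⁻¹ * (c * transportCost π') := by gcongr
      _ = transportCost π' := by rw [← mul_assoc, ENNReal.inv_mul_cancel hc0 hct, one_mul]
  have hp : ∀ t : unitInterval, IsProbabilityMeasure (c⁻¹ • π.map (eval t)) := fun t => by
    rw [← hmap]; exact Measure.isProbabilityMeasure_map (eval_measurable t).aemeasurable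
  have hne : Nonempty (Geo X) := by
    by_contra hne
    rw [not_nonempty_iff] at hne
    exact hc0 (by rw [hc, univ_eq_empty_iff.2 hne, measure_empty])
  obtain ⟨γ₀⟩ := hne
  have hb0 := ae_map_closure (π := π) 0 (hss.mono fun _ h => h.1)
  have hb1 := ae_map_closure (π := π) 1 (hss.mono fun _ h => h.2)
  obtain ⟨π₂, ho2, hcd⟩ := H.cd _ _ (hp 0) (hp 1) ⟨closure s, hs.closure, by
    rw [Measure.smul_apply]; rw [ae_iff] at hb0
    have : π.map (eval 0) (closure s)ᶜ = 0 := hb0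
    simp [this], by
    rw [Measure.smul_apply]; rw [ae_iff] at hb1
    have : π.map (eval 1) (closure s)ᶜ = 0 := hb1
    simp [this]⟩
  have := hp 0
  have := hp 1
  have huniq := (H.gt _ _ (hp 0) (hp 1)
    (secondMoment_of_bdd (eval 0 γ₀) hs.closure (Measure.ae_smul_measure hb0 _))
    (secondMoment_of_bdd (eval 0 γ₀) hs.closure (Measure.ae_smul_measure hb1 _))
    (hπ.ac0.smul_left _) (hπ.ac1.smul_left _)).1
  have h12 : π₂ = π₁ := huniq.unique ho2 hopt
  subst h12
  have hcd := hcd t N' hN'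
  have hN0 : 0 < N' := by linarith
  have hD : ∀ t : unitInterval, (π₁.map (eval t)).rnDeriv m =ᵐ[m] fun y => c⁻¹ * Dn m π t y := by
    intro t
    rw [hmap]
    filter_upwards [Measure.rnDeriv_smul_left_of_ne_top (π.map (eval t)) m hit] with y hy
    rw [hy]; rfl
  have hpow : ∀ (z : ℝ) (y : ℝ≥0∞), (c⁻¹ * y) ^ z = (c⁻¹) ^ z * y ^ z := by
    intro z y
    rw [ENNReal.mul_rpow_eq_ite]
    rw [if_neg]
    rintro ⟨h, _⟩
    rcases h with h | h
    · exact hi0 h.1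
    · exact hit h.1
  have hR : ∫⁻ x, ((π₁.map (eval t)).rnDeriv m x) ^ (1 - 1 / N') ∂m =
      (c⁻¹) ^ (1 - 1 / N') * ∫⁻ x, (Dn m π t x) ^ (1 - 1 / N') ∂m := by
    rw [← lintegral_const_mul _ ((Dn_measurable m π t).pow_const _)]
    apply lintegral_congr_ae
    filter_upwards [hD t] with y hy
    rw [hy, hpow]
  have hq0 : (c⁻¹) ^ (-(1 / N')) ≠ 0 := by
    simp only [ne_eq, ENNReal.rpow_eq_zero_iff, not_or, not_and]
    exact ⟨fun h => absurd h hi0, fun h => absurd h hit⟩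
  have hqt : (c⁻¹) ^ (-(1 / N')) ≠ ⊤ := by
    simp only [ne_eq, ENNReal.rpow_eq_top_iff, not_or, not_and]
    exact ⟨fun h => absurd h hi0, fun h => absurd h hit⟩
  have hr0 : (c⁻¹) ^ (1 - 1 / N') ≠ 0 := by
    simp only [ne_eq, ENNReal.rpow_eq_zero_iff, not_or, not_and]
    exact ⟨fun h => absurd h hi0, fun h => absurd h hit⟩
  have hrt : (c⁻¹) ^ (1 - 1 / N') ≠ ⊤ := by
    simp only [ne_eq, ENNReal.rpow_eq_top_iff, not_or, not_and]
    exact ⟨fun h => absurd h hi0, fun h => absurd h hit⟩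
  have hL : ∫⁻ γ, (sigmaCoeff K N' (1 - (t : ℝ)) (dist (eval 0 γ) (eval 1 γ)) *
                 ((π₁.map (eval 0)).rnDeriv m (eval 0 γ)) ^ (-(1 / N')) +
               sigmaCoeff K N' (t : ℝ) (dist (eval 0 γ) (eval 1 γ)) *
                 ((π₁.map (eval 1)).rnDeriv m (eval 1 γ)) ^ (-(1 / N'))) ∂π₁ =
      (c⁻¹) ^ (1 - 1 / N') * ∫⁻ γ, cdL K N' m π t γ ∂π := by
    have e1 : (c⁻¹) ^ (1 - 1 / N') = c⁻¹ * (c⁻¹) ^ (-(1 / N')) := by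
      rw [sub_eq_add_neg, ENNReal.rpow_add _ _ hi0 hit, ENNReal.rpow_one]
    rw [e1, mul_assoc, ← lintegral_const_mul' _ _ hqt]
    conv_lhs => rw [hπ₁, lintegral_smul_measure]
    rw [smul_eq_mul]
    congr 1
    apply lintegral_congr_ae
    have a0 := ae_of_ae_map (eval_measurable 0).aemeasurable (hπ.ac0.ae_le (hD 0))
    have a1 := ae_of_ae_map (eval_measurable 1).aemeasurable (hπ.ac1.ae_le (hD 1))
    rw [← hπ₁]
    filter_upwards [a0, a1] with γ g0 g1
    rw [g0, g1, hpow, hpow, cdL, len]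
    ring
  rw [hR, hL] at hcd
  exact (ENNReal.mul_le_mul_iff_right hr0 hrt).1 hcd

/-- restriction of good plans -/
lemma GoodPlan.mono {m : Measure X} {π ρ : Measure (Geo X)} (hπ : GoodPlan m π)
    (h : ρ ≤ π) : GoodPlan m ρ := by
  have := hπ.fin
  have hf : IsFiniteMeasure ρ := isFiniteMeasure_of_le π h
  have hac : ρ ≪ π := Measure.absolutelyContinuous_of_le h
  obtain ⟨s, hs, hss⟩ := hπ.bdd
  refine ⟨hf, ?_, (hac.map (eval_measurable 0)).trans hπ.ac0,
    (hac.map (eval_measurable 1)).trans hπ.ac1, s, hs, hac.ae_le hss⟩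
  intro π' h0 h1
  have hadd : π = (π - ρ) + ρ := (Measure.sub_add_cancel_of_le h).symm
  have key := hπ.opt ((π - ρ) + π') (by
    rw [Measure.map_add _ _ (eval_measurable 0), h0, ← Measure.map_add _ _ (eval_measurable 0),
      ← hadd]) (by
    rw [Measure.map_add _ _ (eval_measurable 1), h1, ← Measure.map_add _ _ (eval_measurable 1),
      ← hadd])
  have hadd' : ∀ a b : Measure (Geo X),
      transportCost (a + b) = transportCost a + transportCost b := by
    intro a b; simp [transportCost, lintegral_add_measure]
  have hfin : transportCost (π - ρ) ≠ ⊤ := by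
    have := cost_ne_top hs hss
    rw [hadd, hadd'] at this
    exact ne_top_of_le_ne_top this le_self_add
  rw [hadd', show transportCost π = transportCost (π - ρ) + transportCost ρ by
    rw [← hadd', ← hadd]] at key
  exact (ENNReal.add_le_add_iff_left hfin).1 key

end Plans

section SigmaBounds

lemma sigma_measurable (K N t : ℝ) : Measurable (fun θ => sigmaCoeff K N t θ) := by
  unfold sigmaCoeff
  refine Measurable.ite (measurableSet_le (by fun_prop) (by fun_prop)) measurable_const ?_
  refine Measurable.ite (measurableSet_lt (by fun_prop) (by fun_prop)) (by fun_prop) ?_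
  exact Measurable.ite (measurableSet_eq_fun (by fun_prop) (by fun_prop)) measurable_const
    (by fun_prop)

lemma sinh_ratio_lb {μ x : ℝ} (h0 : 0 ≤ μ) (h1 : μ ≤ 1) (hx : 0 < x) :
    μ * Real.exp (-(1 - μ) * x) ≤ Real.sinh (μ * x) / Real.sinh x := by
  rw [le_div_iff₀ (Real.sinh_pos_iff.2 hx)]
  have hconv := convexOn_exp.2 (mem_univ (0:ℝ)) (mem_univ (-2 * x)) (sub_nonneg.2 h1) h0
    (by ring)
  simp only [smul_eq_mul, mul_zero, zero_add, Real.exp_zero, mul_one] at hconv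
  have e1 : Real.sinh (μ * x) = Real.exp (μ * x) * (1 - Real.exp (μ * (-2 * x))) / 2 := by
    rw [Real.sinh_eq, mul_sub, ← Real.exp_add]; ring_nf
  have e2 : Real.sinh x = Real.exp x * (1 - Real.exp (-2 * x)) / 2 := by
    rw [Real.sinh_eq, mul_sub, ← Real.exp_add]; ring_nf
  have e3 : Real.exp (-(1 - μ) * x) * Real.exp x = Real.exp (μ * x) := by
    rw [← Real.exp_add]; ring_nf
  rw [e1, e2]
  calc μ * Real.exp (-(1 - μ) * x) * (Real.exp x * (1 - Real.exp (-2 * x)) / 2)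
      = (Real.exp (-(1 - μ) * x) * Real.exp x) * (μ * (1 - Real.exp (-2 * x))) / 2 := by ring
    _ ≤ Real.exp (μ * x) * (1 - Real.exp (μ * (-2 * x))) / 2 := by
        rw [e3]; gcongr; linarith

lemma sin_ratio_lb {μ x : ℝ} (h0 : 0 ≤ μ) (h1 : μ ≤ 1) (hx : 0 < x) (hx' : x < Real.pi) :
    μ ≤ Real.sin (μ * x) / Real.sin x := by
  rw [le_div_iff₀ (Real.sin_pos_of_pos_of_lt_pi hx hx')]
  have := strictConcaveOn_sin_Icc.concaveOn.2 (x := 0) ⟨le_rfl, Real.pi_pos.le⟩ (y := x)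
    ⟨hx.le, hx'.le⟩ (sub_nonneg.2 h1) h0 (by ring)
  simpa using this

lemma mul_sqrt_lt_pi {K N θ : ℝ} (hN : 0 < N) (hK : 0 < K) (hθ : 0 ≤ θ)
    (h : K * θ ^ 2 < N * Real.pi ^ 2) : θ * Real.sqrt (K / N) < Real.pi := by
  apply lt_of_pow_lt_pow_left₀ 2 Real.pi_pos.le
  rw [mul_pow, Real.sq_sqrt (div_pos hK hN).le, ← mul_div_assoc, div_lt_iff₀ hN]
  linarith

lemma sigma_lb {K N μ θ : ℝ} (hN : 0 < N) (h0 : 0 ≤ μ) (h1 : μ ≤ 1) (hθ : 0 ≤ θ) :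
    ENNReal.ofReal (μ * Real.exp (-(1 - μ) * (θ * Real.sqrt (|K| / N)))) ≤
      sigmaCoeff K N μ θ := by
  have hle : μ * Real.exp (-(1 - μ) * (θ * Real.sqrt (|K| / N))) ≤ μ := by
    have : Real.exp (-(1 - μ) * (θ * Real.sqrt (|K| / N))) ≤ 1 := by
      rw [Real.exp_le_one_iff]
      have : 0 ≤ (1 - μ) * (θ * Real.sqrt (|K| / N)) := by
        have := sub_nonneg.2 h1
        positivity
      linarith
    nlinarith
  unfold sigmaCoeff
  split_ifs with a b c
  · exact le_top
  · apply ENNReal.ofReal_le_ofReal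
    have hθ' : 0 < θ := by
      rcases hθ.lt_or_eq with h | h
      · exact h
      · rw [← h] at b; simp at b
    have hK : 0 < K := by
      by_contra h
      have := mul_nonneg (sub_nonneg.2 (not_lt.1 h)) (sq_nonneg θ)
      linarith
    refine hle.trans ?_
    rw [mul_assoc]
    exact sin_ratio_lb h0 h1 (mul_pos hθ' (Real.sqrt_pos.2 (div_pos hK hN)))
      (mul_sqrt_lt_pi hN hK hθ (not_le.1 a))
  · exact ENNReal.ofReal_le_ofReal hle
  · apply ENNReal.ofReal_le_ofReal
    have hθ' : 0 < θ := by
      rcases hθ.lt_or_eq with h | h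
      · exact h
      · rw [← h] at c; simp at c
    have hK : K < 0 := by
      by_contra h
      have := mul_nonneg (not_lt.1 h) (sq_nonneg θ)
      exact c (le_antisymm (not_lt.1 b) this)
    rw [mul_assoc, abs_of_neg hK]
    exact sinh_ratio_lb h0 h1 (mul_pos hθ' (Real.sqrt_pos.2 (div_pos (neg_pos.2 hK) hN)))

lemma sigma_pos {K N μ θ : ℝ} (hN : 0 < N) (h0 : 0 < μ) (h1 : μ ≤ 1) (hθ : 0 ≤ θ) :
    0 < sigmaCoeff K N μ θ :=
  lt_of_lt_of_le (ENNReal.ofReal_pos.2 (by positivity)) (sigma_lb hN h0.le h1 hθ)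

end SigmaBounds

section Core
variable [BorelSpace X] [ProperSpace X]

lemma cdL_measurable (K N' : ℝ) (m : Measure X) (π : Measure (Geo X)) (t : unitInterval) :
    Measurable (cdL K N' m π t) := by
  unfold cdL
  exact (((sigma_measurable _ _ _).comp len_measurable).mul
    (((Dn_measurable m π 0).comp (eval_measurable 0)).pow_const _)).add
    (((sigma_measurable _ _ _).comp len_measurable).mul
    (((Dn_measurable m π 1).comp (eval_measurable 1)).pow_const _))

lemma rnDeriv_mono_left {m μ ν : Measure X} [SigmaFinite m] [IsFiniteMeasure ν] (h : μ ≤ ν) :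
    μ.rnDeriv m ≤ᵐ[m] ν.rnDeriv m := by
  have : IsFiniteMeasure μ := isFiniteMeasure_of_le ν h
  have hadd : ν = (ν - μ) + μ := (Measure.sub_add_cancel_of_le h).symm
  have := Measure.rnDeriv_add (ν - μ) μ m
  rw [← hadd] at this
  filter_upwards [this] with y hy
  rw [hy]
  exact le_add_self

lemma Dn_mono {m : Measure X} [SigmaFinite m] {π ρ : Measure (Geo X)} [IsFiniteMeasure π]
    (h : ρ ≤ π) (t : unitInterval) : Dn m ρ t ≤ᵐ[m] Dn m π t :=
  rnDeriv_mono_left (Measure.map_mono h (eval_measurable t))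

lemma rpow_neg_anti {a b : ℝ≥0∞} {z : ℝ} (hz : z ≤ 0) (h : a ≤ b) : b ^ z ≤ a ^ z := by
  obtain ⟨w, rfl⟩ : ∃ w, z = -w := ⟨-z, by ring⟩
  rw [ENNReal.rpow_neg, ENNReal.rpow_neg, ENNReal.inv_le_inv]
  exact ENNReal.rpow_le_rpow h (by linarith)

lemma core_le {K N : ℝ} {m : Measure X} [SigmaFinite m] (H : Hyp K N m)
    {π ρ : Measure (Geo X)} (hπ : GoodPlan m π) (hρ : ρ ≤ π) {N' : ℝ} (hN' : N ≤ N')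
    (h1 : 1 < N') (t : unitInterval) :
    ∫⁻ γ, cdL K N' m π t γ ∂ρ ≤ ∫⁻ x, (Dn m ρ t x) ^ (1 - 1 / N') ∂m := by
  have := hπ.fin
  have hG := hπ.mono hρ
  refine le_trans ?_ (cd_of_opt H hG hN' h1 t)
  apply lintegral_mono_ae
  have a0 := ae_of_ae_map (eval_measurable 0).aemeasurable (hG.ac0.ae_le (Dn_mono (m := m) hρ 0))
  have a1 := ae_of_ae_map (eval_measurable 1).aemeasurable (hG.ac1.ae_le (Dn_mono (m := m) hρ 1))
  have hz : -(1 / N') ≤ 0 := by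
    have : 0 ≤ 1 / N' := by positivity
    linarith
  filter_upwards [a0, a1] with γ g0 g1
  unfold cdL
  exact add_le_add (mul_le_mul_right (rpow_neg_anti hz g0) _)
    (mul_le_mul_right (rpow_neg_anti hz g1) _)

lemma map_restrict_of_ae {π : Measure (Geo X)} {Γ : Set (Geo X)} {t : unitInterval} {S : Set X}
    (hS : MeasurableSet S) (h : Γ =ᵐ[π] (eval t) ⁻¹' S) :
    (π.restrict Γ).map (eval t) = (π.map (eval t)).restrict S := by
  rw [Measure.restrict_congr_set h, Measure.restrict_map (eval_measurable t) hS]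

lemma core_restrict {K N : ℝ} {m : Measure X} [SigmaFinite m] (H : Hyp K N m)
    {π : Measure (Geo X)} (hπ : GoodPlan m π) {Γ : Set (Geo X)} {N' : ℝ} (hN' : N ≤ N')
    (h1 : 1 < N') (t : unitInterval) {S : Set X}
    (hS : MeasurableSet S) (h : Γ =ᵐ[π] (eval t) ⁻¹' S) :
    ∫⁻ γ in Γ, cdL K N' m π t γ ∂π ≤ ∫⁻ x in S, (Dn m π t x) ^ (1 - 1 / N') ∂m := by
  have := hπ.fin
  refine (core_le H hπ (ρ := π.restrict Γ) Measure.restrict_le_self hN' h1 t).trans ?_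
  rw [← lintegral_indicator hS]
  apply le_of_eq
  apply lintegral_congr_ae
  have : Dn m (π.restrict Γ) t =ᵐ[m] S.indicator (Dn m π t) := by
    unfold Dn
    rw [map_restrict_of_ae hS h]
    exact Measure.rnDeriv_restrict _ _ hS
  filter_upwards [this] with y hy
  rw [hy]
  by_cases hyS : y ∈ S
  · simp [hyS]
  · have : 0 < 1 - 1 / N' := by
      rw [sub_pos, div_lt_one (by linarith)]; exact h1
    rw [indicator_of_notMem hyS, indicator_of_notMem hyS, ENNReal.zero_rpow_of_pos this]

lemma Dn_lt_top_ae {m : Measure X} [SigmaFinite m] {π : Measure (Geo X)} [IsFiniteMeasure π]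
    (t : unitInterval) (h : π.map (eval t) ≪ m) : ∀ᵐ γ ∂π, Dn m π t (eval t γ) < ⊤ :=
  ae_of_ae_map (eval_measurable t).aemeasurable (h.ae_le (Measure.rnDeriv_lt_top _ _))

lemma Dn_pos_ae {m : Measure X} [SigmaFinite m] {π : Measure (Geo X)} [IsFiniteMeasure π]
    (t : unitInterval) (h : π.map (eval t) ≪ m) : ∀ᵐ γ ∂π, 0 < Dn m π t (eval t γ) :=
  ae_of_ae_map (eval_measurable t).aemeasurable (Measure.rnDeriv_pos h)

/-- intermediate marginals are absolutely continuous -/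
lemma GoodPlan.ac {K N : ℝ} {m : Measure X} [SigmaFinite m] (H : Hyp K N m)
    {π : Measure (Geo X)} (hπ : GoodPlan m π) (t : unitInterval) :
    π.map (eval t) ≪ m := by
  have := hπ.fin
  by_cases ht1 : (t : ℝ) = 0
  · have : t = 0 := Subtype.ext ht1
    rw [this]; exact hπ.ac0
  have ht : 0 < (t : ℝ) := lt_of_le_of_ne t.2.1 (Ne.symm ht1)
  refine Measure.AbsolutelyContinuous.mk fun S hS h0 => ?_
  rw [Measure.map_apply (eval_measurable t) hS]
  have hN := H.hN
  have key := core_restrict H hπ (N' := N + 1) (by linarith) (by linarith) t hS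
    (Filter.EventuallyEq.refl _ ((eval t) ⁻¹' S))
  have hms : MeasurableSet ((eval t : Geo X → X) ⁻¹' S) := eval_measurable t hS
  rw [show ∫⁻ x in S, (Dn m π t x) ^ (1 - 1 / (N + 1)) ∂m = 0 by
    rw [Measure.restrict_eq_zero.2 h0, lintegral_zero_measure]] at key
  have k0 := (lintegral_eq_zero_iff (cdL_measurable _ _ _ _ _)).1 (le_antisymm key bot_le)
  rw [Filter.EventuallyEq, ae_restrict_iff' hms] at k0
  rw [← nonpos_iff_eq_zero, ← measure_empty (μ := π)]
  apply measure_mono_ae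
  filter_upwards [k0, Dn_lt_top_ae 1 hπ.ac1] with γ g1 g2 g3
  exfalso
  have := g1 g3
  simp only [cdL, Pi.zero_apply, add_eq_zero, mul_eq_zero] at this
  rcases this.2 with h | h
  · exact (sigma_pos (by linarith) ht t.2.2 (len_nonneg γ)).ne' h
  · rw [ENNReal.rpow_eq_zero_iff] at h
    rcases h with h | h
    · have : 0 ≤ 1 / (N + 1) := by positivity
      linarith [h.2]
    · exact g2.ne h.1

end Core

section RadialPlans
variable [BorelSpace X] [ProperSpace X]

/-- radial plans -/
structure RPlan (m : Measure X) (x : X) (π : Measure (Geo X)) : Prop where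
  fin : IsFiniteMeasure π
  ac0 : π.map (eval 0) ≪ m
  ac1 : π.map (eval 1) ≪ m
  bdd : ∃ R : ℝ, ∀ᵐ γ ∂π, dist x (eval 0 γ) ≤ R ∧ dist x (eval 1 γ) ≤ R
  rad : ∃ a b : ℝ, 0 < a ∧ ∀ᵐ γ ∂π, dist x (eval 1 γ) = a * dist x (eval 0 γ) + b ∧
    len γ = |dist x (eval 0 γ) - dist x (eval 1 γ)|

lemma RPlan.mono {m : Measure X} {x : X} {π ρ : Measure (Geo X)} (h : RPlan m x π)
    (hr : ρ ≤ π) : RPlan m x ρ := by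
  have := h.fin
  have hac : ρ ≪ π := Measure.absolutelyContinuous_of_le hr
  obtain ⟨R, hR⟩ := h.bdd
  obtain ⟨a, b, ha, hab⟩ := h.rad
  exact ⟨isFiniteMeasure_of_le π hr, (hac.map (eval_measurable 0)).trans h.ac0,
    (hac.map (eval_measurable 1)).trans h.ac1, ⟨R, hac.ae_le hR⟩, a, b, ha, hac.ae_le hab⟩

lemma RPlan.good {m : Measure X} {x : X} {π : Measure (Geo X)} (h : RPlan m x π) :
    GoodPlan m π := by
  have := h.fin
  obtain ⟨R, hR⟩ := h.bdd
  obtain ⟨a, b, ha, hab⟩ := h.rad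
  refine ⟨h.fin, ?_, h.ac0, h.ac1, closedBall x R, isBounded_closedBall, ?_⟩
  swap
  · filter_upwards [hR] with γ hγ
    exact ⟨by rw [mem_closedBall, dist_comm]; exact hγ.1,
      by rw [mem_closedBall, dist_comm]; exact hγ.2⟩
  intro π' h0 h1
  have hf : IsFiniteMeasure π' := ⟨by
    rw [← map_univ_eval π' 0, h0, map_univ_eval]; exact measure_lt_top _ _⟩
  have hrm : Measurable (fun y : X => dist x y) := (continuous_const.dist continuous_id).measurable
  have hR' : ∀ᵐ γ ∂π', dist x (eval 0 γ) ≤ R ∧ dist x (eval 1 γ) ≤ R := by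
    have hms : MeasurableSet {y : X | dist x y ≤ R} := measurableSet_le hrm measurable_const
    have b0 : ∀ᵐ γ ∂π', dist x (eval 0 γ) ≤ R := by
      have : ∀ᵐ y ∂(π.map (eval 0)), dist x y ≤ R :=
        (ae_map_iff (p := fun y => dist x y ≤ R) (eval_measurable 0).aemeasurable hms).2
          (hR.mono fun _ h => h.1)
      rw [← h0] at this
      exact ae_of_ae_map (eval_measurable 0).aemeasurable this
    have b1 : ∀ᵐ γ ∂π', dist x (eval 1 γ) ≤ R := by
      have : ∀ᵐ y ∂(π.map (eval 1)), dist x y ≤ R :=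
        (ae_map_iff (p := fun y => dist x y ≤ R) (eval_measurable 1).aemeasurable hms).2
          (hR.mono fun _ h => h.2)
      rw [← h1] at this
      exact ae_of_ae_map (eval_measurable 1).aemeasurable this
    filter_upwards [b0, b1] with γ g0 g1 using ⟨g0, g1⟩
  set F : ℝ → ℝ := fun r => a * r ^ 2 - a ^ 2 * r ^ 2 - 2 * a * b * r with hF
  set G : ℝ → ℝ := fun r => a * r ^ 2 - r ^ 2 + 2 * b * r - b ^ 2 with hG
  have hcF : Continuous F := by fun_prop
  have hcG : Continuous G := by fun_prop
  have hd0 : Continuous fun γ : Geo X => dist x (eval 0 γ) := continuous_const.dist (eval_continuous 0)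
  have hd1 : Continuous fun γ : Geo X => dist x (eval 1 γ) := continuous_const.dist (eval_continuous 1)
  have intg : ∀ (ρ : Measure (Geo X)) [IsFiniteMeasure ρ],
      (∀ᵐ γ ∂ρ, dist x (eval 0 γ) ≤ R ∧ dist x (eval 1 γ) ≤ R) →
      ∀ Φ : ℝ → ℝ → ℝ, Continuous (fun p : ℝ × ℝ => Φ p.1 p.2) →
      Integrable (fun γ => Φ (dist x (eval 0 γ)) (dist x (eval 1 γ))) ρ := by
    intro ρ _ hρ Φ hΦ
    obtain ⟨C, hC⟩ := ((isCompact_Icc (a := (0:ℝ)) (b := R)).prod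
      (isCompact_Icc (a := (0:ℝ)) (b := R))).exists_bound_of_continuousOn hΦ.continuousOn
    refine Integrable.of_bound (hΦ.comp (hd0.prodMk hd1)).aestronglyMeasurable C ?_
    filter_upwards [hρ] with γ hγ
    exact hC (dist x (eval 0 γ), dist x (eval 1 γ)) ⟨⟨dist_nonneg, hγ.1⟩, ⟨dist_nonneg, hγ.2⟩⟩
  have eqF : ∫ γ, F (dist x (eval 0 γ)) ∂π = ∫ γ, F (dist x (eval 0 γ)) ∂π' := by
    rw [← integral_map (φ := eval 0) (f := fun y => F (dist x y)) (eval_measurable 0).aemeasurable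
        (hcF.measurable.comp hrm).aestronglyMeasurable, ← h0,
      integral_map (φ := eval 0) (f := fun y => F (dist x y)) (eval_measurable 0).aemeasurable
        (hcF.measurable.comp hrm).aestronglyMeasurable]
  have eqG : ∫ γ, G (dist x (eval 1 γ)) ∂π = ∫ γ, G (dist x (eval 1 γ)) ∂π' := by
    rw [← integral_map (φ := eval 1) (f := fun y => G (dist x y)) (eval_measurable 1).aemeasurable
        (hcG.measurable.comp hrm).aestronglyMeasurable, ← h1,
      integral_map (φ := eval 1) (f := fun y => G (dist x y)) (eval_measurable 1).aemeasurable
        (hcG.measurable.comp hrm).aestronglyMeasurable]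
  have iF := fun (ρ : Measure (Geo X)) [IsFiniteMeasure ρ] hρ =>
    intg ρ hρ (fun u v => F u) (hcF.comp continuous_fst)
  have iG := fun (ρ : Measure (Geo X)) [IsFiniteMeasure ρ] hρ =>
    intg ρ hρ (fun u v => G v) (hcG.comp continuous_snd)
  have iS := fun (ρ : Measure (Geo X)) [IsFiniteMeasure ρ] hρ =>
    intg ρ hρ (fun u v => (u - v) ^ 2) (by fun_prop)
  have hle : ∫ γ, a * (dist x (eval 0 γ) - dist x (eval 1 γ)) ^ 2 ∂π ≤
      ∫ γ, a * (dist x (eval 0 γ) - dist x (eval 1 γ)) ^ 2 ∂π' := by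
    calc ∫ γ, a * (dist x (eval 0 γ) - dist x (eval 1 γ)) ^ 2 ∂π
        = ∫ γ, (F (dist x (eval 0 γ)) + G (dist x (eval 1 γ))) ∂π := by
          apply integral_congr_ae
          filter_upwards [hab] with γ hγ
          simp only [hF, hG, hγ.1]; ring
      _ = ∫ γ, (F (dist x (eval 0 γ)) + G (dist x (eval 1 γ))) ∂π' := by
          rw [integral_add (iF π hR) (iG π hR), integral_add (iF π' hR') (iG π' hR'), eqF, eqG]
      _ ≤ _ := by
          apply integral_mono ((iF π' hR').add (iG π' hR')) ((iS π' hR').const_mul a)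
          intro γ
          simp only [hF, hG, Pi.add_apply]
          nlinarith [sq_nonneg (dist x (eval 1 γ) - a * dist x (eval 0 γ) - b)]
  rw [integral_const_mul, integral_const_mul] at hle
  have hle := le_of_mul_le_mul_left hle ha
  calc transportCost π
      = ∫⁻ γ, ENNReal.ofReal ((dist x (eval 0 γ) - dist x (eval 1 γ)) ^ 2) ∂π := by
        apply lintegral_congr_ae
        filter_upwards [hab] with γ hγ
        have := hγ.2
        unfold len at this
        rw [this, sq_abs]
    _ = ENNReal.ofReal (∫ γ, (dist x (eval 0 γ) - dist x (eval 1 γ)) ^ 2 ∂π) :=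
        (ofReal_integral_eq_lintegral_ofReal (iS π hR) (ae_of_all _ fun _ => sq_nonneg _)).symm
    _ ≤ ENNReal.ofReal (∫ γ, (dist x (eval 0 γ) - dist x (eval 1 γ)) ^ 2 ∂π') :=
        ENNReal.ofReal_le_ofReal hle
    _ = ∫⁻ γ, ENNReal.ofReal ((dist x (eval 0 γ) - dist x (eval 1 γ)) ^ 2) ∂π' :=
        ofReal_integral_eq_lintegral_ofReal (iS π' hR') (ae_of_all _ fun _ => sq_nonneg _)
    _ ≤ transportCost π' := by
        apply lintegral_mono
        intro γ
        apply ENNReal.ofReal_le_ofReal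
        rw [← sq_abs]
        refine pow_le_pow_left₀ (abs_nonneg _) ?_ 2
        rw [dist_comm x, dist_comm x]
        exact abs_dist_sub_le _ _ _

lemma rad_eval {x : X} {γ : Geo X} (h : len γ = |dist x (eval 0 γ) - dist x (eval 1 γ)|)
    (t : unitInterval) :
    dist x (eval t γ) = (1 - t) * dist x (eval 0 γ) + t * dist x (eval 1 γ) := by
  have h0 := dist_eval γ 0 t
  have h1 := dist_eval γ t 1
  have ht := t.2
  have a0 : |((0:unitInterval):ℝ) - t| = t := by simp [abs_of_nonneg ht.1]
  have a1 : |(t:ℝ) - ((1:unitInterval):ℝ)| = 1 - t := by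
    rw [abs_of_nonpos (by simpa using ht.2)]; simp
  rw [a0] at h0
  rw [a1] at h1
  have t1 := dist_triangle x (eval 0 γ) (eval t γ)
  have t2 := dist_triangle x (eval t γ) (eval 0 γ)
  have t3 := dist_triangle x (eval 1 γ) (eval t γ)
  have t4 := dist_triangle x (eval t γ) (eval 1 γ)
  rw [dist_comm (eval t γ) (eval 0 γ)] at t2
  rw [dist_comm (eval 1 γ) (eval t γ)] at t3
  rcases abs_cases (dist x (eval 0 γ) - dist x (eval 1 γ)) with hc | hc <;>
  · rw [hc.1] at h
    rw [h] at h0 h1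
    nlinarith

/-- subsegment plan -/
lemma RPlan.sub {K N : ℝ} {m : Measure X} [SigmaFinite m] (H : Hyp K N m) {x : X}
    {π : Measure (Geo X)} (h : RPlan m x π) (u v : unitInterval) :
    RPlan m x (π.map (fun γ => subseg γ u v)) := by
  have hms : Measurable (fun γ : Geo X => subseg γ u v) :=
    subseg_measurable measurable_id measurable_const measurable_const
  have := h.fin
  have hm0 : (π.map (fun γ => subseg γ u v)).map (eval 0) = π.map (eval u) := by
    rw [Measure.map_map (eval_measurable 0) hms]; congr 1; ext γ; simp
  have hm1 : (π.map (fun γ => subseg γ u v)).map (eval 1) = π.map (eval v) := by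
    rw [Measure.map_map (eval_measurable 1) hms]; congr 1; ext γ; simp
  obtain ⟨R, hR⟩ := h.bdd
  obtain ⟨a, b, ha, hab⟩ := h.rad
  have hpos : ∀ u : unitInterval, 0 < 1 - (u:ℝ) + u * a := by
    intro u
    rcases u.2.1.lt_or_eq with hu | hu
    · have := mul_pos hu ha
      have := u.2.2
      linarith
    · rw [← hu]; simp
  have hd : ∀ t : unitInterval, Measurable fun γ : Geo X => dist x (eval t γ) := fun t =>
    (continuous_const.dist (eval_continuous t)).measurable
  refine ⟨Measure.isFiniteMeasure_map _ _, hm0 ▸ h.good.ac H u, hm1 ▸ h.good.ac H v, ⟨R, ?_⟩,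
    (1 - v + v * a) / (1 - u + u * a), v * b - (1 - v + v * a) / (1 - u + u * a) * (u * b),
    div_pos (hpos v) (hpos u), ?_⟩
  · refine (ae_map_iff hms.aemeasurable ((measurableSet_le (hd 0) measurable_const).inter
      (measurableSet_le (hd 1) measurable_const))).2 ?_
    filter_upwards [hab, hR] with γ hγ hγR
    show dist x (eval 0 (subseg γ u v)) ≤ R ∧ dist x (eval 1 (subseg γ u v)) ≤ R
    rw [eval_subseg_zero, eval_subseg_one, rad_eval hγ.2 u, rad_eval hγ.2 v]
    have hu := u.2
    have hv := v.2
    constructor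
    · have := mul_le_mul_of_nonneg_left hγR.1 (sub_nonneg.2 hu.2)
      have := mul_le_mul_of_nonneg_left hγR.2 hu.1
      linarith
    · have := mul_le_mul_of_nonneg_left hγR.1 (sub_nonneg.2 hv.2)
      have := mul_le_mul_of_nonneg_left hγR.2 hv.1
      linarith
  · refine (ae_map_iff hms.aemeasurable ((measurableSet_eq_fun (hd 1)
      (((hd 0).const_mul _).add_const _)).inter
      (measurableSet_eq_fun len_measurable ((hd 0).sub (hd 1)).abs))).2 ?_
    filter_upwards [hab, hR] with γ hγ hγR
    have hlen : len (subseg γ u v) = |(u:ℝ) - v| * len γ := by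
      unfold len
      rw [eval_subseg_zero, eval_subseg_one, dist_eval]; rfl
    show dist x (eval 1 (subseg γ u v)) = (1 - v + v * a) / (1 - u + u * a) *
      dist x (eval 0 (subseg γ u v)) + (v * b - (1 - v + v * a) / (1 - u + u * a) * (u * b)) ∧
      len (subseg γ u v) = |dist x (eval 0 (subseg γ u v)) - dist x (eval 1 (subseg γ u v))|
    rw [hlen, eval_subseg_zero, eval_subseg_one, rad_eval hγ.2 u, rad_eval hγ.2 v]
    constructor
    · rw [hγ.1]
      have hq := div_mul_cancel₀ (1 - (v:ℝ) + v * a) (hpos u).ne'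
      linear_combination - dist x (eval 0 γ) * hq
    · rw [hγ.2, ← abs_mul, ← abs_neg]
      congr 1; ring

end RadialPlans

section Inj
variable [BorelSpace X] [ProperSpace X]

lemma mul_rpow_aux {N' : ℝ} (h1 : 1 < N') {y : ℝ≥0∞} (hy : y < ⊤) :
    y * y ^ (-(1 / N')) = y ^ (1 - 1 / N') := by
  by_cases h0 : y = 0
  · have : 0 < 1 - 1 / N' := by
      rw [sub_pos, div_lt_one (by linarith)]; exact h1
    rw [h0, zero_mul, ENNReal.zero_rpow_of_pos this]
  · rw [sub_eq_add_neg, ENNReal.rpow_add _ _ h0 hy.ne, ENNReal.rpow_one]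

lemma ent_eq {m : Measure X} [SigmaFinite m] {π : Measure (Geo X)} [IsFiniteMeasure π]
    {N' : ℝ} (h1 : 1 < N') (t : unitInterval) (hac : π.map (eval t) ≪ m) {S : Set X}
    (hS : MeasurableSet S) :
    ∫⁻ γ in (eval t) ⁻¹' S, (Dn m π t (eval t γ)) ^ (-(1 / N')) ∂π =
      ∫⁻ y in S, (Dn m π t y) ^ (1 - 1 / N') ∂m := by
  have hf : Measurable fun y => (Dn m π t y) ^ (-(1 / N')) := (Dn_measurable m π t).pow_const _
  rw [← setLIntegral_map hS hf (eval_measurable t),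
    ← setLIntegral_rnDeriv_mul hac hf.aemeasurable hS]
  apply lintegral_congr_ae
  filter_upwards [ae_restrict_of_ae (Measure.rnDeriv_lt_top (π.map (eval t)) m)] with y hy
  exact mul_rpow_aux h1 hy

lemma ent_eq' {m : Measure X} [SigmaFinite m] {π : Measure (Geo X)} [IsFiniteMeasure π]
    {N' : ℝ} (h1 : 1 < N') (t : unitInterval) (hac : π.map (eval t) ≪ m) :
    ∫⁻ γ, (Dn m π t (eval t γ)) ^ (-(1 / N')) ∂π =
      ∫⁻ y, (Dn m π t y) ^ (1 - 1 / N') ∂m := by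
  have := ent_eq (m := m) (π := π) h1 t hac MeasurableSet.univ
  simpa using this

lemma Dn_subseg (m : Measure X) (π : Measure (Geo X)) (u v t : unitInterval) :
    Dn m (π.map (fun γ => subseg γ u v)) t = Dn m π (cmb u v t) := by
  have hms : Measurable (fun γ : Geo X => subseg γ u v) :=
    subseg_measurable measurable_id measurable_const measurable_const
  unfold Dn
  rw [Measure.map_map (eval_measurable t) hms]; rfl

lemma len_subseg (γ : Geo X) (u v : unitInterval) :
    len (subseg γ u v) = |(u:ℝ) - v| * len γ := by
  unfold len
  rw [eval_subseg_zero, eval_subseg_one, dist_eval]; rfl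

lemma len_subseg_le (γ : Geo X) (u v : unitInterval) : len (subseg γ u v) ≤ len γ := by
  rw [len_subseg]
  have : |(u:ℝ) - v| ≤ 1 := by
    rw [abs_le]
    have := u.2.1; have := u.2.2; have := v.2.1; have := v.2.2
    constructor <;> linarith
  nlinarith [len_nonneg γ]

lemma ent_lb {K N : ℝ} {m : Measure X} [SigmaFinite m] (H : Hyp K N m) {x : X}
    {ρ : Measure (Geo X)} (h : RPlan m x ρ) {L : ℝ} (hL : ∀ᵐ γ ∂ρ, len γ ≤ L)
    {N' : ℝ} (hN' : N ≤ N') (h1 : 1 < N') (u v l : unitInterval) :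
    ENNReal.ofReal ((1 - l) * Real.exp (- l * (L * Real.sqrt (|K| / N')))) *
      ∫⁻ y, (Dn m ρ u y) ^ (1 - 1 / N') ∂m ≤
      ∫⁻ y, (Dn m ρ (cmb u v l) y) ^ (1 - 1 / N') ∂m := by
  have hms : Measurable (fun γ : Geo X => subseg γ u v) :=
    subseg_measurable measurable_id measurable_const measurable_const
  have hs := h.sub H u v
  have := hs.fin
  have key := cd_of_opt H hs.good hN' h1 l
  rw [Dn_subseg] at key
  refine le_trans ?_ key
  have e0 : Dn m ρ u = Dn m (ρ.map (fun γ => subseg γ u v)) 0 := by rw [Dn_subseg, cmb_zero]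
  have hmm : Measurable fun γ : Geo X =>
      (Dn m (ρ.map (fun γ => subseg γ u v)) 0 (eval 0 γ)) ^ (-(1 / N')) :=
    ((Dn_measurable m _ 0).comp (eval_measurable 0)).pow_const _
  rw [e0, ← ent_eq' h1 0 hs.ac0, ← lintegral_const_mul _ hmm]
  apply lintegral_mono_ae
  have hL' : ∀ᵐ γ ∂(ρ.map (fun γ => subseg γ u v)), len γ ≤ L := by
    refine (ae_map_iff (p := fun γ => len γ ≤ L) hms.aemeasurable
      (measurableSet_le len_measurable measurable_const)).2 ?_
    filter_upwards [hL] with γ hγ using (len_subseg_le γ u v).trans hγ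
  filter_upwards [hL'] with γ hγ
  unfold cdL
  refine le_trans ?_ le_self_add
  refine mul_le_mul_left (le_trans ?_ (sigma_lb (by linarith) (sub_nonneg.2 l.2.2)
    (by linarith [l.2.1]) (len_nonneg γ))) _
  apply ENNReal.ofReal_le_ofReal
  have : 0 ≤ 1 - (l:ℝ) := sub_nonneg.2 l.2.2
  refine mul_le_mul_of_nonneg_left (Real.exp_le_exp.2 ?_) this
  have h2 := mul_le_mul_of_nonneg_right hγ (Real.sqrt_nonneg (|K| / N'))
  have h3 := mul_le_mul_of_nonneg_left h2 l.2.1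
  linarith

lemma ent_finite {K N : ℝ} {m : Measure X} [SigmaFinite m] (H : Hyp K N m) {x : X}
    {ρ : Measure (Geo X)} (h : RPlan m x ρ) {N' : ℝ} (h1 : 1 < N') (t : unitInterval) :
    ∫⁻ y, (Dn m ρ t y) ^ (1 - 1 / N') ∂m ≠ ⊤ := by
  have := h.fin
  obtain ⟨R, hR⟩ := h.bdd
  obtain ⟨a, b, ha, hab⟩ := h.rad
  have hp : 0 < 1 - 1 / N' := by rw [sub_pos, div_lt_one (by linarith)]; exact h1
  have hp1 : 1 - 1 / N' ≤ 1 := by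
    have : 0 ≤ 1 / N' := by positivity
    linarith
  have hms : MeasurableSet (closedBall x R) := isClosed_closedBall.measurableSet
  have hball : ∀ᵐ γ ∂ρ, eval t γ ∈ closedBall x R := by
    filter_upwards [hab, hR] with γ hγ hγR
    rw [mem_closedBall, dist_comm, rad_eval hγ.2 t]
    have := mul_le_mul_of_nonneg_left hγR.1 (sub_nonneg.2 t.2.2)
    have := mul_le_mul_of_nonneg_left hγR.2 t.2.1
    linarith
  have hmap : (ρ.map (eval t)) = (ρ.map (eval t)).restrict (closedBall x R) := by
    rw [Measure.restrict_eq_self_of_ae_mem]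
    exact (ae_map_iff (p := fun y => y ∈ closedBall x R) (eval_measurable t).aemeasurable hms).2
      hball
  have hD : Dn m ρ t =ᵐ[m] (closedBall x R).indicator (Dn m ρ t) := by
    have := Measure.rnDeriv_restrict (ρ.map (eval t)) m hms
    rw [← hmap] at this
    exact this
  have hle : ∫⁻ y, (Dn m ρ t y) ^ (1 - 1 / N') ∂m ≤
      ∫⁻ y, ((closedBall x R).indicator (fun _ => 1) y + Dn m ρ t y) ∂m := by
    apply lintegral_mono_ae
    filter_upwards [hD] with y hy
    by_cases hyb : y ∈ closedBall x R
    · rw [indicator_of_mem hyb]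
      rcases le_total (Dn m ρ t y) 1 with h | h
      · refine le_trans (ENNReal.rpow_le_one h hp.le) le_self_add
      · refine le_trans ?_ le_add_self
        calc _ ≤ (Dn m ρ t y) ^ (1:ℝ) := ENNReal.rpow_le_rpow_of_exponent_le h hp1
          _ = _ := ENNReal.rpow_one _
    · rw [hy, indicator_of_notMem hyb, ENNReal.zero_rpow_of_pos hp]
      exact bot_le
  refine ne_top_of_le_ne_top ?_ hle
  rw [lintegral_add_right _ (Dn_measurable m ρ t), lintegral_indicator hms]
  refine ENNReal.add_ne_top.2 ⟨?_, ?_⟩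
  · simpa using H.bdd _ isBounded_closedBall
  · exact ne_top_of_le_ne_top (measure_ne_top (ρ.map (eval t)) univ)
      (Measure.lintegral_rnDeriv_le)

lemma map_withDensity_comp {Ω Y : Type*} [MeasurableSpace Ω] [MeasurableSpace Y]
    {μ : Measure Ω} {f : Ω → Y} (hf : Measurable f) {w : Y → ℝ≥0∞} (hw : Measurable w) :
    (μ.withDensity (fun ω => w (f ω))).map f = (μ.map f).withDensity w := by
  ext s hs
  rw [Measure.map_apply hf hs, withDensity_apply _ (hf hs), withDensity_apply _ hs,
    setLIntegral_map hs hw hf]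

/-- closeness of times -/
def Close (c : unitInterval → ℝ) (ε : ℝ) (s t : unitInterval) : Prop :=
  (∃ v l, cmb t v l = s ∧ ε < c l) ∧ (∃ v l, cmb s v l = t ∧ ε < c l)

/-- sets determined at time t -/
def InG (π : Measure (Geo X)) (t : unitInterval) (Γ : Set (Geo X)) : Prop :=
  ∃ S : Set X, MeasurableSet S ∧ Γ =ᵐ[π] (eval t) ⁻¹' S

lemma inj_close {K N : ℝ} {m : Measure X} [SigmaFinite m] (H : Hyp K N m) {x : X}
    {π : Measure (Geo X)} (h : RPlan m x π) {L : ℝ} (hL : ∀ᵐ γ ∂π, len γ ≤ L)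
    {N' : ℝ} (hN' : N ≤ N') (h1 : 1 < N') {s t : unitInterval} {ε : ℝ} (hε : 0 < ε)
    (hε2 : (2:ℝ) ^ (-(1 / N')) ≤ ε * ε)
    (hst : Close (fun l => (1 - l) * Real.exp (- l * (L * Real.sqrt (|K| / N')))) ε s t)
    {B : Set X} (hB : MeasurableSet B) : InG π t ((eval s) ⁻¹' B) := by
  have := h.fin
  have hp : 0 < 1 - 1 / N' := by rw [sub_pos, div_lt_one (by linarith)]; exact h1
  set p := 1 - 1 / N' with hpdef
  obtain ⟨⟨v1, l1, hl1, hc1⟩, v2, l2, hl2, hc2⟩ := hst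
  have hmB : MeasurableSet ((eval s : Geo X → X) ⁻¹' B) := eval_measurable s hB
  set π1 := π.restrict ((eval s) ⁻¹' B) with hπ1
  set π2 := π.restrict ((eval s) ⁻¹' B)ᶜ with hπ2
  have hle1 : π1 ≤ π := Measure.restrict_le_self
  have hle2 : π2 ≤ π := Measure.restrict_le_self
  have hact := h.good.ac H t
  have hac1 : π1.map (eval t) ≪ m :=
    ((Measure.absolutelyContinuous_of_le hle1).map (eval_measurable t)).trans hact
  have hac2 : π2.map (eval t) ≪ m :=
    ((Measure.absolutelyContinuous_of_le hle2).map (eval_measurable t)).trans hact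
  set p1 := Dn m π1 t with hp1
  set p2 := Dn m π2 t with hp2
  have hmp1 : Measurable p1 := Dn_measurable _ _ _
  have hmp2 : Measurable p2 := Dn_measurable _ _ _
  set κ : X → ℝ≥0∞ := fun y => min (p1 y) (p2 y) with hκ
  have hmκ : Measurable κ := hmp1.min hmp2
  have hd1 : π1.map (eval t) = m.withDensity p1 := (Measure.withDensity_rnDeriv_eq _ _ hac1).symm
  have hd2 : π2.map (eval t) = m.withDensity p2 := (Measure.withDensity_rnDeriv_eq _ _ hac2).symm
  have hp1t : ∀ᵐ y ∂m, p1 y < ⊤ := Measure.rnDeriv_lt_top _ _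
  have hp2t : ∀ᵐ y ∂m, p2 y < ⊤ := Measure.rnDeriv_lt_top _ _
  have hwd : ∀ (ρ : Measure (Geo X)) (q : X → ℝ≥0∞), Measurable q → ρ.map (eval t) = m.withDensity q →
      (∀ᵐ y ∂m, q y < ⊤) → (∀ y, κ y ≤ q y) →
      ((ρ.withDensity (fun γ => (fun y => κ y / q y) (eval t γ))).map (eval t) = m.withDensity κ ∧
        ρ.withDensity (fun γ => (fun y => κ y / q y) (eval t γ)) ≤ ρ) := by
    intro ρ q hq hρ hqt hle
    constructor
    · have hmd : Measurable fun y => κ y / q y := hmκ.div hq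
      rw [map_withDensity_comp (eval_measurable t) hmd, hρ, ← withDensity_mul _ hq hmd]
      apply withDensity_congr_ae
      filter_upwards [hqt] with y hy
      simp only [Pi.mul_apply]
      by_cases h0 : q y = 0
      · have := hle y
        rw [h0, nonpos_iff_eq_zero] at this
        rw [h0, this, zero_mul]
      · exact ENNReal.mul_div_cancel h0 hy.ne
    · have : (fun γ : Geo X => (fun y => κ y / q y) (eval t γ)) ≤ fun _ => 1 := by
        intro γ
        exact ENNReal.div_le_of_le_mul (by rw [one_mul]; exact hle _)
      calc _ ≤ ρ.withDensity (fun _ => 1) := withDensity_mono (ae_of_all _ this)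
        _ = ρ := withDensity_one
  obtain ⟨hP1, hP1le⟩ := hwd π1 p1 hmp1 hd1 hp1t (fun y => min_le_left _ _)
  obtain ⟨hP2, hP2le⟩ := hwd π2 p2 hmp2 hd2 hp2t (fun y => min_le_right _ _)
  set P1 := π1.withDensity (fun γ => (fun y => κ y / p1 y) (eval t γ)) with hP1def
  set P2 := π2.withDensity (fun γ => (fun y => κ y / p2 y) (eval t γ)) with hP2def
  have hsum : P1 + P2 ≤ π := by
    calc P1 + P2 ≤ π1 + π2 := add_le_add hP1le hP2le
      _ = π := Measure.restrict_add_restrict_compl hmB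
  have hR1 : RPlan m x P1 := h.mono (hP1le.trans hle1)
  have hR2 : RPlan m x P2 := h.mono (hP2le.trans hle2)
  have hR12 : RPlan m x (P1 + P2) := h.mono hsum
  have := hR1.fin
  have := hR2.fin
  have := hR12.fin
  have aL : ∀ {ρ : Measure (Geo X)}, ρ ≤ π → ∀ᵐ γ ∂ρ, len γ ≤ L := fun hρ =>
    (Measure.absolutelyContinuous_of_le hρ).ae_le hL
  have b1 := ent_lb H hR1 (aL (hP1le.trans hle1)) hN' h1 t v1 l1
  have b2 := ent_lb H hR2 (aL (hP2le.trans hle2)) hN' h1 t v1 l1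
  have b12 := ent_lb H hR12 (aL hsum) hN' h1 s v2 l2
  rw [hl1] at b1 b2
  rw [hl2] at b12
  have D1 : Dn m P1 t =ᵐ[m] κ := by
    unfold Dn; rw [hP1]; exact Measure.rnDeriv_withDensity _ hmκ
  have D2 : Dn m P2 t =ᵐ[m] κ := by
    unfold Dn; rw [hP2]; exact Measure.rnDeriv_withDensity _ hmκ
  have Dadd : ∀ r, Dn m (P1 + P2) r =ᵐ[m] Dn m P1 r + Dn m P2 r := by
    intro r
    unfold Dn
    rw [Measure.map_add _ _ (eval_measurable r)]
    exact Measure.rnDeriv_add _ _ _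
  set E := ∫⁻ y, (κ y) ^ p ∂m with hE
  have E1 : ∫⁻ y, (Dn m P1 t y) ^ p ∂m = E := by
    apply lintegral_congr_ae; filter_upwards [D1] with y hy; rw [hy]
  have E2 : ∫⁻ y, (Dn m P2 t y) ^ p ∂m = E := by
    apply lintegral_congr_ae; filter_upwards [D2] with y hy; rw [hy]
  have hEfin : E ≠ ⊤ := by rw [← E1]; exact ent_finite H hR1 h1 t
  have E12 : ∫⁻ y, (Dn m (P1 + P2) t y) ^ p ∂m = (2:ℝ≥0∞) ^ p * E := by
    rw [hE, ← lintegral_const_mul _ (hmκ.pow_const _)]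
    apply lintegral_congr_ae
    filter_upwards [D1, D2, Dadd t] with y hy1 hy2 hy3
    rw [hy3, Pi.add_apply, hy1, hy2, ← two_mul, ENNReal.mul_rpow_of_nonneg _ _ hp.le]
  have Ind1 : Dn m P1 s =ᵐ[m] B.indicator (Dn m P1 s) := by
    have hmm : (P1.map (eval s)) = (P1.map (eval s)).restrict B := by
      rw [Measure.restrict_eq_self_of_ae_mem]
      refine (ae_map_iff (p := fun y => y ∈ B) (eval_measurable s).aemeasurable hB).2 ?_
      exact (Measure.absolutelyContinuous_of_le hP1le).ae_le (ae_restrict_mem hmB)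
    have := Measure.rnDeriv_restrict (P1.map (eval s)) m hB
    rw [← hmm] at this
    exact this
  have Ind2 : Dn m P2 s =ᵐ[m] Bᶜ.indicator (Dn m P2 s) := by
    have hmm : (P2.map (eval s)) = (P2.map (eval s)).restrict Bᶜ := by
      rw [Measure.restrict_eq_self_of_ae_mem]
      refine (ae_map_iff (p := fun y => y ∈ Bᶜ) (eval_measurable s).aemeasurable hB.compl).2 ?_
      exact (Measure.absolutelyContinuous_of_le hP2le).ae_le (ae_restrict_mem hmB.compl)
    have := Measure.rnDeriv_restrict (P2.map (eval s)) m hB.compl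
    rw [← hmm] at this
    exact this
  have Es : ∫⁻ y, (Dn m (P1 + P2) s y) ^ p ∂m =
      ∫⁻ y, (Dn m P1 s y) ^ p ∂m + ∫⁻ y, (Dn m P2 s y) ^ p ∂m := by
    rw [← lintegral_add_left ((Dn_measurable _ _ _).pow_const _)]
    apply lintegral_congr_ae
    filter_upwards [Ind1, Ind2, Dadd s] with y hy1 hy2 hy3
    rw [hy3, Pi.add_apply]
    by_cases hy : y ∈ B
    · have : Dn m P2 s y = 0 := by rw [hy2]; simp [hy]
      rw [this, ENNReal.zero_rpow_of_pos hp]; simp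
    · have : Dn m P1 s y = 0 := by rw [hy1]; simp [hy]
      rw [this, ENNReal.zero_rpow_of_pos hp]; simp
  rw [E1] at b1
  rw [E2] at b2
  rw [Es, E12] at b12
  -- conclude E = 0
  have hE0 : E = 0 := by
    by_contra hne
    have e1 : ENNReal.ofReal ε * E ≤ ∫⁻ y, (Dn m P1 s y) ^ p ∂m :=
      le_trans (by gcongr) b1
    have e2 : ENNReal.ofReal ε * E ≤ ∫⁻ y, (Dn m P2 s y) ^ p ∂m :=
      le_trans (by gcongr) b2
    set c := (1 - (l2:ℝ)) * Real.exp (- l2 * (L * Real.sqrt (|K| / N'))) with hc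
    have e3 : ENNReal.ofReal c * (ENNReal.ofReal ε * E + ENNReal.ofReal ε * E) ≤ (2:ℝ≥0∞) ^ p * E :=
      le_trans (by gcongr) b12
    have e4 : ENNReal.ofReal c * (2 * ENNReal.ofReal ε) * E ≤ (2:ℝ≥0∞) ^ p * E := by
      refine le_trans (le_of_eq ?_) e3; ring
    have e5 := (ENNReal.mul_le_mul_iff_left hne hEfin).1 e4
    rw [show (2:ℝ≥0∞) = ENNReal.ofReal 2 by simp, ENNReal.ofReal_rpow_of_pos (by norm_num),
      ← ENNReal.ofReal_mul (by norm_num), ← ENNReal.ofReal_mul (by linarith),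
      ENNReal.ofReal_le_ofReal_iff (by positivity)] at e5
    have e6 : (2:ℝ) ^ p = 2 * (2:ℝ) ^ (-(1 / N')) := by
      rw [hpdef, sub_eq_add_neg, Real.rpow_add (by norm_num), Real.rpow_one]
    rw [e6] at e5
    have : ε * ε < c * ε := by gcongr
    nlinarith
  have hκ0 : ∀ᵐ y ∂m, κ y = 0 := by
    have := (lintegral_eq_zero_iff (hmκ.pow_const p)).1 hE0
    filter_upwards [this] with y hy
    simpa [ENNReal.rpow_eq_zero_iff, hp, not_lt.2 hp.le] using hy
  refine ⟨{y | p1 y ≠ 0}, (hmp1 (measurableSet_singleton 0)).compl, ?_⟩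
  have hSm : MeasurableSet {y | p1 y ≠ 0} := (hmp1 (measurableSet_singleton 0)).compl
  have f1 : ∀ᵐ γ ∂π1, eval t γ ∈ {y | p1 y ≠ 0} := by
    filter_upwards [Dn_pos_ae t hac1] with γ hγ using hγ.ne'
  have f2 : ∀ᵐ γ ∂π2, eval t γ ∉ {y | p1 y ≠ 0} := by
    filter_upwards [Dn_pos_ae t hac2, ae_of_ae_map (eval_measurable t).aemeasurable
      (hac2.ae_le hκ0)] with γ hγ hγ2
    rw [not_not]
    rcases min_choice (p1 (eval t γ)) (p2 (eval t γ)) with h | h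
    · rw [← h]; exact hγ2
    · exfalso
      apply hγ.ne'
      rw [← hp2, ← h]; exact hγ2
  rw [ae_restrict_iff' hmB] at f1
  rw [ae_restrict_iff' hmB.compl] at f2
  filter_upwards [f1, f2] with γ g1 g2
  apply propext
  constructor
  · exact g1
  · intro hh
    by_contra hcon
    exact g2 hcon hh

end Inj

section Key
variable [BorelSpace X] [ProperSpace X]

lemma exists_cmb_one {u w : unitInterval} (h : u ≤ w) (hu : (u:ℝ) < 1) :
    ∃ l : unitInterval, cmb u 1 l = w ∧ (l:ℝ) = (w - u) / (1 - u) := by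
  have hw := w.2
  have h' : (u:ℝ) ≤ w := h
  refine ⟨⟨(w - u) / (1 - u), div_nonneg (by linarith) (by linarith), ?_⟩, ?_, rfl⟩
  · rw [div_le_one (by linarith)]; linarith [hw.2]
  · apply Subtype.ext
    rw [coe_cmb]
    have : (1:ℝ) - u ≠ 0 := by linarith
    simp only [Set.Icc.coe_one]
    field_simp
    ring

lemma exists_cmb_zero {u w : unitInterval} (h : w ≤ u) (hu : 0 < (u:ℝ)) :
    ∃ l : unitInterval, cmb u 0 l = w ∧ (l:ℝ) = (u - w) / u := by
  have hw := w.2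
  have h' : (w:ℝ) ≤ u := h
  refine ⟨⟨(u - w) / u, div_nonneg (by linarith) (by linarith), ?_⟩, ?_, rfl⟩
  · rw [div_le_one (by linarith)]; linarith [hw.1]
  · apply Subtype.ext
    rw [coe_cmb]
    simp only [Set.Icc.coe_zero]
    field_simp
    ring

lemma close_eventually {f : ℝ → ℝ} (hf : Continuous f) {ε : ℝ} (hε : ε < f 0) {s : unitInterval}
    (h0 : 0 < (s:ℝ)) (h1 : (s:ℝ) < 1) :
    ∀ᶠ t : unitInterval in 𝓝 s, Close (fun l => f l) ε s t := by
  have c1 : ContinuousAt (fun t : unitInterval => f ((s - t) / (1 - t))) s := by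
    apply hf.continuousAt.comp
    exact ContinuousAt.div (by fun_prop) (by fun_prop) (by linarith)
  have c2 : ContinuousAt (fun t : unitInterval => f ((t - s) / (1 - s))) s := by
    apply hf.continuousAt.comp
    exact ContinuousAt.div (by fun_prop) (by fun_prop) (by linarith)
  have c3 : ContinuousAt (fun t : unitInterval => f ((t - s) / t)) s := by
    apply hf.continuousAt.comp
    exact ContinuousAt.div (by fun_prop) (by fun_prop) (by linarith)
  have c4 : ContinuousAt (fun t : unitInterval => f ((s - t) / s)) s := by
    apply hf.continuousAt.comp
    exact ContinuousAt.div (by fun_prop) (by fun_prop) (by linarith)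
  have k1 := c1.eventually (lt_mem_nhds (a := ε) (by simpa using hε))
  have k2 := c2.eventually (lt_mem_nhds (a := ε) (by simpa using hε))
  have k3 := c3.eventually (lt_mem_nhds (a := ε) (by simpa using hε))
  have k4 := c4.eventually (lt_mem_nhds (a := ε) (by simpa using hε))
  have t1 : ∀ᶠ t : unitInterval in 𝓝 s, (t:ℝ) < 1 :=
    continuous_subtype_val.continuousAt.eventually (gt_mem_nhds h1)
  have t0 : ∀ᶠ t : unitInterval in 𝓝 s, 0 < (t:ℝ) :=
    continuous_subtype_val.continuousAt.eventually (lt_mem_nhds h0)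
  filter_upwards [k1, k2, k3, k4, t1, t0] with t g1 g2 g3 g4 ht1 ht0
  rcases le_total s t with h | h
  · obtain ⟨l, hl, hl'⟩ := exists_cmb_zero h ht0
    obtain ⟨l2, hl2, hl2'⟩ := exists_cmb_one h h1
    exact ⟨⟨0, l, hl, by simp only [hl']; exact g3⟩, ⟨1, l2, hl2, by simp only [hl2']; exact g2⟩⟩
  · obtain ⟨l, hl, hl'⟩ := exists_cmb_one h ht1
    obtain ⟨l2, hl2, hl2'⟩ := exists_cmb_zero h h0
    exact ⟨⟨1, l, hl, by simp only [hl']; exact g1⟩, ⟨0, l2, hl2, by simp only [hl2']; exact g4⟩⟩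

lemma Close.symm' {c : unitInterval → ℝ} {ε : ℝ} {s t : unitInterval} (h : Close c ε s t) :
    Close c ε t s := ⟨h.2, h.1⟩

lemma len_le_of_bdd {x : X} {R : ℝ} {γ : Geo X}
    (h : dist x (eval 0 γ) ≤ R ∧ dist x (eval 1 γ) ≤ R) : len γ ≤ 2 * R := by
  have := dist_triangle_left (eval 0 γ) (eval 1 γ) x
  unfold len; linarith

lemma inG_interior {K N : ℝ} {m : Measure X} [SigmaFinite m] (H : Hyp K N m) {x : X}
    {π : Measure (Geo X)} (h : RPlan m x π) {s t : unitInterval}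
    (hs : (s:ℝ) ∈ Ioo (0:ℝ) 1) (ht : (t:ℝ) ∈ Ioo (0:ℝ) 1) :
    ∀ B : Set X, MeasurableSet B → InG π t ((eval s) ⁻¹' B) := by
  obtain ⟨R, hR⟩ := h.bdd
  have hL : ∀ᵐ γ ∂π, len γ ≤ 2 * R := hR.mono fun _ => len_le_of_bdd
  have hN := H.hN
  set N' := N + 1 with hN'
  set f : ℝ → ℝ := fun l => (1 - l) * Real.exp (- l * ((2 * R) * Real.sqrt (|K| / N'))) with hf
  have hfc : Continuous f := by fun_prop
  have hf0 : f 0 = 1 := by simp [hf]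
  set ε : ℝ := (2:ℝ) ^ (-(1 / N') / 2) with hε
  have hε0 : 0 < ε := by positivity
  have hε1 : ε < f 0 := by
    rw [hf0]
    apply Real.rpow_lt_one_of_one_lt_of_neg (by norm_num)
    have : 0 < 1 / N' := by positivity
    linarith
  have hε2 : (2:ℝ) ^ (-(1 / N')) ≤ ε * ε := by
    rw [hε, ← Real.rpow_add (by norm_num)]; simp
  have hpre : IsPreconnected {s : unitInterval | (s:ℝ) ∈ Ioo (0:ℝ) 1} := by
    have : {s : unitInterval | (s:ℝ) ∈ Ioo (0:ℝ) 1} = Ioo (0:unitInterval) 1 := by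
      ext s; rfl
    rw [this]
    exact isPreconnected_Ioo
  have key := hpre.induction₂' (P := fun s t => ∀ B : Set X, MeasurableSet B →
      InG π t ((eval s) ⁻¹' B)) (x := s) (y := t) ?_ ?_ hs ht
  · exact key
  · intro s hs
    apply eventually_nhdsWithin_of_eventually_nhds
    filter_upwards [close_eventually hfc hε1 hs.1 hs.2] with t hst
    exact ⟨fun B hB => inj_close H h hL (by linarith) (by linarith) hε0 hε2 hst hB,
      fun B hB => inj_close H h hL (by linarith) (by linarith) hε0 hε2 hst.symm' hB⟩
  · intro a b c _ _ _ hab hbc B hB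
    obtain ⟨S, hS, hS'⟩ := hab B hB
    obtain ⟨T, hT, hT'⟩ := hbc S hS
    exact ⟨T, hT, hS'.trans hT'⟩

/-- sigma-algebra of sets determined at time t -/
@[reducible] def GSigma (π : Measure (Geo X)) (t : unitInterval) : MeasurableSpace (Geo X) where
  MeasurableSet' := InG π t
  measurableSet_empty := ⟨∅, MeasurableSet.empty, by simp⟩
  measurableSet_compl := by
    rintro Γ ⟨S, hS, h⟩
    exact ⟨Sᶜ, hS.compl, h.compl⟩
  measurableSet_iUnion := by
    intro f hf
    choose S hS h using hf
    refine ⟨⋃ i, S i, MeasurableSet.iUnion hS, ?_⟩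
    rw [preimage_iUnion]
    exact Filter.EventuallyEq.countable_iUnion h

lemma eval_GSigma {K N : ℝ} {m : Measure X} [SigmaFinite m] (H : Hyp K N m) {x : X}
    {π : Measure (Geo X)} (h : RPlan m x π) {t : unitInterval}
    (ht : (t:ℝ) ∈ Ioo (0:ℝ) 1) (s : unitInterval) : Measurable[GSigma π t] (eval s : Geo X → X) := by
  have hlim : ∃ a : ℕ → unitInterval, (∀ n, (a n : ℝ) ∈ Ioo (0:ℝ) 1) ∧ Tendsto a atTop (𝓝 s) := by
    have hd : s ∈ closure (Ioo (0:unitInterval) 1) := by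
      rw [closure_Ioo (by simp)]; exact ⟨s.2.1, s.2.2⟩
    obtain ⟨a, ha, ha'⟩ := mem_closure_iff_seq_limit.1 hd
    exact ⟨a, fun n => ⟨(ha n).1, (ha n).2⟩, ha'⟩
  obtain ⟨a, ha, ha'⟩ := hlim
  refine @measurable_of_tendsto_metrizable (Geo X) X (GSigma π t) _ _ _ _
    (fun n => eval (a n)) (eval s) (fun n => ?_) ?_
  · intro B hB
    exact inG_interior H h (ha n) ht B hB
  · rw [tendsto_pi_nhds]
    intro γ
    exact ((γ.1.continuous.tendsto s).comp ha')

/-- pointwise CD inequality -/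
lemma key_prop {K N : ℝ} {m : Measure X} [SigmaFinite m] (H : Hyp K N m) {x : X}
    {π : Measure (Geo X)} (h : RPlan m x π) {t : unitInterval}
    (ht : (t:ℝ) ∈ Ioo (0:ℝ) 1) {N' : ℝ} (hN' : N ≤ N') (h1 : 1 < N') :
    ∀ᵐ γ ∂π, cdL K N' m π t γ ≤ (Dn m π t (eval t γ)) ^ (-(1 / N')) := by
  have := h.fin
  set F : X × X × X → ℝ≥0∞ := fun q =>
    sigmaCoeff K N' (1 - (t : ℝ)) (dist q.1 q.2.1) * (Dn m π 0 q.1) ^ (-(1 / N')) +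
    sigmaCoeff K N' (t : ℝ) (dist q.1 q.2.1) * (Dn m π 1 q.2.1) ^ (-(1 / N')) with hF
  set G : X × X × X → ℝ≥0∞ := fun q => (Dn m π t q.2.2) ^ (-(1 / N')) with hG
  have hdm : Measurable fun q : X × X × X => dist q.1 q.2.1 := by
    apply Continuous.measurable; fun_prop
  have hFm : Measurable F :=
    (((sigma_measurable _ _ _).comp hdm).mul
      (((Dn_measurable m π 0).comp measurable_fst).pow_const _)).add
    (((sigma_measurable _ _ _).comp hdm).mul
      (((Dn_measurable m π 1).comp (measurable_fst.comp measurable_snd)).pow_const _))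
  have hGm : Measurable G := ((Dn_measurable m π t).comp
    (measurable_snd.comp measurable_snd)).pow_const _
  have hT : Measurable[GSigma π t] (fun γ : Geo X => (eval 0 γ, eval 1 γ, eval t γ)) :=
    (eval_GSigma H h ht 0).prodMk ((eval_GSigma H h ht 1).prodMk (eval_GSigma H h ht t))
  have hmem : InG π t ((fun γ : Geo X => (eval 0 γ, eval 1 γ, eval t γ)) ⁻¹' {q | G q < F q}) :=
    hT (measurableSet_lt hGm hFm)
  set Γ := ((fun γ : Geo X => (eval 0 γ, eval 1 γ, eval t γ)) ⁻¹' {q | G q < F q}) with hΓ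
  obtain ⟨S, hS, hSΓ⟩ := hmem
  have hac := h.good.ac H t
  have c1 := core_restrict H h.good hN' h1 t hS hSΓ
  rw [← ent_eq h1 t hac hS, ← Measure.restrict_congr_set hSΓ] at c1
  have hfin : ∫⁻ γ in Γ, (Dn m π t (eval t γ)) ^ (-(1 / N')) ∂π ≠ ⊤ := by
    refine ne_top_of_le_ne_top (ent_finite H h h1 t) ?_
    rw [← ent_eq' h1 t hac]
    exact setLIntegral_le_lintegral _ _
  have hΓm : MeasurableSet Γ := ((eval_measurable 0).prodMk
    ((eval_measurable 1).prodMk (eval_measurable t))) (measurableSet_lt hGm hFm)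
  have hlt : ∀ γ ∈ Γ, (Dn m π t (eval t γ)) ^ (-(1 / N')) < cdL K N' m π t γ := fun γ hγ => hγ
  have heq := ae_eq_of_ae_le_of_lintegral_le (μ := π.restrict Γ)
    ((ae_restrict_iff' hΓm).2 (ae_of_all _ fun γ hγ => (hlt γ hγ).le)) hfin
    (cdL_measurable _ _ _ _ _).aemeasurable c1
  have heq := (ae_restrict_iff' hΓm).1 heq
  filter_upwards [heq] with γ hγ
  by_contra hcon
  have hin : γ ∈ Γ := not_le.1 hcon
  exact (hlt γ hin).ne (hγ hin)

end Key

section P7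
variable [ProperSpace X] [BorelSpace X]

lemma const_bound {K N : ℝ} {m : Measure X} [SigmaFinite m] (H : Hyp K N m)
    {π : Measure (Geo X)} (hπ : GoodPlan m π) {N' : ℝ} (hN' : N ≤ N') (h1 : 1 < N')
    (t : unitInterval) {c : ℝ≥0∞} (hc : c ≠ ⊤) (h : ∀ᵐ γ ∂π, c ≤ cdL K N' m π t γ) :
    ∀ᵐ γ ∂π, c ≤ (Dn m π t (eval t γ)) ^ (-(1 / N')) := by
  haveI := hπ.fin
  have hac := hπ.ac H t
  set S : Set X := {y | (Dn m π t y) ^ (-(1 / N')) < c} with hSdef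
  have hS : MeasurableSet S :=
    measurableSet_lt ((Dn_measurable m π t).pow_const _) measurable_const
  have hΓ : MeasurableSet (eval t ⁻¹' S : Set (Geo X)) := eval_measurable t hS
  have e1 := core_restrict H hπ hN' h1 t hS (Filter.EventuallyEq.refl _ _)
  rw [← ent_eq h1 t hac hS] at e1
  have e2 : ∫⁻ γ in eval t ⁻¹' S, c ∂π ≤ ∫⁻ γ in eval t ⁻¹' S, cdL K N' m π t γ ∂π :=
    lintegral_mono_ae (ae_restrict_of_ae h)
  have hlt : ∀ᵐ γ ∂(π.restrict (eval t ⁻¹' S)), (Dn m π t (eval t γ)) ^ (-(1 / N')) < c := by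
    filter_upwards [ae_restrict_mem hΓ] with γ hγ using hγ
  have hfin : ∫⁻ γ in eval t ⁻¹' S, (Dn m π t (eval t γ)) ^ (-(1 / N')) ∂π ≠ ⊤ := by
    refine ne_top_of_le_ne_top ?_ (lintegral_mono_ae (hlt.mono fun γ hγ => hγ.le))
    rw [lintegral_const]
    exact ENNReal.mul_ne_top hc (measure_ne_top _ _)
  have e3 := ae_eq_of_ae_le_of_lintegral_le (hlt.mono fun γ hγ => hγ.le) hfin
    aemeasurable_const (e2.trans e1)
  have h0 : ∀ᵐ γ ∂(π.restrict (eval t ⁻¹' S)), False := by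
    filter_upwards [hlt, e3] with γ h2 h3
    exact h2.ne h3
  rw [ae_restrict_iff' hΓ] at h0
  filter_upwards [h0] with γ hγ
  by_contra hcon
  exact hγ (not_le.1 hcon)

lemma map_le_of_const {K N : ℝ} {m : Measure X} [SigmaFinite m] (H : Hyp K N m)
    {π : Measure (Geo X)} (hπ : GoodPlan m π) {N' : ℝ} (hN' : N ≤ N') (h1 : 1 < N')
    (t : unitInterval) {c : ℝ≥0∞} (hc : c ≠ ⊤) (hc0 : c ≠ 0) (h : ∀ᵐ γ ∂π, c ≤ cdL K N' m π t γ) :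
    π.map (eval t) ≤ (c ^ (-N')) • m := by
  haveI := hπ.fin
  have hac := hπ.ac H t
  have e1 := const_bound H hπ hN' h1 t hc h
  have e2 : ∀ᵐ y ∂(π.map (eval t)), c ≤ (Dn m π t y) ^ (-(1 / N')) :=
    (ae_map_iff (p := fun y => c ≤ (Dn m π t y) ^ (-(1 / N'))) (eval_measurable t).aemeasurable
      (measurableSet_le measurable_const ((Dn_measurable m π t).pow_const _))).2 e1
  have e3 : m.withDensity (Dn m π t) = π.map (eval t) := Measure.withDensity_rnDeriv_eq _ _ hac
  rw [← e3, ae_withDensity_iff (Dn_measurable m π t)] at e2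
  rw [← e3, ← withDensity_const]
  refine withDensity_mono ?_
  filter_upwards [e2] with y hy
  by_cases h0 : Dn m π t y = 0
  · simp [h0]
  · have := rpow_neg_anti (z := -N') (by linarith) (hy h0)
    rwa [← ENNReal.rpow_mul, show -(1 / N') * -N' = 1 by field_simp, ENNReal.rpow_one] at this
end P7

section P8
variable [ProperSpace X] [BorelSpace X]

lemma geo_compact (x : X) (R : ℝ) :
    IsCompact {γ : Geo X | eval 0 γ ∈ closedBall x R ∧ eval 1 γ ∈ closedBall x R} := by
  have hemb : @Topology.IsEmbedding (Geo X) _ PseudoMetricSpace.toUniformSpace.toTopologicalSpace _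
      (Subtype.val : Geo X → C(unitInterval, X)) :=
    Topology.IsEmbedding.subtypeVal
  refine hemb.isCompact_iff.2 ?_
  set S := Subtype.val '' {γ : Geo X | eval 0 γ ∈ closedBall x R ∧ eval 1 γ ∈ closedBall x R}
    with hS
  have hSdesc : ∀ f : C(unitInterval, X), f ∈ S ↔
      IsUnitGeodesic f ∧ f 0 ∈ closedBall x R ∧ f 1 ∈ closedBall x R := by
    intro f
    constructor
    · rintro ⟨γ, hγ, rfl⟩
      exact ⟨γ.2, hγ⟩
    · rintro ⟨h1, h2⟩
      exact ⟨⟨f, h1⟩, h2, rfl⟩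
  have hl : ∀ f ∈ S, dist (f 0) (f 1) ≤ 2 * R := by
    intro f hf
    have h := ((hSdesc f).1 hf).2
    rw [mem_closedBall, mem_closedBall] at h
    have := dist_triangle_right (f 0) (f 1) x
    linarith
  refine ArzelaAscoli.isCompact_of_equicontinuous S ?_ ?_
  · have himg : ContinuousMap.toFun '' S = {f : unitInterval → X |
        (∀ s t : unitInterval, dist (f s) (f t) = |(s : ℝ) - (t : ℝ)| * dist (f 0) (f 1)) ∧
        f 0 ∈ closedBall x R ∧ f 1 ∈ closedBall x R} := by
      ext f
      constructor
      · rintro ⟨g, hg, rfl⟩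
        exact (hSdesc g).1 hg
      · rintro ⟨h1, h2⟩
        have hc : Continuous f := by
          refine (LipschitzWith.of_dist_le_mul (K := (dist (f 0) (f 1)).toNNReal) ?_).continuous
          intro s t
          rw [h1 s t, Real.coe_toNNReal _ dist_nonneg, mul_comm]
          exact le_rfl
        exact ⟨⟨f, hc⟩, (hSdesc _).2 ⟨h1, h2⟩, rfl⟩
    rw [himg]
    refine IsCompact.of_isClosed_subset
      (isCompact_univ_pi (fun _ : unitInterval => isCompact_closedBall x (3 * R))) ?_ ?_
    · have hap : ∀ t : unitInterval, Continuous (fun f : unitInterval → X => f t) :=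
        fun t => continuous_apply t
      simp only [ofPred_and, ofPred_forall]
      refine IsClosed.inter ?_ (IsClosed.inter ?_ ?_)
      · refine isClosed_iInter fun s => isClosed_iInter fun t => isClosed_eq ?_ ?_
        · exact (hap s).dist (hap t)
        · exact continuous_const.mul ((hap 0).dist (hap 1))
      · exact isClosed_closedBall.preimage (hap 0)
      · exact isClosed_closedBall.preimage (hap 1)
    · rintro f ⟨h1, h2, h3⟩ t -
      rw [mem_closedBall] at *
      have e1 := h1 t 0
      have e2 := dist_triangle (f t) (f 0) x
      have e3 := dist_triangle_right (f 0) (f 1) x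
      have e4 : |(t:ℝ) - (0:unitInterval)| ≤ 1 := by
        rw [abs_le]; constructor <;> simp <;> linarith [t.2.1, t.2.2]
      have e5 : |(t:ℝ) - (0:unitInterval)| * dist (f 0) (f 1) ≤ 1 * dist (f 0) (f 1) :=
        mul_le_mul_of_nonneg_right e4 dist_nonneg
      linarith
  · refine Metric.equicontinuous_of_continuity_modulus (fun r => r * (2 * R)) ?_ _ ?_
    · have : Tendsto (fun r : ℝ => r * (2 * R)) (𝓝 0) (𝓝 (0 * (2 * R))) :=
        (continuous_id.mul continuous_const).tendsto 0
      simpa using this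
    · rintro s t ⟨f, hf⟩
      have h1 := ((hSdesc f).1 hf).1 s t
      have h2 := hl f hf
      change dist (f s) (f t) ≤ dist s t * (2 * R)
      rw [h1]
      exact mul_le_mul_of_nonneg_left h2 (abs_nonneg _)
end P8

section P9
variable [ProperSpace X] [BorelSpace X]

lemma le_of_open {μ m : Measure X} [m.OuterRegular] (h : ∀ U : Set X, IsOpen U → μ U ≤ m U) :
    μ ≤ m := by
  rw [Measure.le_iff]
  intro s hs
  rw [s.measure_eq_iInf_isOpen m]
  refine le_iInf₂ fun U hU => le_iInf fun hUo => ?_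
  exact (measure_mono hU).trans (h U hUo)

lemma unif_prob {m : Measure X} {A : Set X} (h0 : 0 < m A) (h1 : m A ≠ ⊤) :
    IsProbabilityMeasure ((m A)⁻¹ • m.restrict A) := by
  refine ⟨?_⟩
  rw [Measure.smul_apply, Measure.restrict_apply_univ, smul_eq_mul,
    ENNReal.inv_mul_cancel h0.ne' h1]

lemma unif_compl {m : Measure X} {A s : Set X} (hs : MeasurableSet s) (h : A ⊆ s) :
    ((m A)⁻¹ • m.restrict A) sᶜ = 0 := by
  rw [Measure.smul_apply, Measure.restrict_apply hs.compl,
    show sᶜ ∩ A = ∅ from by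
      ext y; simp only [mem_inter_iff, mem_compl_iff, mem_empty_iff_false, iff_false]
      exact fun hh => hh.1 (h hh.2)]
  simp

/-- approximate plans and the uniform density bound -/
lemma approx_plan {K N : ℝ} {m : Measure X} [IsLocallyFiniteMeasure m] (H : Hyp K N m) (x : X)
    {A : Set X} (hA : MeasurableSet A) (hA0 : 0 < m A) {b : ℝ} (hb : 0 ≤ b)
    (hAb : A ⊆ closedBall x b) (ε : ℝ) (hε : 0 < ε) (hε1 : ε ≤ 1) :
    ∃ π : Measure (Geo X), IsProbabilityMeasure π ∧
      (∀ᵐ γ ∂π, eval 0 γ ∈ ball x ε) ∧ π.map (eval 1) = (m A)⁻¹ • m.restrict A ∧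
      (∀ᵐ γ ∂π, eval 1 γ ∈ closedBall x b) ∧
      ∀ t : unitInterval, 0 < (t:ℝ) → π.map (eval t) ≤
        ((ENNReal.ofReal ((t:ℝ) * Real.exp (-(1 - (t:ℝ)) * ((b + 1) * Real.sqrt (|K| / (N + 1)))))
          * ((m A)⁻¹) ^ (-(1 / (N + 1)))) ^ (-(N + 1))) • m := by
  have hN := H.hN
  have hAf : m A ≠ ⊤ := H.bdd A (isBounded_closedBall.subset hAb)
  have hBf : m (ball x ε) ≠ ⊤ := H.bdd _ isBounded_ball
  have hp0 := unif_prob (H.supp x ε hε) hBf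
  have hp1 := unif_prob hA0 hAf
  have hsm : MeasurableSet (closedBall x (b + 1)) := isClosed_closedBall.measurableSet
  obtain ⟨π, ⟨hpr, h0, h1, hopt⟩, -⟩ := H.cd _ _ hp0 hp1 ⟨closedBall x (b + 1), isBounded_closedBall,
    unif_compl hsm (ball_subset_closedBall.trans (closedBall_subset_closedBall (by linarith))),
    unif_compl hsm (hAb.trans (closedBall_subset_closedBall (by linarith)))⟩
  have hae0 : ∀ᵐ γ ∂π, eval 0 γ ∈ ball x ε := by
    have : (π.map (eval 0)) (ball x ε)ᶜ = 0 := by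
      rw [h0]; exact unif_compl isOpen_ball.measurableSet le_rfl
    rw [Measure.map_apply (eval_measurable 0) isOpen_ball.measurableSet.compl] at this
    exact this
  have hae1 : ∀ᵐ γ ∂π, eval 1 γ ∈ closedBall x b := by
    have : (π.map (eval 1)) (closedBall x b)ᶜ = 0 := by
      rw [h1]; exact unif_compl isClosed_closedBall.measurableSet hAb
    rw [Measure.map_apply (eval_measurable 1) isClosed_closedBall.measurableSet.compl] at this
    exact this
  have hac : ∀ B : Set X, ((m B)⁻¹ • m.restrict B) ≪ m := fun B =>
    (Measure.smul_absolutelyContinuous).trans Measure.restrict_le_self.absolutelyContinuous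
  have hG : GoodPlan m π := by
    refine ⟨inferInstance, ?_, ?_, ?_, ?_⟩
    · intro π' g0 g1
      refine hopt π' ⟨?_⟩ (g0.trans h0) (g1.trans h1)
      rw [← map_univ_eval π' 0, g0, map_univ_eval, measure_univ]
    · rw [h0]; exact hac _
    · rw [h1]; exact hac _
    · refine ⟨closedBall x (b + 1), isBounded_closedBall, ?_⟩
      filter_upwards [hae0, hae1] with γ g0 g1
      exact ⟨closedBall_subset_closedBall (by linarith) (ball_subset_closedBall g0),
        closedBall_subset_closedBall (by linarith) g1⟩
  refine ⟨π, hpr, hae0, h1, hae1, fun t ht => ?_⟩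
  have hD1 : ∀ᵐ γ ∂π, Dn m π 1 (eval 1 γ) ≤ (m A)⁻¹ := by
    have e1 : π.map (eval 1) = m.withDensity (A.indicator fun _ => (m A)⁻¹) := by
      rw [h1, withDensity_indicator hA, withDensity_const]
    have e2 : Dn m π 1 =ᵐ[m] (A.indicator fun _ => (m A)⁻¹) := by
      unfold Dn
      rw [e1]
      exact Measure.rnDeriv_withDensity m (measurable_const.indicator hA)
    have e3 : ∀ᵐ y ∂m, Dn m π 1 y ≤ (m A)⁻¹ := by
      filter_upwards [e2] with y hy
      rw [hy]
      exact indicator_le_self' (fun _ _ => bot_le) y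
    exact ae_of_ae_map (p := fun y => Dn m π 1 y ≤ (m A)⁻¹)
      (eval_measurable 1).aemeasurable (hG.ac1.ae_le e3)
  have hpos : 0 < (t:ℝ) * Real.exp (-(1 - (t:ℝ)) * ((b + 1) * Real.sqrt (|K| / (N + 1)))) :=
    mul_pos ht (Real.exp_pos _)
  refine map_le_of_const H hG (by linarith) (by linarith) t ?_ ?_ ?_
  · refine ENNReal.mul_ne_top ENNReal.ofReal_ne_top ?_
    refine ENNReal.rpow_ne_top_of_ne_zero ?_ ?_
    · exact ENNReal.inv_ne_zero.2 hAf
    · exact ENNReal.inv_ne_top.2 hA0.ne'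
  · refine mul_ne_zero (ENNReal.ofReal_pos.2 hpos).ne' ?_
    rw [Ne, ENNReal.rpow_eq_zero_iff]
    rintro (⟨g, -⟩ | ⟨g, -⟩)
    · exact ENNReal.inv_ne_zero.2 hAf g
    · exact ENNReal.inv_ne_top.2 hA0.ne' g
  · filter_upwards [hae0, hae1, hD1] with γ g0 g1 g2
    unfold cdL
    refine le_trans ?_ le_add_self
    refine mul_le_mul' ?_ (rpow_neg_anti (neg_nonpos.2 (by positivity)) g2)
    have hlen : len γ ≤ b + 1 := by
      rw [mem_ball] at g0
      rw [mem_closedBall] at g1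
      have := dist_triangle_right (eval 0 γ) (eval 1 γ) x
      unfold len; linarith
    refine le_trans ?_ (sigma_lb (by linarith) t.2.1 t.2.2 (len_nonneg γ))
    refine ENNReal.ofReal_le_ofReal (mul_le_mul_of_nonneg_left (Real.exp_le_exp.2 ?_) t.2.1)
    have : len γ * Real.sqrt (|K| / (N + 1)) ≤ (b + 1) * Real.sqrt (|K| / (N + 1)) :=
      mul_le_mul_of_nonneg_right hlen (Real.sqrt_nonneg _)
    nlinarith [t.2.2]

lemma foundation {K N : ℝ} {m : Measure X} [IsLocallyFiniteMeasure m] (H : Hyp K N m) (x : X)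
    {A : Set X} (hA : MeasurableSet A) (hA0 : 0 < m A) {b : ℝ} (hb : 0 ≤ b)
    (hAb : A ⊆ closedBall x b) :
    ∃ P : Measure (Geo X), IsFiniteMeasure P ∧ (∀ᵐ γ ∂P, eval 0 γ = x) ∧
      P.map (eval 1) = m.restrict A ∧
      ∀ t : unitInterval, 0 < (t:ℝ) → P.map (eval t) ≪ m := by
  have hN := H.hN
  have hAf : m A ≠ ⊤ := H.bdd A (isBounded_closedBall.subset hAb)
  have hk : ∀ k : ℕ, 0 < 1 / ((k:ℝ) + 1) ∧ 1 / ((k:ℝ) + 1) ≤ 1 := by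
    intro k
    have : (0:ℝ) ≤ k := k.cast_nonneg
    refine ⟨by positivity, ?_⟩
    rw [div_le_one (by linarith)]; linarith
  choose π hpr h0 h1 h2 h3 using
    fun k : ℕ => approx_plan H x hA hA0 hb hAb (1 / ((k:ℝ) + 1)) (hk k).1 (hk k).2
  let p : ℕ → ProbabilityMeasure (Geo X) := fun k => ⟨π k, hpr k⟩
  have htight : IsTightMeasureSet {y | ∃ μ ∈ range p, (μ : Measure (Geo X)) = y} := by
    rw [isTightMeasureSet_iff_exists_isCompact_measure_compl_le]
    intro ε hε
    refine ⟨_, geo_compact x (b + 1), ?_⟩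
    rintro _ ⟨_, ⟨k, rfl⟩, rfl⟩
    refine le_trans (le_of_eq ?_) bot_le
    have : ∀ᵐ γ ∂(π k), γ ∈ {γ : Geo X | eval 0 γ ∈ closedBall x (b + 1) ∧
        eval 1 γ ∈ closedBall x (b + 1)} := by
      filter_upwards [h0 k, h2 k] with γ g0 g1
      exact ⟨closedBall_subset_closedBall (by linarith [(hk k).2]) (ball_subset_closedBall g0),
        closedBall_subset_closedBall (by linarith) g1⟩
    exact this
  have hcomp := isCompact_closure_of_isTightMeasureSet htight
  obtain ⟨q, -, hq⟩ := hcomp.ultrafilter_le_nhds ((hyperfilter ℕ).map p) (by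
    rw [le_principal_iff, Ultrafilter.coe_map]
    exact Filter.mem_map.2 (Filter.univ_mem' fun k => subset_closure ⟨k, rfl⟩))
  have htend : Tendsto p (hyperfilter ℕ : Filter ℕ) (𝓝 q) := hq
  have hopen : ∀ U : Set (Geo X), IsOpen U → (q : Measure (Geo X)) U ≤
      liminf (fun k => (π k) U) (hyperfilter ℕ : Filter ℕ) := fun U hU =>
    ProbabilityMeasure.le_liminf_measure_open_of_tendsto htend hU
  have hq0 : ∀ᵐ γ ∂(q : Measure (Geo X)), eval 0 γ = x := by
    have : ∀ j : ℕ, ∀ᵐ γ ∂(q : Measure (Geo X)), dist (eval 0 γ) x ≤ 1 / ((j:ℝ) + 1) := by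
      intro j
      have hU : IsOpen {γ : Geo X | 1 / ((j:ℝ) + 1) < dist (eval 0 γ) x} :=
        isOpen_lt continuous_const ((eval_continuous 0).dist continuous_const)
      have e := hopen _ hU
      have e2 : ∀ᶠ k in (hyperfilter ℕ : Filter ℕ),
          (π k) {γ : Geo X | 1 / ((j:ℝ) + 1) < dist (eval 0 γ) x} = 0 := by
        have : ∀ᶠ k : ℕ in atTop,
          (π k) {γ : Geo X | 1 / ((j:ℝ) + 1) < dist (eval 0 γ) x} = 0 := by
          filter_upwards [eventually_ge_atTop j] with k hkj
          have : ∀ᵐ γ ∂(π k), ¬ (1 / ((j:ℝ) + 1) < dist (eval 0 γ) x) := by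
            filter_upwards [h0 k] with γ g
            rw [mem_ball] at g
            rw [not_lt]
            refine g.le.trans (one_div_le_one_div_of_le (by positivity) ?_)
            have : (j:ℝ) ≤ k := by exact_mod_cast hkj
            linarith
          rw [ae_iff] at this
          simpa only [not_not] using this
        exact Nat.hyperfilter_le_atTop this
      rw [liminf_congr e2, liminf_const] at e
      rw [ae_iff]
      simpa only [not_le] using le_antisymm e bot_le
    filter_upwards [ae_all_iff.2 this] with γ hγ
    rw [← dist_le_zero]
    exact ge_of_tendsto' tendsto_one_div_add_atTop_nhds_zero_nat hγ
  have hq1 : (q : Measure (Geo X)).map (eval 1) = (m A)⁻¹ • m.restrict A := by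
    have hc := ProbabilityMeasure.tendsto_map_of_tendsto_of_continuous p q htend
      (eval_continuous (X := X) 1)
    have hcst : ∀ k, (p k).map (eval_continuous (X := X) 1).aemeasurable =
        ⟨(m A)⁻¹ • m.restrict A, unif_prob hA0 hAf⟩ := by
      intro k
      refine Subtype.ext ?_
      exact h1 k
    simp_rw [hcst] at hc
    have := tendsto_nhds_unique hc tendsto_const_nhds
    exact congrArg Subtype.val this
  refine ⟨(m A) • (q : Measure (Geo X)), ?_, ?_, ?_, ?_⟩
  · exact Measure.smul_finite _ hAf
  · exact Measure.ae_smul_measure hq0 _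
  · rw [Measure.map_smul, hq1, smul_smul, ENNReal.mul_inv_cancel hA0.ne' hAf, one_smul]
  · intro t ht
    rw [Measure.map_smul]
    refine Measure.smul_absolutelyContinuous.trans ?_
    have hpos : 0 < (t:ℝ) * Real.exp (-(1 - (t:ℝ)) * ((b + 1) * Real.sqrt (|K| / (N + 1)))) :=
      mul_pos ht (Real.exp_pos _)
    set C := ((ENNReal.ofReal ((t:ℝ) * Real.exp (-(1 - (t:ℝ)) *
      ((b + 1) * Real.sqrt (|K| / (N + 1))))) * ((m A)⁻¹) ^ (-(1 / (N + 1)))) ^ (-(N + 1))) with hC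
    have hCf : C ≠ ⊤ := by
      have a1 : ((m A)⁻¹) ^ (-(1 / (N + 1))) ≠ 0 := by
        rw [Ne, ENNReal.rpow_eq_zero_iff]
        rintro (⟨g, -⟩ | ⟨g, -⟩)
        · exact ENNReal.inv_ne_zero.2 hAf g
        · exact ENNReal.inv_ne_top.2 hA0.ne' g
      have a2 : ((m A)⁻¹) ^ (-(1 / (N + 1))) ≠ ⊤ :=
        ENNReal.rpow_ne_top_of_ne_zero (ENNReal.inv_ne_zero.2 hAf) (ENNReal.inv_ne_top.2 hA0.ne')
      exact ENNReal.rpow_ne_top_of_ne_zero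
        (mul_ne_zero (ENNReal.ofReal_pos.2 hpos).ne' a1) (ENNReal.mul_ne_top ENNReal.ofReal_ne_top a2)
    have := Measure.OuterRegular.smul m hCf
    refine Measure.AbsolutelyContinuous.trans (Measure.absolutelyContinuous_of_le
      (le_of_open (m := C • m) fun U hU => ?_)) Measure.smul_absolutelyContinuous
    rw [Measure.map_apply (eval_measurable t) hU.measurableSet]
    refine (hopen _ (hU.preimage (eval_continuous t))).trans ?_
    have hle : ∀ k, (π k) (eval t ⁻¹' U) ≤ (C • m) U := fun k => by
      rw [← Measure.map_apply (eval_measurable t) hU.measurableSet]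
      exact h3 k t ht U
    refine (liminf_le_liminf (Filter.Eventually.of_forall hle)).trans ?_
    rw [liminf_const]
end P9

section P10
variable [ProperSpace X] [BorelSpace X]

/-- radial plans from a point -/
structure FP (m : Measure X) (x : X) (a b : ℝ) (A : Set X) (P : Measure (Geo X)) : Prop where
  fin : IsFiniteMeasure P
  start : ∀ᵐ γ ∂P, eval 0 γ = x
  map1 : P.map (eval 1) = m.restrict A
  ac : ∀ t : unitInterval, 0 < (t:ℝ) → P.map (eval t) ≪ m
  len : ∀ᵐ γ ∂P, a ≤ len γ ∧ len γ ≤ b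
  ha : 0 < a
  hA : MeasurableSet A

/-- real-time evaluation, clamped -/
def cl (s : ℝ) : unitInterval := projIcc 0 1 zero_le_one s

lemma cl_continuous : Continuous cl := continuous_projIcc (h := zero_le_one)

lemma coe_cl {s : ℝ} (h0 : 0 ≤ s) (h1 : s ≤ 1) : (cl s : ℝ) = s := by
  unfold cl
  rw [projIcc_of_mem zero_le_one (⟨h0, h1⟩ : s ∈ Icc (0:ℝ) 1)]

/-- point at distance `u` along the geodesic -/
def Z (γ : Geo X) (u : ℝ) : X := eval (cl (u / len γ)) γ

lemma Z_measurable' {Ω : Type*} [MeasurableSpace Ω] {G : Ω → Geo X} {u : Ω → ℝ}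
    (hG : Measurable G) (hu : Measurable u) : Measurable (fun ω => Z (G ω) (u ω)) :=
  eval_measurable' hG (cl_continuous.measurable.comp (hu.div (len_measurable.comp hG)))

lemma dist_eval_start {x : X} {γ : Geo X} (h : eval 0 γ = x) (t : unitInterval) :
    dist x (eval t γ) = t * len γ := by
  rw [← h, dist_eval]
  congr 1
  simp [abs_of_nonneg t.2.1]

lemma dist_Z {x : X} {γ : Geo X} (h : eval 0 γ = x) {u : ℝ} (h0 : 0 ≤ u) (hl : 0 < len γ)
    (h1 : u ≤ len γ) : dist x (Z γ u) = u := by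
  unfold Z
  rw [dist_eval_start h, coe_cl (by positivity) ((div_le_one hl).2 h1)]
  field_simp

lemma ae_vol_image {f : ℝ → ℝ} {E F : Set ℝ} (hE : volume E = 0) (hf : DifferentiableOn ℝ f E)
    (h : F ⊆ f '' E) : volume F = 0 :=
  measure_mono_null h (addHaar_image_eq_zero_of_differentiableOn_of_addHaar_eq_zero volume hf hE)

/-- null sets pull back -/
lemma ac_Phi_ae {m : Measure X} [SigmaFinite m] {x : X} {a b : ℝ} {A : Set X}
    {P : Measure (Geo X)} (hP : FP m x a b A P) {E : Set (X × ℝ)} (hE : MeasurableSet E)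
    (h0 : (m.prod volume) E = 0) :
    ∀ᵐ γ ∂P, ∀ᵐ u : ℝ, 0 < u → u < len γ → (Z γ u, len γ) ∉ E := by
  have := hP.fin
  have s1 := Measure.measure_ae_null_of_prod_null h0
  have s2 : ∀ᵐ z ∂m, ∀ᵐ s : ℝ, 0 < s → 0 < dist x z → (z, dist x z / s) ∉ E := by
    filter_upwards [s1] with z hz
    rw [ae_iff]
    refine ae_vol_image (E := (Prod.mk z ⁻¹' E) ∩ Ioi 0) (f := fun y => dist x z / y)
      (measure_mono_null inter_subset_left hz) ?_ ?_
    · intro y hy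
      exact ((differentiableAt_const _).div differentiableAt_id (ne_of_gt hy.2)).differentiableWithinAt
    · intro s hs
      simp only [mem_ofPred_eq, Classical.not_imp, not_not] at hs
      obtain ⟨hs0, hr, hmem⟩ := hs
      refine ⟨dist x z / s, ⟨hmem, div_pos hr hs0⟩, ?_⟩
      simp only
      field_simp
  have s3 : ∀ᵐ s : ℝ, ∀ᵐ z ∂m, 0 < s → 0 < dist x z → (z, dist x z / s) ∉ E := by
    refine (Measure.ae_ae_comm ?_).1 s2
    have hm1 : Measurable (fun p : X × ℝ => (p.1, dist x p.1 / p.2)) := by fun_prop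
    have e1 : MeasurableSet {p : X × ℝ | 0 < p.2} := measurableSet_lt measurable_const measurable_snd
    have e2 : MeasurableSet {p : X × ℝ | 0 < dist x p.1} :=
      measurableSet_lt measurable_const (by fun_prop)
    exact e1.imp (e2.imp (hm1 hE).compl)
  have s4 : ∀ᵐ s : ℝ, ∀ᵐ γ ∂P, 0 < s → s < 1 → (eval (cl s) γ, len γ) ∉ E := by
    filter_upwards [s3] with s hs
    by_cases hs01 : 0 < s ∧ s < 1
    · have hcs : (cl s : ℝ) = s := coe_cl hs01.1.le hs01.2.le
      have := ae_of_ae_map (eval_measurable (cl s)).aemeasurable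
        ((hP.ac (cl s) (by rw [hcs]; exact hs01.1)).ae_le hs)
      filter_upwards [this, hP.start, hP.len] with γ h1 h2 h3 _ _
      have hd := dist_eval_start h2 (cl s)
      rw [hcs] at hd
      have hl : 0 < len γ := hP.ha.trans_le h3.1
      have := h1 hs01.1 (by rw [hd]; exact mul_pos hs01.1 hl)
      rwa [hd, mul_div_cancel_left₀ _ hs01.1.ne'] at this
    · filter_upwards with γ g1 g2
      exact absurd ⟨g1, g2⟩ hs01
  have s5 : ∀ᵐ γ ∂P, ∀ᵐ s : ℝ, 0 < s → s < 1 → (eval (cl s) γ, len γ) ∉ E := by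
    refine (Measure.ae_ae_comm ?_).1 s4
    have hm1 : Measurable (fun p : ℝ × Geo X => (eval (cl p.1) p.2, len p.2)) :=
      (eval_measurable' measurable_snd (cl_continuous.measurable.comp measurable_fst)).prodMk
        (len_measurable.comp measurable_snd)
    have e1 : MeasurableSet {p : ℝ × Geo X | 0 < p.1} := measurableSet_lt measurable_const measurable_fst
    have e2 : MeasurableSet {p : ℝ × Geo X | p.1 < 1} := measurableSet_lt measurable_fst measurable_const
    exact e1.imp (e2.imp (hm1 hE).compl)
  filter_upwards [s5, hP.len] with γ h1 h3
  have hl : 0 < len γ := hP.ha.trans_le h3.1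
  rw [ae_iff] at h1 ⊢
  refine ae_vol_image (f := fun y => y * len γ) h1 (by fun_prop) ?_
  intro u hu
  simp only [mem_ofPred_eq, Classical.not_imp, not_not] at hu
  refine ⟨u / len γ, ?_, by field_simp⟩
  simp only [mem_ofPred_eq, Classical.not_imp, not_not]
  exact ⟨div_pos hu.1 hl, (div_lt_one hl).2 hu.2.1, hu.2.2⟩

/-- domain -/
def Dom (X : Type*) [MetricSpace X] : Set (Geo X × ℝ) := {p | 0 < p.2 ∧ p.2 < len p.1}

lemma Dom_meas : MeasurableSet (Dom X) := by
  unfold Dom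
  exact (measurableSet_lt measurable_const measurable_snd).inter
    (measurableSet_lt measurable_snd (len_measurable.comp measurable_fst))

/-- joint map -/
def Phi (p : Geo X × ℝ) : X × ℝ := (Z p.1 p.2, len p.1)

lemma Phi_meas : Measurable (Phi : Geo X × ℝ → X × ℝ) :=
  (Z_measurable' measurable_fst measurable_snd).prodMk (len_measurable.comp measurable_fst)

/-- the measure on pairs -/
def M0 (P : Measure (Geo X)) : Measure (Geo X × ℝ) := (P.prod volume).restrict (Dom X)

/-- joint density -/
def Qd (m : Measure X) (P : Measure (Geo X)) : X × ℝ → ℝ≥0∞ :=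
  ((M0 P).map Phi).rnDeriv (m.prod volume)

lemma Qd_meas (m : Measure X) (P : Measure (Geo X)) : Measurable (Qd m P) :=
  Measure.measurable_rnDeriv _ _

lemma M0_fin {m : Measure X} {x : X} {a b : ℝ} {A : Set X}
    {P : Measure (Geo X)} (hP : FP m x a b A P) : IsFiniteMeasure (M0 P) := by
  have := hP.fin
  refine ⟨?_⟩
  unfold M0
  rw [Measure.restrict_apply_univ, Measure.prod_apply Dom_meas]
  have : ∀ᵐ γ ∂P, volume (Prod.mk γ ⁻¹' Dom X) ≤ ENNReal.ofReal b := by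
    filter_upwards [hP.len] with γ hγ
    refine (measure_mono (t := Ioo 0 b) ?_).trans (by simp)
    intro u hu
    exact ⟨hu.1, hu.2.trans_le hγ.2⟩
  refine (lintegral_mono_ae this).trans_lt ?_
  rw [lintegral_const]
  exact ENNReal.mul_lt_top ENNReal.ofReal_lt_top (measure_lt_top _ _)

lemma ac_Phi {m : Measure X} [SigmaFinite m] {x : X} {a b : ℝ} {A : Set X}
    {P : Measure (Geo X)} (hP : FP m x a b A P) : (M0 P).map Phi ≪ m.prod volume := by
  have := hP.fin
  refine Measure.AbsolutelyContinuous.mk fun E hE h0 => ?_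
  rw [Measure.map_apply Phi_meas hE, M0, Measure.restrict_apply (Phi_meas hE),
    Measure.measure_prod_null ((Phi_meas hE).inter Dom_meas)]
  filter_upwards [ac_Phi_ae hP hE h0] with γ hγ
  rw [ae_iff] at hγ
  refine measure_mono_null ?_ hγ
  rintro u ⟨h1, h2, h3⟩
  simp only [mem_ofPred_eq, Classical.not_imp, not_not]
  exact ⟨h2, h3, h1⟩

/-- the density along geodesics -/
def Qh (m : Measure X) (P : Measure (Geo X)) (γ : Geo X) (u : ℝ) : ℝ≥0∞ := Qd m P (Z γ u, len γ)

lemma Qh_meas' (m : Measure X) (P : Measure (Geo X)) {Ω : Type*} [MeasurableSpace Ω]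
    {G : Ω → Geo X} {u : Ω → ℝ}
    (hG : Measurable G) (hu : Measurable u) : Measurable (fun ω => Qh m P (G ω) (u ω)) :=
  (Qd_meas m P).comp ((Z_measurable' hG hu).prodMk (len_measurable.comp hG))

lemma Qh_pos_fin {m : Measure X} [SigmaFinite m] {x : X} {a b : ℝ} {A : Set X}
    {P : Measure (Geo X)} (hP : FP m x a b A P) :
    ∀ᵐ γ ∂P, ∀ᵐ u : ℝ, 0 < u → u < len γ → 0 < Qh m P γ u ∧ Qh m P γ u < ⊤ := by
  have := hP.fin
  have := M0_fin hP
  have hac := ac_Phi hP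
  have e1 := ae_of_ae_map Phi_meas.aemeasurable (Measure.rnDeriv_pos hac)
  have e0 : ∀ᵐ z ∂((M0 P).map Phi), Qd m P z < ⊤ := hac.ae_le (Measure.rnDeriv_lt_top _ _)
  have e2 := ae_of_ae_map Phi_meas.aemeasurable e0
  have e3 : ∀ᵐ p ∂(M0 P), 0 < Qh m P p.1 p.2 ∧ Qh m P p.1 p.2 < ⊤ := by
    filter_upwards [e1, e2] with p h1 h2 using ⟨h1, h2⟩
  rw [M0, ae_restrict_iff' Dom_meas] at e3
  filter_upwards [Measure.ae_ae_of_ae_prod e3] with γ hγ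
  filter_upwards [hγ] with u hu h1 h2 using hu ⟨h1, h2⟩
end P10

section P11
variable [ProperSpace X] [BorelSpace X]

lemma exists_piSystem (X : Type*) [TopologicalSpace X] [SecondCountableTopology X]
    [MeasurableSpace X] [BorelSpace X] :
    ∃ C : Set (Set X), C.Countable ∧ IsPiSystem C ∧ ‹MeasurableSpace X› = MeasurableSpace.generateFrom C
      ∧ ∀ s ∈ C, MeasurableSet s := by
  obtain ⟨b, hb1, -, hb3⟩ := TopologicalSpace.exists_countable_basis X
  have hB := TopologicalSpace.isTopologicalBasis_of_subbasis hb3.eq_generateFrom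
  refine ⟨(fun f => ⋂₀ f) '' {f : Set (Set X) | f.Finite ∧ f ⊆ b}, ?_, ?_, ?_, ?_⟩
  · exact (countable_ofPred_finite_subset hb1).image _
  · rintro _ ⟨f, hf, rfl⟩ _ ⟨g, hg, rfl⟩ -
    exact ⟨f ∪ g, ⟨hf.1.union hg.1, union_subset hf.2 hg.2⟩, sInter_union _ _⟩
  · rw [‹BorelSpace X›.measurable_eq]
    exact hB.borel_eq_generateFrom
  · intro s hs
    exact (hB.isOpen hs).measurableSet

lemma disint {Ω : Type*} [MeasurableSpace Ω] {P : Measure Ω} [IsFiniteMeasure P]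
    {m : Measure X} [SigmaFinite m] {W : Ω × ℝ → X} (hW : Measurable W) {D : Set (Ω × ℝ)}
    (hD : MeasurableSet D) {R : X × ℝ → ℝ≥0∞} (hR : Measurable R)
    (h : ∀ B : Set X, MeasurableSet B → ∀ J : Set ℝ, MeasurableSet J →
      ∫⁻ β in J, P {ω | (ω, β) ∈ D ∧ W (ω, β) ∈ B} = ∫⁻ β in J, ∫⁻ z in B, R (z, β) ∂m) :
    ∀ᵐ β : ℝ, (P.restrict {ω | (ω, β) ∈ D}).map (fun ω => W (ω, β)) =
      m.withDensity (fun z => R (z, β)) := by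
  obtain ⟨C, hC1, hC2, hC3, hC4⟩ := exists_piSystem X
  have key : ∀ B : Set X, MeasurableSet B →
      ∀ᵐ β : ℝ, P {ω | (ω, β) ∈ D ∧ W (ω, β) ∈ B} = ∫⁻ z in B, R (z, β) ∂m := by
    intro B hB
    refine ae_eq_of_forall_setLIntegral_eq_of_sigmaFinite ?_ ?_ fun J hJ _ => h B hB J hJ
    · exact measurable_measure_prodMk_right (hD.inter (hW hB))
    · exact Measurable.lintegral_prod_right' (f := fun p : ℝ × X => R (p.2, p.1))
        (hR.comp measurable_swap)
  have hall : ∀ᵐ β : ℝ, ∀ B ∈ C, P {ω | (ω, β) ∈ D ∧ W (ω, β) ∈ B} = ∫⁻ z in B, R (z, β) ∂m :=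
    (ae_ball_iff hC1).2 fun B hB => key B (hC4 B hB)
  filter_upwards [hall, key univ MeasurableSet.univ] with β h1 h2
  have hWb : Measurable (fun ω => W (ω, β)) := hW.comp measurable_prodMk_right
  have hDb : MeasurableSet {ω | (ω, β) ∈ D} := measurable_prodMk_right hD
  have hleft : ∀ B : Set X, MeasurableSet B → ((P.restrict {ω | (ω, β) ∈ D}).map
      (fun ω => W (ω, β))) B = P {ω | (ω, β) ∈ D ∧ W (ω, β) ∈ B} := by
    intro B hB
    rw [Measure.map_apply hWb hB, Measure.restrict_apply (hWb hB), inter_comm]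
    rfl
  refine ext_of_generate_finite C hC3 hC2 (fun B hB => ?_) ?_
  · rw [hleft B (hC4 B hB), h1 B hB, withDensity_apply _ (hC4 B hB)]
  · rw [hleft _ MeasurableSet.univ, h2, withDensity_apply _ MeasurableSet.univ]

lemma lintegral_affine {α : ℝ} (hα : 0 < α) (c : ℝ) {g : ℝ → ℝ≥0∞} (hg : Measurable g) :
    ∫⁻ θ, g θ = ∫⁻ β, ENNReal.ofReal α⁻¹ * g ((c - β) / α) := by
  rw [lintegral_const_mul _ (by fun_prop), lintegral_sub_left_eq_self (fun β => g (β / α)) c]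
  have e := Real.map_volume_mul_left (a := α⁻¹) (inv_ne_zero hα.ne')
  have e2 : ∫⁻ β, g (β / α) = ∫⁻ y, g y ∂(Measure.map (α⁻¹ * ·) volume) := by
    rw [lintegral_map hg (by fun_prop)]
    refine lintegral_congr fun β => ?_
    rw [div_eq_inv_mul]
  rw [e2, e, lintegral_smul_measure, inv_inv, abs_of_pos hα, smul_eq_mul, ← mul_assoc,
    ← ENNReal.ofReal_mul (by positivity), inv_mul_cancel₀ hα.ne', ENNReal.ofReal_one, one_mul]

lemma law_eq {m : Measure X} [SigmaFinite m] {x : X} {a b : ℝ} {A : Set X}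
    {P : Measure (Geo X)} (hP : FP m x a b A P) {α : ℝ} (hα : 0 < α) :
    ∀ᵐ β : ℝ, (P.restrict {γ | 0 < α * len γ + β ∧ α * len γ + β < len γ}).map
        (fun γ => Z γ (α * len γ + β)) =
      m.withDensity (fun z => ENNReal.ofReal α⁻¹ * Qd m P (z, (dist x z - β) / α)) := by
  have := hP.fin
  have hfin := M0_fin hP
  have hlm : Measurable (len : Geo X → ℝ) := len_measurable
  have hum : Measurable (fun p : Geo X × ℝ => α * len p.1 + p.2) :=
    (measurable_const.mul (hlm.comp measurable_fst)).add measurable_snd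
  have hsh : Measurable (fun p : Geo X × ℝ => (p.1, α * len p.1 + p.2)) := measurable_fst.prodMk hum
  refine disint (W := fun p : Geo X × ℝ => Z p.1 (α * len p.1 + p.2))
    (D := (fun p : Geo X × ℝ => (p.1, α * len p.1 + p.2)) ⁻¹' Dom X)
    (R := fun p => ENNReal.ofReal α⁻¹ * Qd m P (p.1, (dist x p.1 - p.2) / α))
    (Z_measurable' measurable_fst hum) (hsh Dom_meas) ?_ ?_
  · exact measurable_const.mul ((Qd_meas m P).comp (by fun_prop))
  intro B hB J hJ
  -- the test function
  let F : X × ℝ → ℝ≥0∞ := (B ×ˢ J).indicator 1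
  have hF : Measurable F := measurable_one.indicator (hB.prod hJ)
  have hFv : ∀ z β, F (z, β) = B.indicator 1 z * J.indicator 1 β := by
    intro z β
    by_cases hz : z ∈ B <;> by_cases hβ : β ∈ J <;> simp [F, hz, hβ]
  let f1 : Geo X × ℝ → ℝ≥0∞ := fun p =>
    (Dom X).indicator (fun q => F (Z q.1 q.2, q.2 - α * len q.1)) p
  have hf1 : Measurable f1 := by
    refine Measurable.indicator (hF.comp ?_) Dom_meas
    exact (Z_measurable' measurable_fst measurable_snd).prodMk
      (measurable_snd.sub (measurable_const.mul (hlm.comp measurable_fst)))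
  have L1 : ∫⁻ β in J, P {γ | (γ, β) ∈ (fun p : Geo X × ℝ => (p.1, α * len p.1 + p.2)) ⁻¹' Dom X ∧
      Z γ (α * len γ + β) ∈ B} = ∫⁻ β, ∫⁻ γ, f1 (γ, α * len γ + β) ∂P := by
    rw [← lintegral_indicator hJ]
    refine lintegral_congr fun β => ?_
    have hms : MeasurableSet {γ : Geo X | (γ, β) ∈ (fun p : Geo X × ℝ =>
        (p.1, α * len p.1 + p.2)) ⁻¹' Dom X ∧ Z γ (α * len γ + β) ∈ B} :=
      (measurable_prodMk_right (hsh Dom_meas)).inter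
        (Z_measurable' measurable_id ((measurable_const.mul hlm).add measurable_const) hB)
    by_cases hβ : β ∈ J
    · rw [indicator_of_mem hβ, ← lintegral_indicator_one hms]
      refine lintegral_congr fun γ => ?_
      by_cases hd : (γ, α * len γ + β) ∈ Dom X <;> by_cases hz : Z γ (α * len γ + β) ∈ B <;>
        simp [f1, hFv, hd, hz, hβ, indicator]
    · rw [indicator_of_notMem hβ]
      symm
      refine (lintegral_congr fun γ => ?_).trans lintegral_zero
      simp [f1, hFv, hβ, indicator]
  have L2 : ∫⁻ β, ∫⁻ γ, f1 (γ, α * len γ + β) ∂P = ∫⁻ p, f1 p ∂(P.prod volume) := by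
    rw [lintegral_lintegral_swap (f := fun β γ => f1 (γ, α * len γ + β))
      (hf1.comp (hsh.comp measurable_swap)).aemeasurable, lintegral_prod _ hf1.aemeasurable]
    refine lintegral_congr fun γ => ?_
    exact lintegral_add_left_eq_self (fun u => f1 (γ, u)) (α * len γ)
  let F2 : X × ℝ → ℝ≥0∞ := fun q => F (q.1, dist x q.1 - α * q.2)
  have hF2 : Measurable F2 := hF.comp (by fun_prop)
  have L3 : ∫⁻ p, f1 p ∂(P.prod volume) = ∫⁻ p, F2 (Phi p) ∂(M0 P) := by
    rw [lintegral_indicator Dom_meas]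
    refine lintegral_congr_ae ?_
    have e1 : ∀ᵐ p ∂(P.prod (volume : Measure ℝ)), eval 0 p.1 = x :=
      Measure.quasiMeasurePreserving_fst.ae hP.start
    filter_upwards [ae_restrict_of_ae e1, ae_restrict_mem Dom_meas] with p h1 h2
    have := dist_Z h1 h2.1.le (h2.1.trans h2.2) h2.2.le
    simp only [F2, Phi, this]
  have L4 : ∫⁻ p, F2 (Phi p) ∂(M0 P) = ∫⁻ z, (∫⁻ θ, Qd m P (z, θ) * F2 (z, θ)) ∂m := by
    rw [← lintegral_map hF2 Phi_meas,
      ← Measure.withDensity_rnDeriv_eq _ _ (ac_Phi hP),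
      lintegral_withDensity_eq_lintegral_mul _ (Measure.measurable_rnDeriv _ _) hF2,
      lintegral_prod _ ((Measure.measurable_rnDeriv _ _).mul hF2).aemeasurable]
    rfl
  have L5 : ∫⁻ z, (∫⁻ θ, Qd m P (z, θ) * F2 (z, θ)) ∂m =
      ∫⁻ z, (∫⁻ β, ENNReal.ofReal α⁻¹ * Qd m P (z, (dist x z - β) / α) * F (z, β)) ∂m := by
    refine lintegral_congr fun z => ?_
    refine (lintegral_affine hα (dist x z) (g := fun θ => Qd m P (z, θ) * F2 (z, θ))
      (((Qd_meas m P).mul hF2).comp measurable_prodMk_left)).trans ?_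
    refine lintegral_congr fun β => ?_
    simp only [F2]
    rw [mul_div_cancel₀ _ hα.ne', show dist x z - (dist x z - β) = β by ring, mul_assoc]
  have hRm : Measurable (fun p : X × ℝ => ENNReal.ofReal α⁻¹ * Qd m P (p.1, (dist x p.1 - p.2) / α)) :=
    measurable_const.mul ((Qd_meas m P).comp (by fun_prop))
  have L6 : ∫⁻ z, (∫⁻ β, ENNReal.ofReal α⁻¹ * Qd m P (z, (dist x z - β) / α) * F (z, β)) ∂m =
      ∫⁻ β in J, ∫⁻ z in B, ENNReal.ofReal α⁻¹ * Qd m P (z, (dist x z - β) / α) ∂m := by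
    rw [lintegral_lintegral_swap (f := fun z β => ENNReal.ofReal α⁻¹ *
      Qd m P (z, (dist x z - β) / α) * F (z, β)) (hRm.mul hF).aemeasurable,
      ← lintegral_indicator hJ]
    refine lintegral_congr fun β => ?_
    by_cases hβ : β ∈ J
    · rw [indicator_of_mem hβ, ← lintegral_indicator hB]
      refine lintegral_congr fun z => ?_
      by_cases hz : z ∈ B <;> simp [hFv, hz, hβ]
    · rw [indicator_of_notMem hβ]
      simp [hFv, hβ]
  exact L1.trans (L2.trans (L3.trans (L4.trans (L5.trans L6))))
end P11

section P12
variable [ProperSpace X] [BorelSpace X]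

/-- the law of `Z` at `α θ + β` has the expected density -/
def GoodLaw (m : Measure X) (x : X) (P : Measure (Geo X)) (α β : ℝ) : Prop :=
  (P.restrict {γ | 0 < α * len γ + β ∧ α * len γ + β < len γ}).map
        (fun γ => Z γ (α * len γ + β)) =
      m.withDensity (fun z => ENNReal.ofReal α⁻¹ * Qd m P (z, (dist x z - β) / α))

lemma Zaff_meas (α β : ℝ) : Measurable (fun γ : Geo X => Z γ (α * len γ + β)) :=
  Z_measurable' measurable_id ((measurable_const.mul len_measurable).add measurable_const)

lemma law_dens {m : Measure X} [SigmaFinite m] {x : X} {a b : ℝ} {A : Set X}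
    {P : Measure (Geo X)} (hP : FP m x a b A P) {α β : ℝ} (hα : 0 < α) (hg : GoodLaw m x P α β)
    {T : Set ℝ} (hT : MeasurableSet T) (hTd : ∀ θ ∈ T, 0 < α * θ + β ∧ α * θ + β < θ) :
    ((P.restrict (len ⁻¹' T)).map (fun γ => Z γ (α * len γ + β)) ≪ m) ∧
    ∀ᵐ γ ∂(P.restrict (len ⁻¹' T)),
      ((P.restrict (len ⁻¹' T)).map (fun γ => Z γ (α * len γ + β))).rnDeriv m (Z γ (α * len γ + β)) =
        ENNReal.ofReal α⁻¹ * Qh m P γ (α * len γ + β) := by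
  have := hP.fin
  have hlm : Measurable (len : Geo X → ℝ) := len_measurable
  have hW := Zaff_meas (X := X) α β
  set D : Set (Geo X) := {γ | 0 < α * len γ + β ∧ α * len γ + β < len γ} with hD
  set S : Set X := (fun z => (dist x z - β) / α) ⁻¹' T with hS
  have hSm : MeasurableSet S := (show Measurable (fun z : X => (dist x z - β) / α) by fun_prop) hT
  have hTm : MeasurableSet (len ⁻¹' T : Set (Geo X)) := hlm hT
  have hDm : MeasurableSet D := (measurableSet_lt measurable_const
    ((measurable_const.mul hlm).add measurable_const)).inter
    (measurableSet_lt ((measurable_const.mul hlm).add measurable_const) hlm)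
  have hth : ∀ᵐ γ ∂P, γ ∈ D → (dist x (Z γ (α * len γ + β)) - β) / α = len γ := by
    filter_upwards [hP.start, hP.len] with γ h1 h2 h3
    rw [dist_Z h1 h3.1.le (hP.ha.trans_le h2.1) h3.2.le]
    field_simp
    ring
  have hre : P.restrict (len ⁻¹' T) =
      (P.restrict D).restrict ((fun γ => Z γ (α * len γ + β)) ⁻¹' S) := by
    rw [Measure.restrict_restrict (hW hSm)]
    refine Measure.restrict_congr_set ?_
    rw [Filter.eventuallyEq_set]
    filter_upwards [hth] with γ h1
    constructor
    · intro h2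
      have h3 : γ ∈ D := hTd _ h2
      refine ⟨?_, h3⟩
      change (dist x (Z γ (α * len γ + β)) - β) / α ∈ T
      rw [h1 h3]; exact h2
    · rintro ⟨h2, h3⟩
      change (dist x (Z γ (α * len γ + β)) - β) / α ∈ T at h2
      rw [h1 h3] at h2; exact h2
  set q : X → ℝ≥0∞ := fun z => ENNReal.ofReal α⁻¹ * Qd m P (z, (dist x z - β) / α) with hq
  have hqm : Measurable q := measurable_const.mul ((Qd_meas m P).comp (by fun_prop))
  have hmap : (P.restrict (len ⁻¹' T)).map (fun γ => Z γ (α * len γ + β)) =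
      m.withDensity (S.indicator q) := by
    rw [hre, ← Measure.restrict_map hW hSm, withDensity_indicator hSm, ← restrict_withDensity hSm]
    congr 1
  have hac : (P.restrict (len ⁻¹' T)).map (fun γ => Z γ (α * len γ + β)) ≪ m := by
    rw [hmap]; exact withDensity_absolutelyContinuous _ _
  refine ⟨hac, ?_⟩
  have e1 : ((P.restrict (len ⁻¹' T)).map (fun γ => Z γ (α * len γ + β))).rnDeriv m =ᵐ[m]
      S.indicator q := by
    rw [hmap]
    exact Measure.rnDeriv_withDensity m (hqm.indicator hSm)
  have e2 := ae_of_ae_map hW.aemeasurable (hac.ae_le e1)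
  filter_upwards [e2, ae_restrict_of_ae hth, ae_restrict_mem hTm] with γ h1 h2 h3
  rw [h1]
  have h4 := h2 (hTd _ h3)
  have h5 : Z γ (α * len γ + β) ∈ S := by
    change (dist x (Z γ (α * len γ + β)) - β) / α ∈ T
    rw [h4]; exact h3
  rw [indicator_of_mem h5]
  simp only [hq, h4, Qh]

lemma radial_key {K N : ℝ} {m : Measure X} [SigmaFinite m] (H : Hyp K N m) {x : X} {a b : ℝ}
    {A : Set X} {P : Measure (Geo X)} (hP : FP m x a b A P) {α₀ β₀ α₁ β₁ : ℝ} (h0 : 0 < α₀)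
    (h1 : 0 < α₁) {T : Set ℝ} (hT : MeasurableSet T)
    (hT0 : ∀ θ ∈ T, 0 < α₀ * θ + β₀ ∧ α₀ * θ + β₀ ≤ θ)
    (hT1 : ∀ θ ∈ T, 0 < α₁ * θ + β₁ ∧ α₁ * θ + β₁ ≤ θ)
    (hac0 : (P.restrict (len ⁻¹' T)).map (fun γ => Z γ (α₀ * len γ + β₀)) ≪ m)
    (hac1 : (P.restrict (len ⁻¹' T)).map (fun γ => Z γ (α₁ * len γ + β₁)) ≪ m)
    {l : unitInterval} (hl : (l:ℝ) ∈ Ioo (0:ℝ) 1) {α β : ℝ}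
    (hα : α = (1 - l) * α₀ + l * α₁) (hβ : β = (1 - l) * β₀ + l * β₁)
    {N' : ℝ} (hN' : N ≤ N') (hN1 : 1 < N') :
    ∀ᵐ γ ∂(P.restrict (len ⁻¹' T)),
      sigmaCoeff K N' (1 - l) |(α₀ * len γ + β₀) - (α₁ * len γ + β₁)| *
        (((P.restrict (len ⁻¹' T)).map (fun γ => Z γ (α₀ * len γ + β₀))).rnDeriv m
          (Z γ (α₀ * len γ + β₀))) ^ (-(1 / N')) +
      sigmaCoeff K N' l |(α₀ * len γ + β₀) - (α₁ * len γ + β₁)| *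
        (((P.restrict (len ⁻¹' T)).map (fun γ => Z γ (α₁ * len γ + β₁))).rnDeriv m
          (Z γ (α₁ * len γ + β₁))) ^ (-(1 / N')) ≤
      (((P.restrict (len ⁻¹' T)).map (fun γ => Z γ (α * len γ + β))).rnDeriv m
          (Z γ (α * len γ + β))) ^ (-(1 / N')) := by
  have := hP.fin
  have hlm : Measurable (len : Geo X → ℝ) := len_measurable
  have hTm : MeasurableSet (len ⁻¹' T : Set (Geo X)) := hlm hT
  set ρ := P.restrict (len ⁻¹' T) with hρ
  let G : Geo X → Geo X := fun γ => subseg γ (cl ((α₀ * len γ + β₀) / len γ))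
    (cl ((α₁ * len γ + β₁) / len γ))
  have hG : Measurable G := by
    refine subseg_measurable measurable_id ?_ ?_ <;>
    exact cl_continuous.measurable.comp
      (((measurable_const.mul hlm).add measurable_const).div hlm)
  have g0 : ∀ γ, eval 0 (G γ) = Z γ (α₀ * len γ + β₀) := fun γ => eval_subseg_zero _ _ _
  have g1 : ∀ γ, eval 1 (G γ) = Z γ (α₁ * len γ + β₁) := fun γ => eval_subseg_one _ _ _
  have hbase : ∀ᵐ γ ∂ρ, eval 0 γ = x ∧ 0 < len γ ∧ len γ ≤ b ∧ len γ ∈ T := by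
    filter_upwards [ae_restrict_of_ae hP.start, ae_restrict_of_ae hP.len, ae_restrict_mem hTm]
      with γ a1 a2 a3
    exact ⟨a1, hP.ha.trans_le a2.1, a2.2, a3⟩
  have gl : ∀ᵐ γ ∂ρ, eval l (G γ) = Z γ (α * len γ + β) := by
    filter_upwards [hbase] with γ hγ
    obtain ⟨k1, k2, k3, k4⟩ := hγ
    have t0 := hT0 _ k4
    have t1 := hT1 _ k4
    have s0 : 0 ≤ (α₀ * len γ + β₀) / len γ := div_nonneg t0.1.le k2.le
    have s1 : 0 ≤ (α₁ * len γ + β₁) / len γ := div_nonneg t1.1.le k2.le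
    have r0 : (α₀ * len γ + β₀) / len γ ≤ 1 := (div_le_one k2).2 t0.2
    have r1 : (α₁ * len γ + β₁) / len γ ≤ 1 := (div_le_one k2).2 t1.2
    have hfe : (α * len γ + β) / len γ =
        (1 - l) * ((α₀ * len γ + β₀) / len γ) + l * ((α₁ * len γ + β₁) / len γ) := by
      rw [hα, hβ]; field_simp; ring
    have hl1 := hl.1
    have hl2 : 0 < 1 - (l:ℝ) := by linarith [hl.2]
    change eval (cmb _ _ l) γ = eval _ γ
    congr 1
    refine Subtype.ext ?_
    rw [coe_cmb, coe_cl s0 r0, coe_cl s1 r1, coe_cl, hfe]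
    · rw [hfe]; positivity
    · rw [hfe]; nlinarith
  have hd : ∀ᵐ γ ∂ρ, dist x (eval 0 (G γ)) = α₀ * len γ + β₀ ∧
      dist x (eval 1 (G γ)) = α₁ * len γ + β₁ ∧
      len (G γ) = |(α₀ * len γ + β₀) - (α₁ * len γ + β₁)| ∧ len γ ≤ b ∧ len γ ∈ T := by
    filter_upwards [hbase] with γ hγ
    obtain ⟨k1, k2, k3, k4⟩ := hγ
    have t0 := hT0 _ k4
    have t1 := hT1 _ k4
    refine ⟨?_, ?_, ?_, k3, k4⟩
    · rw [g0, dist_Z k1 t0.1.le k2 t0.2]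
    · rw [g1, dist_Z k1 t1.1.le k2 t1.2]
    · have s0 : 0 ≤ (α₀ * len γ + β₀) / len γ := div_nonneg t0.1.le k2.le
      have s1 : 0 ≤ (α₁ * len γ + β₁) / len γ := div_nonneg t1.1.le k2.le
      have r0 : (α₀ * len γ + β₀) / len γ ≤ 1 := (div_le_one k2).2 t0.2
      have r1 : (α₁ * len γ + β₁) / len γ ≤ 1 := (div_le_one k2).2 t1.2
      have e1 : len (G γ) = |(α₀ * len γ + β₀) / len γ - (α₁ * len γ + β₁) / len γ| * len γ := by
        have := len_subseg γ (cl ((α₀ * len γ + β₀) / len γ)) (cl ((α₁ * len γ + β₁) / len γ))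
        rw [coe_cl s0 r0, coe_cl s1 r1] at this
        exact this
      have e2 : (α₀ * len γ + β₀) / len γ - (α₁ * len γ + β₁) / len γ =
        ((α₀ * len γ + β₀) - (α₁ * len γ + β₁)) / len γ := by ring
      rw [e1, e2, abs_div, abs_of_pos k2, div_mul_cancel₀ _ k2.ne']
  have hmapt : ∀ t : unitInterval, ∀ f : Geo X → X, (∀ᵐ γ ∂ρ, eval t (G γ) = f γ) →
      (ρ.map G).map (eval t) = ρ.map f := by
    intro t f hf
    rw [Measure.map_map (eval_measurable t) hG]
    exact Measure.map_congr hf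
  have m0 := hmapt 0 _ (Filter.Eventually.of_forall g0)
  have m1 := hmapt 1 _ (Filter.Eventually.of_forall g1)
  have ml := hmapt l _ gl
  have hR : RPlan m x (ρ.map G) := by
    refine ⟨inferInstance, by rw [m0]; exact hac0, by rw [m1]; exact hac1, ⟨b, ?_⟩,
      ⟨α₁ / α₀, β₁ - α₁ / α₀ * β₀, by positivity, ?_⟩⟩
    · have hms : MeasurableSet {γ : Geo X | dist x (eval 0 γ) ≤ b ∧ dist x (eval 1 γ) ≤ b} :=
        (measurableSet_le (measurable_const.dist (eval_measurable 0)) measurable_const).inter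
          (measurableSet_le (measurable_const.dist (eval_measurable 1)) measurable_const)
      rw [ae_map_iff (p := fun γ => dist x (eval 0 γ) ≤ b ∧ dist x (eval 1 γ) ≤ b)
        hG.aemeasurable hms]
      filter_upwards [hd] with γ hγ
      obtain ⟨d0, d1, -, d3, d4⟩ := hγ
      rw [d0, d1]
      exact ⟨(hT0 _ d4).2.trans d3, (hT1 _ d4).2.trans d3⟩
    · have e0 : Measurable (fun γ : Geo X => dist x (eval 0 γ)) :=
        measurable_const.dist (eval_measurable 0)
      have e1 : Measurable (fun γ : Geo X => dist x (eval 1 γ)) :=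
        measurable_const.dist (eval_measurable 1)
      have hms : MeasurableSet {γ : Geo X | dist x (eval 1 γ) =
          α₁ / α₀ * dist x (eval 0 γ) + (β₁ - α₁ / α₀ * β₀) ∧
          len γ = |dist x (eval 0 γ) - dist x (eval 1 γ)|} :=
        (measurableSet_eq_fun e1 ((measurable_const.mul e0).add measurable_const)).inter
          (measurableSet_eq_fun hlm (e0.sub e1).abs)
      rw [ae_map_iff (p := fun γ => dist x (eval 1 γ) =
          α₁ / α₀ * dist x (eval 0 γ) + (β₁ - α₁ / α₀ * β₀) ∧
          len γ = |dist x (eval 0 γ) - dist x (eval 1 γ)|)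
        hG.aemeasurable hms]
      filter_upwards [hd] with γ hγ
      obtain ⟨d0, d1, d2, d3, d4⟩ := hγ
      rw [d0, d1, d2]
      refine ⟨?_, rfl⟩
      field_simp
      ring
  have key := ae_of_ae_map hG.aemeasurable (key_prop H hR hl hN' hN1)
  filter_upwards [key, hd, gl] with γ hk hγ hgl
  obtain ⟨-, -, d2, -, -⟩ := hγ
  unfold cdL Dn at hk
  rwa [m0, m1, ml, d2, g0, g1, hgl] at hk
end P12

section P13
variable [ProperSpace X] [BorelSpace X]

lemma ae_shift {p : ℝ → Prop} (h : ∀ᵐ x : ℝ, p x) (t : ℝ) : ∀ᵐ x : ℝ, p (x + t) :=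
  (measurePreserving_add_right volume t).quasiMeasurePreserving.ae h

/-- midpoint inequality -/
def MidIneq (K N' : ℝ) (m : Measure X) (P : Measure (Geo X)) (α₀ α₁ : ℝ) (γ : Geo X) (c h : ℝ) :
    Prop :=
  0 < h → 0 < c - h → c + h < len γ →
    sigmaCoeff K N' (1 / 2) (2 * h) * (ENNReal.ofReal α₀⁻¹ * Qh m P γ (c - h)) ^ (-(1 / N')) +
    sigmaCoeff K N' (1 / 2) (2 * h) * (ENNReal.ofReal α₁⁻¹ * Qh m P γ (c + h)) ^ (-(1 / N')) ≤
    (ENNReal.ofReal ((α₀ + α₁) / 2)⁻¹ * Qh m P γ c) ^ (-(1 / N'))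

lemma MidIneq_meas (K N' : ℝ) (m : Measure X) (P : Measure (Geo X)) (α₀ α₁ : ℝ)
    {Ω : Type*} [MeasurableSpace Ω] {G : Ω → Geo X} {c h : Ω → ℝ} (hG : Measurable G)
    (hc : Measurable c) (hh : Measurable h) :
    MeasurableSet {ω | MidIneq K N' m P α₀ α₁ (G ω) (c ω) (h ω)} := by
  unfold MidIneq
  have s1 : Measurable fun ω => sigmaCoeff K N' (1 / 2) (2 * h ω) :=
    (sigma_measurable K N' (1/2)).comp (hh.const_mul 2)
  refine (measurableSet_lt measurable_const hh).imp
    ((measurableSet_lt measurable_const (hc.sub hh)).imp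
    ((measurableSet_lt (hc.add hh) (len_measurable.comp hG)).imp (measurableSet_le ?_ ?_)))
  · exact (s1.mul ((measurable_const.mul (Qh_meas' m P hG (hc.sub hh))).pow_const _)).add
      (s1.mul ((measurable_const.mul (Qh_meas' m P hG (hc.add hh))).pow_const _))
  · exact (measurable_const.mul (Qh_meas' m P hG hc)).pow_const _

lemma mid_fixed {K N : ℝ} {m : Measure X} [SigmaFinite m] (H : Hyp K N m) {x : X} {a b : ℝ}
    {A : Set X} {P : Measure (Geo X)} (hP : FP m x a b A P) {α₀ α₁ : ℝ} (h0 : 0 < α₀)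
    (h1 : 0 < α₁) {N' : ℝ} (hN' : N ≤ N') (hN1 : 1 < N') (η : ℝ) :
    ∀ᵐ β : ℝ, ∀ᵐ γ ∂P, MidIneq K N' m P α₀ α₁ γ (β + (α₀ + α₁) / 2 * len γ)
      (η + (α₁ - α₀) / 2 * len γ) := by
  have := hP.fin
  have hlm : Measurable (len : Geo X → ℝ) := len_measurable
  have g0 : ∀ᵐ β : ℝ, GoodLaw m x P α₀ (β + -η) := ae_shift (law_eq hP h0) (-η)
  have g1 : ∀ᵐ β : ℝ, GoodLaw m x P α₁ (β + η) := ae_shift (law_eq hP h1) η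
  have gm : ∀ᵐ β : ℝ, GoodLaw m x P ((α₀ + α₁) / 2) β := law_eq hP (by positivity)
  filter_upwards [g0, g1, gm] with β k0 k1 km
  let T : Set ℝ := {θ | (0 < α₀ * θ + (β + -η) ∧ α₁ * θ + (β + η) < θ) ∧
    0 < η + (α₁ - α₀) / 2 * θ}
  have hT : MeasurableSet T := by
    have a1 : MeasurableSet {θ : ℝ | 0 < α₀ * θ + (β + -η)} :=
      measurableSet_lt (by fun_prop) (by fun_prop)
    have a2 : MeasurableSet {θ : ℝ | α₁ * θ + (β + η) < θ} :=
      measurableSet_lt (by fun_prop) (by fun_prop)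
    have a3 : MeasurableSet {θ : ℝ | 0 < η + (α₁ - α₀) / 2 * θ} :=
      measurableSet_lt (by fun_prop) (by fun_prop)
    exact (a1.inter a2).inter a3
  have d0 : ∀ θ ∈ T, 0 < α₀ * θ + (β + -η) ∧ α₀ * θ + (β + -η) < θ := by
    rintro θ ⟨⟨a1, a2⟩, a3⟩
    constructor <;> nlinarith
  have d1 : ∀ θ ∈ T, 0 < α₁ * θ + (β + η) ∧ α₁ * θ + (β + η) < θ := by
    rintro θ ⟨⟨a1, a2⟩, a3⟩
    constructor <;> nlinarith
  have dm : ∀ θ ∈ T, 0 < (α₀ + α₁) / 2 * θ + β ∧ (α₀ + α₁) / 2 * θ + β < θ := by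
    rintro θ ⟨⟨a1, a2⟩, a3⟩
    constructor <;> nlinarith
  obtain ⟨c0, e0⟩ := law_dens hP h0 k0 hT d0
  obtain ⟨c1, e1⟩ := law_dens hP h1 k1 hT d1
  obtain ⟨cm, em⟩ := law_dens hP (by positivity) km hT dm
  have key := radial_key H hP h0 h1 hT (fun θ h => ⟨(d0 θ h).1, (d0 θ h).2.le⟩)
    (fun θ h => ⟨(d1 θ h).1, (d1 θ h).2.le⟩) c0 c1 (l := ⟨1 / 2, by norm_num, by norm_num⟩)
    (by constructor <;> norm_num) (α := (α₀ + α₁) / 2) (β := β) (by push_cast; ring)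
    (by push_cast; ring) hN' hN1
  have key2 := (ae_restrict_iff' (hlm hT)).1 (key.and (e0.and (e1.and em)))
  filter_upwards [key2] with γ hγ p1 p2 p3
  have hm : len γ ∈ T := by
    refine ⟨⟨?_, ?_⟩, p1⟩ <;> linarith
  obtain ⟨q, r0, r1, rm⟩ := hγ hm
  rw [r0, r1, rm] at q
  have eq0 : α₀ * len γ + (β + -η) = β + (α₀ + α₁) / 2 * len γ - (η + (α₁ - α₀) / 2 * len γ) := by
    ring
  have eq1 : α₁ * len γ + (β + η) = β + (α₀ + α₁) / 2 * len γ + (η + (α₁ - α₀) / 2 * len γ) := by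
    ring
  have eqm : (α₀ + α₁) / 2 * len γ + β = β + (α₀ + α₁) / 2 * len γ := by ring
  have eqa : |α₀ * len γ + (β + -η) - (α₁ * len γ + (β + η))| =
      2 * (η + (α₁ - α₀) / 2 * len γ) := by
    rw [abs_of_neg] <;> linarith
  rw [eqa, eq0, eq1, eqm] at q
  have e3 : (1 - (1 / 2) : ℝ) = 1 / 2 := by norm_num
  simp only [e3] at q
  exact q

lemma mid_ae {K N : ℝ} {m : Measure X} [SigmaFinite m] (H : Hyp K N m) {x : X} {a b : ℝ}
    {A : Set X} {P : Measure (Geo X)} (hP : FP m x a b A P) {α₀ α₁ : ℝ} (h0 : 0 < α₀)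
    (h1 : 0 < α₁) {N' : ℝ} (hN' : N ≤ N') (hN1 : 1 < N') :
    ∀ᵐ γ ∂P, ∀ᵐ h : ℝ, ∀ᵐ c : ℝ, MidIneq K N' m P α₀ α₁ γ c h := by
  have := hP.fin
  have hlm : Measurable (len : Geo X → ℝ) := len_measurable
  have s1 : ∀ η : ℝ, ∀ᵐ γ ∂P, ∀ᵐ c : ℝ, MidIneq K N' m P α₀ α₁ γ c
      (η + (α₁ - α₀) / 2 * len γ) := by
    intro η
    have := mid_fixed H hP h0 h1 hN' hN1 η
    rw [Measure.ae_ae_comm] at this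
    · filter_upwards [this] with γ hγ
      have := ae_shift hγ (-((α₀ + α₁) / 2 * len γ))
      filter_upwards [this] with c hc
      rwa [neg_add_cancel_right] at hc
    · exact MidIneq_meas K N' m P α₀ α₁ measurable_snd
        (measurable_fst.add (measurable_const.mul (hlm.comp measurable_snd)))
        (measurable_const.add (measurable_const.mul (hlm.comp measurable_snd)))
  have s2 : ∀ᵐ η : ℝ, ∀ᵐ z ∂(P.prod (volume : Measure ℝ)), MidIneq K N' m P α₀ α₁ z.1 z.2
      (η + (α₁ - α₀) / 2 * len z.1) := by
    refine Eventually.of_forall fun η => ?_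
    rw [Measure.ae_prod_iff_ae_ae]
    · exact s1 η
    · exact MidIneq_meas K N' m P α₀ α₁ measurable_fst measurable_snd
        (measurable_const.add (measurable_const.mul (hlm.comp measurable_fst)))
  rw [Measure.ae_ae_comm] at s2
  · have s3 := Measure.ae_ae_of_ae_prod s2
    filter_upwards [s3] with γ hγ
    have : ∀ᵐ c : ℝ, ∀ᵐ h : ℝ, MidIneq K N' m P α₀ α₁ γ c h := by
      filter_upwards [hγ] with c hc
      have := ae_shift hc (-((α₁ - α₀) / 2 * len γ))
      filter_upwards [this] with h hh
      simpa using hh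
    rw [Measure.ae_ae_comm] at this
    · exact this
    · exact MidIneq_meas K N' m P α₀ α₁ measurable_const measurable_fst measurable_snd
  · exact MidIneq_meas K N' m P α₀ α₁ (measurable_fst.comp measurable_snd)
      (measurable_snd.comp measurable_snd)
      (measurable_fst.add (measurable_const.mul (hlm.comp (measurable_fst.comp measurable_snd))))
end P13

section P14

/-- generalised sine -/
def sn (k x : ℝ) : ℝ := if 0 < k then Real.sin (Real.sqrt k * x) else Real.sinh (Real.sqrt (-k) * x)

/-- generalised cosine -/
def cs (k x : ℝ) : ℝ := if 0 < k then Real.cos (Real.sqrt k * x) else Real.cosh (Real.sqrt (-k) * x)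

lemma sn_add (k x h : ℝ) : sn k (x - h) + sn k (x + h) = 2 * cs k h * sn k x := by
  unfold sn cs
  split_ifs
  · rw [mul_sub, mul_add, Real.sin_sub, Real.sin_add]; ring
  · rw [mul_sub, mul_add, Real.sinh_sub, Real.sinh_add]; ring

lemma sn_zero (k : ℝ) : sn k 0 = 0 := by unfold sn; split_ifs <;> simp

lemma sn_cont (k : ℝ) : Continuous (sn k) := by
  unfold sn
  split_ifs
  · exact Real.continuous_sin.comp (by fun_prop)
  · exact Real.continuous_sinh.comp (by fun_prop)

lemma sn_pos {k x : ℝ} (hk : k ≠ 0) (hx : 0 < x) (h : 0 < k → Real.sqrt k * x < Real.pi) :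
    0 < sn k x := by
  unfold sn
  split_ifs with h1
  · exact Real.sin_pos_of_pos_of_lt_pi (by positivity) (h h1)
  · have : 0 < -k := by
      rcases lt_or_gt_of_ne hk with h2 | h2
      · linarith
      · exact absurd h2 h1
    rw [Real.sinh_pos_iff]
    positivity

lemma mid_real {n C : ℝ} (hn : 1 < n) (hC : 0 < C) {Q0 Q1 Qc S : ℝ≥0∞}
    (h0 : 0 < Q0 ∧ Q0 < ⊤) (h1 : 0 < Q1 ∧ Q1 < ⊤) (hc : 0 < Qc ∧ Qc < ⊤)
    (hS : ENNReal.ofReal (1 / 2 * C ^ (-((n - 1) / n))) ≤ S)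
    (hq : ∀ q0 q1 : ℚ, S * (ENNReal.ofReal (Real.exp q0)⁻¹ * Q0) ^ (-(1 / n)) +
      S * (ENNReal.ofReal (Real.exp q1)⁻¹ * Q1) ^ (-(1 / n)) ≤
      (ENNReal.ofReal ((Real.exp q0 + Real.exp q1) / 2)⁻¹ * Qc) ^ (-(1 / n))) :
    Q0.toReal ^ (-(1 / (n - 1))) + Q1.toReal ^ (-(1 / (n - 1))) ≤
      2 * C * Qc.toReal ^ (-(1 / (n - 1))) := by
  have hn0 : 0 < n := by linarith
  have hn1 : 0 < n - 1 := by linarith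
  have p0 := ENNReal.toReal_pos h0.1.ne' h0.2.ne
  have p1 := ENNReal.toReal_pos h1.1.ne' h1.2.ne
  have pc := ENNReal.toReal_pos hc.1.ne' hc.2.ne
  have conv : ∀ {α : ℝ} {Q : ℝ≥0∞}, 0 < α → Q < ⊤ → 0 < Q.toReal →
      (ENNReal.ofReal α⁻¹ * Q) ^ (-(1 / n)) = ENNReal.ofReal ((α⁻¹ * Q.toReal) ^ (-(1 / n))) := by
    intro α Q hα hQ hQ'
    rw [← ENNReal.ofReal_rpow_of_pos (by positivity), ENNReal.ofReal_mul (by positivity),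
      ENNReal.ofReal_toReal hQ.ne]
  generalize hs : 1 / 2 * C ^ (-((n - 1) / n)) = s at hS
  have hsp : 0 < s := by rw [← hs]; positivity
  have R : ∀ q0 q1 : ℚ, s * ((Real.exp q0)⁻¹ * Q0.toReal) ^ (-(1 / n)) +
      s * ((Real.exp q1)⁻¹ * Q1.toReal) ^ (-(1 / n)) ≤
      (((Real.exp q0 + Real.exp q1) / 2)⁻¹ * Qc.toReal) ^ (-(1 / n)) := by
    intro q0 q1
    have := hq q0 q1
    rw [conv (Real.exp_pos _) h0.2 p0, conv (Real.exp_pos _) h1.2 p1,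
      conv (by positivity) hc.2 pc] at this
    have h2 := (add_le_add (mul_le_mul_left hS _) (mul_le_mul_left hS _)).trans this
    rw [← ENNReal.ofReal_mul hsp.le, ← ENNReal.ofReal_mul hsp.le,
      ← ENNReal.ofReal_add (by positivity) (by positivity),
      ENNReal.ofReal_le_ofReal_iff (by positivity)] at h2
    exact h2
  have R' : ∀ t0 t1 : ℝ, s * ((Real.exp t0)⁻¹ * Q0.toReal) ^ (-(1 / n)) +
      s * ((Real.exp t1)⁻¹ * Q1.toReal) ^ (-(1 / n)) ≤
      (((Real.exp t0 + Real.exp t1) / 2)⁻¹ * Qc.toReal) ^ (-(1 / n)) := by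
    intro t0 t1
    refine Rat.denseRange_cast.induction_on₂ (p := fun t0 t1 : ℝ =>
      s * ((Real.exp t0)⁻¹ * Q0.toReal) ^ (-(1 / n)) +
      s * ((Real.exp t1)⁻¹ * Q1.toReal) ^ (-(1 / n)) ≤
      (((Real.exp t0 + Real.exp t1) / 2)⁻¹ * Qc.toReal) ^ (-(1 / n))) ?_ R t0 t1
    refine isClosed_le ?_ ?_
    · refine Continuous.add (continuous_const.mul ?_) (continuous_const.mul ?_)
      · refine Continuous.rpow_const (Continuous.mul (Continuous.inv₀ (by fun_prop)
          fun z => (Real.exp_pos _).ne') continuous_const) fun z => Or.inl ?_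
        have := Real.exp_pos z.1
        positivity
      · refine Continuous.rpow_const (Continuous.mul (Continuous.inv₀ (by fun_prop)
          fun z => (Real.exp_pos _).ne') continuous_const) fun z => Or.inl ?_
        have := Real.exp_pos z.2
        positivity
    · refine Continuous.rpow_const (Continuous.mul (Continuous.inv₀ (by fun_prop)
          fun z => ?_) continuous_const) fun z => Or.inl ?_
      · positivity
      · positivity
  set g0 := Q0.toReal ^ (-(1 / (n - 1))) with hg0
  set g1 := Q1.toReal ^ (-(1 / (n - 1))) with hg1
  set gc := Qc.toReal ^ (-(1 / (n - 1))) with hgc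
  have g0p : 0 < g0 := by positivity
  have g1p : 0 < g1 := by positivity
  have gcp : 0 < gc := by positivity
  have inv : ∀ {q : ℝ}, 0 < q → q = (q ^ (-(1 / (n - 1)))) ^ (-(n - 1)) := by
    intro q hq
    rw [← Real.rpow_mul hq.le]
    have : -(1 / (n - 1)) * -(n - 1) = 1 := by field_simp
    rw [this, Real.rpow_one]
  have simp1 : ∀ {g : ℝ}, 0 < g → (g⁻¹ * g ^ (-(n - 1))) ^ (-(1 / n)) = g := by
    intro g hg
    rw [← Real.rpow_neg_one, ← Real.rpow_add hg, ← Real.rpow_mul hg.le]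
    have : (-1 + -(n - 1)) * -(1 / n) = 1 := by field_simp; ring
    rw [this, Real.rpow_one]
  have key := R' (Real.log g0) (Real.log g1)
  rw [Real.exp_log g0p, Real.exp_log g1p, inv p0, inv p1, inv pc, ← hg0, ← hg1, ← hgc,
    simp1 g0p, simp1 g1p] at key
  set M := (g0 + g1) / 2 with hM
  have Mp : 0 < M := by positivity
  have e1 : (M⁻¹ * gc ^ (-(n - 1))) ^ (-(1 / n)) = M ^ (1 / n) * gc ^ ((n - 1) / n) := by
    rw [Real.mul_rpow (by positivity) (by positivity), ← Real.rpow_mul gcp.le, Real.inv_rpow Mp.le,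
      Real.rpow_neg Mp.le, inv_inv]
    congr 2
    field_simp
  have e2 : s * g0 + s * g1 = C ^ (-((n - 1) / n)) * (M ^ (1 / n) * M ^ ((n - 1) / n)) := by
    rw [← Real.rpow_add Mp]
    have : 1 / n + (n - 1) / n = 1 := by field_simp; ring
    rw [this, Real.rpow_one, ← hs, hM]; ring
  rw [e1, e2] at key
  have k2 : C ^ (-((n - 1) / n)) * M ^ ((n - 1) / n) ≤ gc ^ ((n - 1) / n) := by
    have : 0 < M ^ (1 / n) := by positivity
    refine le_of_mul_le_mul_left ?_ this
    linarith
  have k3 : M ^ ((n - 1) / n) ≤ (C * gc) ^ ((n - 1) / n) := by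
    rw [Real.mul_rpow hC.le gcp.le]
    rw [Real.rpow_neg hC.le] at k2
    rwa [inv_mul_le_iff₀ (by positivity)] at k2
  have k4 := (Real.rpow_le_rpow_iff Mp.le (by positivity) (by positivity)).1 k3
  rw [hM] at k4
  linarith

lemma e5_aux {K K' n h : ℝ} (hK : 0 < K') (hn : 1 < n) :
    -((K + K') / (2 * K') * (K' / (n - 1) * h ^ 2 / 2)) * ((n - 1) / n) =
      -((K + K') / 4 * h ^ 2 / n) := by
  have h1 : n - 1 ≠ 0 := by linarith
  have h2 : n ≠ 0 := by linarith
  field_simp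
  ring

set_option maxHeartbeats 1000000 in
lemma sig_local {K K' n : ℝ} (hn : 1 < n) (hK : K' < K) (hK0 : K' ≠ 0) (hKp : 0 < K → 0 < K') :
    ∃ δ > 0, ∀ h, 0 < h → h < δ → 0 < cs (K' / (n - 1)) h ∧
      ENNReal.ofReal (1 / 2 * (cs (K' / (n - 1)) h) ^ (-((n - 1) / n))) ≤
        sigmaCoeff K n (1 / 2) (2 * h) := by
  have hn0 : 0 < n := by linarith
  have hn1 : 0 < n - 1 := by linarith
  have hp : 0 < (n - 1) / n := by positivity
  have ev : ∀ c d : ℝ, 0 < d → ∀ᶠ h : ℝ in 𝓝 0, c * h ^ 2 < d := by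
    intro c d hd
    have : ContinuousAt (fun h : ℝ => c * h ^ 2) 0 := by fun_prop
    exact this.eventually_lt continuousAt_const (by simpa using hd)
  have fin : ∀ {p : ℝ → Prop}, (∀ᶠ h : ℝ in 𝓝 0, 0 < h → p h) → ∃ δ > 0, ∀ h, 0 < h → h < δ → p h := by
    intro p hp
    obtain ⟨δ, hδ, h⟩ := Metric.eventually_nhds_iff.1 hp
    refine ⟨δ, hδ, fun y hy hy' => h ?_ hy⟩
    rw [Real.dist_eq, sub_zero, abs_of_pos hy]; exact hy'
  rcases lt_trichotomy K 0 with hk | hk | hk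
  · -- negative
    refine fin ?_
    set μ := K / K' with hμ
    have hK'n : K' < 0 := by linarith
    have hμ0 : 0 < μ := div_pos_of_neg_of_neg hk hK'n
    have hμ1 : μ < 1 := by rw [hμ, div_lt_one_of_neg hK'n]; exact hK
    filter_upwards [ev (μ * (-(K' / (n - 1)) / 2)) (1 - μ) (by linarith)] with h hh hpos
    have hk' : ¬ 0 < K' / (n - 1) := by
      rw [not_lt]; exact div_nonpos_of_nonpos_of_nonneg hK'n.le hn1.le
    have hcs : cs (K' / (n - 1)) h = Real.cosh (Real.sqrt (-(K' / (n - 1))) * h) := by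
      unfold cs; rw [if_neg hk']
    have hk2 : 0 ≤ -(K' / (n - 1)) := by linarith
    set b := Real.sqrt (-(K' / (n - 1))) * h with hb
    have hb2 : b ^ 2 = -(K' / (n - 1)) * h ^ 2 := by rw [hb, mul_pow, Real.sq_sqrt hk2]
    have hcp : 0 < Real.cosh b := Real.cosh_pos _
    refine ⟨by rw [hcs]; exact hcp, ?_⟩
    have kk : K * (2 * h) ^ 2 < 0 := mul_neg_of_neg_of_pos hk (by positivity)
    unfold sigmaCoeff
    rw [if_neg (by nlinarith [Real.pi_pos, sq_nonneg Real.pi]), if_neg (by linarith),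
      if_neg (by linarith), hcs]
    refine ENNReal.ofReal_le_ofReal ?_
    have hkn : 0 < -K / n := div_pos (by linarith) hn0
    set w := Real.sqrt (-K / n) with hw
    have hwp : 0 < w := Real.sqrt_pos.2 hkn
    have ea : (1 / 2 : ℝ) * (2 * h) * w = w * h := by ring
    have eb : (2 * h) * w = 2 * (w * h) := by ring
    rw [ea, eb, Real.sinh_two_mul]
    have hsp : 0 < Real.sinh (w * h) := Real.sinh_pos_iff.2 (by positivity)
    have hca : 0 < Real.cosh (w * h) := Real.cosh_pos _
    have ec : Real.sinh (w * h) / (2 * Real.sinh (w * h) * Real.cosh (w * h)) =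
        1 / 2 * (Real.cosh (w * h))⁻¹ := by field_simp
    rw [ec, Real.rpow_neg hcp.le]
    gcongr
    have c1 : Real.exp (μ * (b ^ 2 / 2)) ≤ Real.cosh b := by
      have d1 : 1 + b ^ 2 / 2 ≤ Real.cosh b := by
        have q1 : 0 ≤ b / 2 := by positivity
        have q2 := Real.self_le_sinh_iff.2 q1
        have q3 := Real.cosh_two_mul (b / 2)
        have q4 := Real.cosh_sq (b / 2)
        rw [mul_div_cancel₀ _ (by norm_num : (2:ℝ) ≠ 0)] at q3
        nlinarith
      have d2 : 1 - μ * (b ^ 2 / 2) ≤ Real.exp (-(μ * (b ^ 2 / 2))) := by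
        have := Real.add_one_le_exp (-(μ * (b ^ 2 / 2))); linarith
      have d3 : μ * (b ^ 2 / 2) < 1 - μ := by rw [hb2]; linarith
      have d4 : 0 ≤ b ^ 2 / 2 := by positivity
      have d5 : 1 ≤ (1 + b ^ 2 / 2) * (1 - μ * (b ^ 2 / 2)) := by nlinarith
      have d6 : 1 ≤ (1 + b ^ 2 / 2) * Real.exp (-(μ * (b ^ 2 / 2))) :=
        d5.trans (mul_le_mul_of_nonneg_left d2 (by positivity))
      rw [Real.exp_neg, ← div_eq_mul_inv, one_le_div (Real.exp_pos _)] at d6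
      linarith
    calc Real.cosh (w * h) ≤ Real.exp ((w * h) ^ 2 / 2) := Real.cosh_le_exp_half_sq _
      _ = Real.exp (μ * (b ^ 2 / 2)) ^ ((n - 1) / n) := by
        rw [← Real.exp_mul, hb2, mul_pow, hw, Real.sq_sqrt hkn.le, hμ]
        congr 1
        field_simp
      _ ≤ Real.cosh b ^ ((n - 1) / n) := Real.rpow_le_rpow (Real.exp_pos _).le c1 hp.le
  · refine ⟨1, one_pos, fun h h0 h1 => ?_⟩
    subst hk
    have hk' : ¬ 0 < K' / (n - 1) := by
      rw [not_lt]; exact div_nonpos_of_nonpos_of_nonneg hK.le hn1.le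
    have hcs : cs (K' / (n - 1)) h = Real.cosh (Real.sqrt (-(K' / (n - 1))) * h) := by
      unfold cs; rw [if_neg hk']
    rw [hcs]
    refine ⟨Real.cosh_pos _, ?_⟩
    unfold sigmaCoeff
    have : 0 < n * Real.pi ^ 2 := by positivity
    rw [if_neg (by nlinarith), if_neg (by simp), if_pos (by simp)]
    refine ENNReal.ofReal_le_ofReal ?_
    have := Real.rpow_le_one_of_one_le_of_nonpos (Real.one_le_cosh
      (Real.sqrt (-(K' / (n - 1))) * h)) (by linarith : -((n - 1) / n) ≤ 0)
    linarith
  · refine fin ?_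
    have hK'p := hKp hk
    set μ := (K + K') / (2 * K') with hμ
    have hμ1 : 1 < μ := by rw [hμ, one_lt_div (by positivity)]; linarith
    have hkn : 0 < K / n := by positivity
    have hk' : 0 < K' / (n - 1) := by positivity
    filter_upwards [ev (μ * (K' / (n - 1) / 2)) (μ - 1) (by linarith),
      ev (K * 4) (n * Real.pi ^ 2) (by positivity), ev (K / n) 1 one_pos,
      ev (K * 5 / 48 * (K / n)) ((K - K') / 2) (by linarith),
      ev (K' / (n - 1) / 2) 1 one_pos] with h h1 h2 h3 h4 h5 hpos
    have hcs : cs (K' / (n - 1)) h = Real.cos (Real.sqrt (K' / (n - 1)) * h) := by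
      unfold cs; rw [if_pos hk']
    set b := Real.sqrt (K' / (n - 1)) * h with hb
    have hb2 : b ^ 2 = (K' / (n - 1)) * h ^ 2 := by rw [hb, mul_pow, Real.sq_sqrt hk'.le]
    have d1 : 1 - b ^ 2 / 2 ≤ Real.cos b := Real.one_sub_sq_div_two_le_cos
    have hcp : 0 < Real.cos b := by
      refine lt_of_lt_of_le ?_ d1
      rw [hb2]; linarith
    refine ⟨by rw [hcs]; exact hcp, ?_⟩
    have kk : 0 < K * (2 * h) ^ 2 := by positivity
    unfold sigmaCoeff
    rw [if_neg (by rw [not_le]; nlinarith), if_pos kk, hcs]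
    refine ENNReal.ofReal_le_ofReal ?_
    set w := Real.sqrt (K / n) with hw
    have hwp : 0 < w := Real.sqrt_pos.2 hkn
    have ea : (1 / 2 : ℝ) * (2 * h) * w = w * h := by ring
    have eb : (2 * h) * w = 2 * (w * h) := by ring
    rw [ea, eb, Real.sin_two_mul]
    have hwh2 : (w * h) ^ 2 = K / n * h ^ 2 := by rw [mul_pow, hw, Real.sq_sqrt hkn.le]
    have hwh1 : w * h < 1 := by
      have : (w * h) ^ 2 < 1 ^ 2 := by rw [hwh2]; linarith
      exact lt_of_pow_lt_pow_left₀ 2 (by norm_num) this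
    have hwh0 : 0 < w * h := by positivity
    have hsp : 0 < Real.sin (w * h) := Real.sin_pos_of_pos_of_lt_pi hwh0
      (by linarith [Real.pi_gt_three])
    have hca : 0 < Real.cos (w * h) := Real.cos_pos_of_mem_Ioo
      ⟨by linarith [Real.pi_gt_three], by linarith [Real.pi_gt_three]⟩
    have ec : Real.sin (w * h) / (2 * Real.sin (w * h) * Real.cos (w * h)) =
        1 / 2 * (Real.cos (w * h))⁻¹ := by field_simp
    rw [ec, Real.rpow_neg hcp.le]
    gcongr
    have c1 : Real.exp (-(μ * (b ^ 2 / 2))) ≤ Real.cos b := by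
      refine le_trans ?_ d1
      have d2 : 1 + μ * (b ^ 2 / 2) ≤ Real.exp (μ * (b ^ 2 / 2)) := by
        have := Real.add_one_le_exp (μ * (b ^ 2 / 2)); linarith
      have d3 : μ * (b ^ 2 / 2) < μ - 1 := by rw [hb2]; linarith
      have d4 : 0 ≤ b ^ 2 / 2 := by positivity
      have d40 : 0 ≤ 1 - b ^ 2 / 2 := by rw [hb2]; linarith
      have d5 : 1 ≤ (1 - b ^ 2 / 2) * (1 + μ * (b ^ 2 / 2)) := by nlinarith
      have d6 : 1 ≤ (1 - b ^ 2 / 2) * Real.exp (μ * (b ^ 2 / 2)) :=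
        d5.trans (mul_le_mul_of_nonneg_left d2 d40)
      rw [Real.exp_neg, inv_le_iff_one_le_mul₀ (Real.exp_pos _)]
      exact d6
    have c2 : Real.cos (w * h) ≤ Real.exp (-((w * h) ^ 2 / 2) + 5 / 96 * (w * h) ^ 4) := by
      have := Real.cos_bound (x := w * h) (by rw [abs_of_pos hwh0]; exact hwh1.le)
      rw [abs_le, abs_of_pos hwh0] at this
      have h9 := Real.add_one_le_exp (-((w * h) ^ 2 / 2) + 5 / 96 * (w * h) ^ 4)
      linarith [this.2]
    calc Real.cos (w * h) ≤ _ := c2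
      _ ≤ Real.exp (-(μ * (b ^ 2 / 2))) ^ ((n - 1) / n) := by
        rw [← Real.exp_mul, hb2]
        refine Real.exp_le_exp.2 ?_
        have e4 : (w * h) ^ 4 = (K / n * h ^ 2) * (K / n * h ^ 2) := by rw [← hwh2]; ring
        have e5 : -(μ * (K' / (n - 1) * h ^ 2 / 2)) * ((n - 1) / n) = -((K + K') / 4 * h ^ 2 / n) := by
          exact e5_aux hK'p hn
        rw [e4, hwh2, e5]
        have e6 : 0 ≤ h ^ 2 / n := by positivity
        have e7 := mul_le_mul_of_nonneg_left h4.le e6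
        have e8 : K / n * h ^ 2 = K * (h ^ 2 / n) := by ring
        have e9 : (K + K') / 4 * h ^ 2 / n = (K + K') / 4 * (h ^ 2 / n) := by ring
        have e10 : K * 5 / 48 * (K / n) * h ^ 2 = K * 5 / 48 * (K * (h ^ 2 / n)) := by ring
        rw [e10] at e7
        rw [e8, e9]
        linarith
      _ ≤ Real.cos b ^ ((n - 1) / n) := Real.rpow_le_rpow (Real.exp_pos _).le c1 hp.le
end P14

section P15

lemma wronsk_step {g s : ℕ → ℝ} {C : ℝ} {D : ℕ} (g0 : 0 ≤ g 0) (s0 : s 0 = 0)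
    (sp : ∀ j, 0 < j → j ≤ D → 0 < s j) (hs : ∀ j, s j + s (j + 2) = 2 * C * s (j + 1))
    (hg : ∀ j, j + 2 ≤ D → g j + g (j + 2) ≤ 2 * C * g (j + 1)) :
    ∀ j, j + 1 ≤ D → g (j + 1) * s j ≤ g j * s (j + 1) := by
  intro j
  induction j with
  | zero =>
    intro h
    rw [s0, mul_zero]
    exact mul_nonneg g0 (sp 1 one_pos h).le
  | succ j ih =>
    intro h
    have h1 := ih (by omega)
    have h2 := sp (j + 1) (by omega) (by omega)
    have h3 := hg j (by omega)
    have h4 := hs j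
    have h5 : s (j + 2) = 2 * C * s (j + 1) - s j := by linarith
    change g (j + 2) * s (j + 1) ≤ g (j + 1) * s (j + 2)
    rw [h5]
    nlinarith

lemma wronsk_mono {g s : ℕ → ℝ} {C : ℝ} {D : ℕ} (g0 : 0 ≤ g 0) (s0 : s 0 = 0)
    (sp : ∀ j, 0 < j → j ≤ D → 0 < s j) (hs : ∀ j, s j + s (j + 2) = 2 * C * s (j + 1))
    (hg : ∀ j, j + 2 ≤ D → g j + g (j + 2) ≤ 2 * C * g (j + 1)) {i : ℕ} (hi : 0 < i) :
    ∀ d, i + d ≤ D → g (i + d) * s i ≤ g i * s (i + d) := by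
  intro d
  induction d with
  | zero => intro _; exact le_rfl
  | succ d ih =>
    intro h
    have h1 := ih (by omega)
    have h2 := wronsk_step g0 s0 sp hs hg (i + d) (by omega)
    have p1 := sp (i + d) (by omega) (by omega)
    have p2 := sp i hi (by omega)
    have p3 := sp (i + (d + 1)) (by omega) h
    change g (i + (d + 1)) * s (i + d) ≤ g (i + d) * s (i + (d + 1)) at h2
    refine le_of_mul_le_mul_right ?_ p1
    calc g (i + (d + 1)) * s i * s (i + d) = (g (i + (d + 1)) * s (i + d)) * s i := by ring
      _ ≤ (g (i + d) * s (i + (d + 1))) * s i := by gcongr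
      _ = (g (i + d) * s i) * s (i + (d + 1)) := by ring
      _ ≤ (g i * s (i + d)) * s (i + (d + 1)) := by gcongr
      _ = _ := by ring

/-- number of steps: `y - j h ∈ (0, h]` -/
lemma exists_steps {y h : ℝ} (hy : 0 < y) (hh : 0 < h) :
    ∃ j : ℕ, 0 < y - j * h ∧ y - j * h ≤ h := by
  have hp : 0 < y / h := by positivity
  have h1 : 0 < ⌈y / h⌉₊ := Nat.ceil_pos.2 hp
  refine ⟨⌈y / h⌉₊ - 1, ?_, ?_⟩
  · have h2 : ⌈y / h⌉₊ - 1 < ⌈y / h⌉₊ := by omega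
    have h3 := Nat.lt_ceil.1 h2
    rw [lt_div_iff₀ hh] at h3
    linarith
  · have h2 := Nat.le_ceil (y / h)
    rw [div_le_iff₀ hh] at h2
    rw [Nat.cast_sub (by omega)]
    push_cast
    linarith

lemma one_dim {s g C : ℝ → ℝ} {θ δ : ℝ} (hθ : 0 < θ) (hδ : 0 < δ) (sc : Continuous s)
    (s0 : s 0 = 0) (hs : ∀ x h, s (x - h) + s (x + h) = 2 * C h * s x)
    (sp : ∀ x, 0 < x → x ≤ θ → 0 < s x) (gp : ∀ x, 0 ≤ g x)
    (hg : ∀ᵐ h : ℝ, 0 < h → h < δ → ∀ᵐ c : ℝ, 0 < c - h → c + h < θ →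
      g (c - h) + g (c + h) ≤ 2 * C h * g c)
    (an : ∀ ε > 0, ∃ η > 0, ∀ᵐ v : ℝ, θ - η < v → v < θ → 1 - ε ≤ g v) :
    ∀ᵐ u : ℝ, 0 < u → u < θ → s u / s θ ≤ g u := by
  have exh : ∀ k : ℕ, ∃ h : ℝ, 0 < h ∧ h < 1 / ((k:ℝ) + 1) ∧ h < δ ∧
      ∀ᵐ c : ℝ, 0 < c - h → c + h < θ → g (c - h) + g (c + h) ≤ 2 * C h * g c := by
    intro k
    have hpos : 0 < min (1 / ((k:ℝ) + 1)) δ := lt_min (by positivity) hδ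
    have hne : (volume.restrict (Ioo (0:ℝ) (min (1 / ((k:ℝ) + 1)) δ))) ≠ 0 := by
      intro h
      rw [Measure.restrict_eq_zero, Real.volume_Ioo, ENNReal.ofReal_eq_zero] at h
      linarith
    have : NeBot (ae (volume.restrict (Ioo (0:ℝ) (min (1 / ((k:ℝ) + 1)) δ)))) := ae_neBot.2 hne
    obtain ⟨h, h1, h2⟩ := ((ae_restrict_of_ae hg).and (ae_restrict_mem (μ := volume)
      (measurableSet_Ioo (a := (0:ℝ)) (b := min (1 / ((k:ℝ) + 1)) δ)))).exists
    have a1 := h2.2.trans_le (min_le_left _ _)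
    have a2 := h2.2.trans_le (min_le_right _ _)
    exact ⟨h, h2.1, a1, a2, h1 h2.1 a2⟩
  choose h hp hk hd hae using exh
  choose η ηp han using fun l : ℕ => an (1 / ((l:ℝ) + 1)) (by positivity)
  have A1 : ∀ᵐ u : ℝ, ∀ k : ℕ, ∀ j : ℤ, 0 < u + j * h k - h k → u + j * h k + h k < θ →
      g (u + j * h k - h k) + g (u + j * h k + h k) ≤ 2 * C (h k) * g (u + j * h k) :=
    ae_all_iff.2 fun k => ae_all_iff.2 fun j => ae_shift (hae k) (j * h k)
  have A2 : ∀ᵐ u : ℝ, ∀ k : ℕ, ∀ j : ℤ, ∀ l : ℕ, θ - η l < u + j * h k → u + j * h k < θ →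
      1 - 1 / ((l:ℝ) + 1) ≤ g (u + j * h k) :=
    ae_all_iff.2 fun k => ae_all_iff.2 fun j => ae_all_iff.2 fun l => ae_shift (han l) (j * h k)
  filter_upwards [A1, A2] with u hu1 hu2 u0 uθ
  have hlim : Tendsto h atTop (𝓝 0) :=
    squeeze_zero (fun k => (hp k).le) (fun k => (hk k).le) tendsto_one_div_add_atTop_nhds_zero_nat
  choose i ip iq using fun k => exists_steps u0 (hp k)
  choose d dp dq using fun k => exists_steps (sub_pos.2 uθ) (hp k)
  have lim1 : Tendsto (fun k => (i k : ℝ) * h k) atTop (𝓝 u) := by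
    have : Tendsto (fun k => u - h k) atTop (𝓝 u) := by simpa using hlim.const_sub u
    refine tendsto_of_tendsto_of_tendsto_of_le_of_le this tendsto_const_nhds ?_ ?_
    · intro k; have := iq k; simp only; linarith
    · intro k; have := ip k; simp only; linarith
  have lim2 : Tendsto (fun k => ((i k + d k : ℕ) : ℝ) * h k) atTop (𝓝 θ) := by
    have : Tendsto (fun k => θ - 2 * h k) atTop (𝓝 θ) := by
      simpa using (hlim.const_mul 2).const_sub θ
    refine tendsto_of_tendsto_of_tendsto_of_le_of_le this tendsto_const_nhds ?_ ?_
    · intro k; have := iq k; have := dq k; simp only; push_cast; linarith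
    · intro k; have := ip k; have := dp k; simp only; push_cast; linarith
  have sθ := sp θ hθ le_rfl
  have main : ∀ l : ℕ, (1 - 1 / ((l:ℝ) + 1)) * s u ≤ g u * s θ := by
    intro l
    have L1 := ((sc.tendsto u).comp lim1).const_mul (1 - 1 / ((l:ℝ) + 1))
    have L2 := ((sc.tendsto θ).comp lim2).const_mul (g u)
    refine le_of_tendsto_of_tendsto L1 L2 ?_
    have ev1 : ∀ᶠ k in atTop, h k < η l := hlim.eventually_lt_const (ηp l)
    have ev2 : ∀ᶠ k in atTop, 0 < (i k : ℝ) * h k := lim1.eventually_const_lt u0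
    filter_upwards [ev1, ev2] with k e1 e2
    simp only [Function.comp]
    have i0 : 0 < i k := by
      rcases Nat.eq_zero_or_pos (i k) with h0 | h0
      · rw [h0] at e2; simp at e2
      · exact h0
    have I1 := ip k
    have I2 := iq k
    have D1 := dp k
    have D2 := dq k
    have H0 := hp k
    have w := wronsk_mono (g := fun j : ℕ => g (u + ((j:ℤ) - (i k : ℤ) : ℤ) * h k))
      (s := fun j : ℕ => s (j * h k)) (C := C (h k)) (D := i k + d k) (gp _) (by simp [s0])
      ?_ ?_ ?_ i0 (d k) le_rfl
    · have z1 : u + (((i k + d k : ℕ) : ℤ) - (i k : ℤ) : ℤ) * h k = u + ((d k : ℕ) : ℤ) * h k := by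
        push_cast; ring
      have z2 : u + (((i k : ℕ) : ℤ) - (i k : ℤ) : ℤ) * h k = u := by simp
      simp only [z1, z2] at w
      have z3 := hu2 k (d k : ℤ) l (by push_cast; linarith) (by push_cast; linarith)
      have z4 : 0 < s ((i k : ℝ) * h k) := sp _ e2 (by linarith)
      exact (mul_le_mul_of_nonneg_right z3 z4.le).trans w
    · intro j j0 j1
      refine sp _ (by positivity) ?_
      have : (j:ℝ) ≤ i k + d k := by exact_mod_cast j1
      nlinarith
    · intro j
      have := hs (((j + 1 : ℕ) : ℝ) * h k) (h k)
      have y1 : ((j + 1 : ℕ) : ℝ) * h k - h k = j * h k := by push_cast; ring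
      have y2 : ((j + 1 : ℕ) : ℝ) * h k + h k = ((j + 2 : ℕ) : ℝ) * h k := by push_cast; ring
      rw [y1, y2] at this
      exact this
    · intro j hj
      have hj' : (j:ℝ) + 2 ≤ i k + d k := by exact_mod_cast hj
      have := hu1 k (((j + 1 : ℕ) : ℤ) - (i k : ℤ))
      have y1 : u + ((((j + 1 : ℕ) : ℤ) - (i k : ℤ) : ℤ) : ℝ) * h k - h k =
        u + (((j : ℤ) - (i k : ℤ) : ℤ) : ℝ) * h k := by push_cast; ring
      have y2 : u + ((((j + 1 : ℕ) : ℤ) - (i k : ℤ) : ℤ) : ℝ) * h k + h k =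
        u + ((((j + 2 : ℕ) : ℤ) - (i k : ℤ) : ℤ) : ℝ) * h k := by push_cast; ring
      rw [y1, y2] at this
      refine this ?_ ?_
      · push_cast
        have : 0 ≤ (j:ℝ) * h k := by positivity
        linarith
      · push_cast
        nlinarith
  rw [div_le_iff₀ sθ]
  have L : Tendsto (fun l : ℕ => (1 - 1 / ((l:ℝ) + 1)) * s u) atTop (𝓝 ((1 - 0) * s u)) :=
    (tendsto_one_div_add_atTop_nhds_zero_nat.const_sub 1).mul_const _
  rw [sub_zero, one_mul] at L
  exact le_of_tendsto' L main
end P15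

section P16
variable [ProperSpace X] [BorelSpace X]

lemma ae_scale {p : ℝ → Prop} (h : ∀ᵐ x : ℝ, p x) {k : ℝ} (hk : k ≠ 0) : ∀ᵐ x : ℝ, p (k * x) := by
  rw [ae_iff] at h ⊢
  have := Real.volume_preimage_mul_left hk {x | ¬ p x}
  rw [h, mul_zero] at this
  exact this

lemma anchor_fixed {K N : ℝ} {m : Measure X} [SigmaFinite m] (H : Hyp K N m) {x : X} {a b : ℝ}
    {A : Set X} {P : Measure (Geo X)} (hP : FP m x a b A P)
    {N' : ℝ} (hN' : N ≤ N') (hN1 : 1 < N') {k : ℕ} (hk : 2 ≤ k) :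
    ∀ᵐ γ ∂P, ∀ᵐ v : ℝ, len γ - a / k < v → v < len γ →
      ENNReal.ofReal ((1 - 1 / (k:ℝ)) * Real.exp (-(1 / (k:ℝ)) * (a * Real.sqrt (|K| / N')))) ≤
        Qh m P γ v ^ (-(1 / N')) := by
  have := hP.fin
  have hlm : Measurable (len : Geo X → ℝ) := len_measurable
  have k0 : (0:ℝ) < k := by exact_mod_cast (by omega : 0 < k)
  have k2 : (2:ℝ) ≤ k := by exact_mod_cast hk
  have ik : 1 / (k:ℝ) ≤ 1 / 2 := one_div_le_one_div_of_le (by norm_num) k2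
  have ik0 : 0 < 1 / (k:ℝ) := by positivity
  have ha := hP.ha
  have N0 : 0 < N' := by linarith
  set c0 := ENNReal.ofReal ((1 - 1 / (k:ℝ)) *
    Real.exp (-(1 / (k:ℝ)) * (a * Real.sqrt (|K| / N')))) with hc0
  have g1 : ∀ᵐ β : ℝ, GoodLaw m x P 1 β := law_eq hP one_pos
  have g2 := ae_scale g1 k0.ne'
  have s1 : ∀ᵐ β : ℝ, ∀ᵐ γ ∂P, len γ - a / k < β + len γ → β + len γ < len γ →
      c0 ≤ Qh m P γ (β + len γ) ^ (-(1 / N')) := by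
    filter_upwards [g1, g2] with β gl gk
    by_cases hβ : -(a / k) < β ∧ β < 0
    swap
    · refine Eventually.of_forall fun γ p1 p2 => absurd ⟨?_, ?_⟩ hβ <;> linarith
    obtain ⟨b1, b2⟩ := hβ
    have b3 : -a < k * β := by
      rw [← neg_div, div_lt_iff₀ k0] at b1; linarith
    have b4 : k * β < 0 := mul_neg_of_pos_of_neg k0 b2
    have b5 : k * β ≤ 1 * β := mul_le_mul_of_nonpos_right (by linarith) b2.le
    have hT : MeasurableSet (Ici a) := measurableSet_Ici
    have dl : ∀ θ ∈ Ici a, 0 < 1 * θ + β ∧ 1 * θ + β < θ := by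
      intro θ hθ
      have : a ≤ θ := hθ
      constructor <;> linarith
    have dk : ∀ θ ∈ Ici a, 0 < 1 * θ + k * β ∧ 1 * θ + k * β < θ := by
      intro θ hθ
      have : a ≤ θ := hθ
      constructor <;> linarith
    have d0 : ∀ θ ∈ Ici a, 0 < 1 * θ + 0 ∧ 1 * θ + 0 ≤ θ := by
      intro θ hθ
      have : a ≤ θ := hθ
      constructor <;> linarith
    obtain ⟨-, el⟩ := law_dens hP one_pos gl hT dl
    obtain ⟨ck, ek⟩ := law_dens hP one_pos gk hT dk
    have hle : (P.restrict (len ⁻¹' Ici a)).map (fun γ => Z γ (1 * len γ + 0)) ≤ m.restrict A := by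
      have e : (fun γ => Z γ (1 * len γ + 0)) =ᵐ[P.restrict (len ⁻¹' Ici a)] (eval 1 : Geo X → X) := by
        filter_upwards [ae_restrict_of_ae hP.len] with γ hγ
        have hl : 0 < len γ := ha.trans_le hγ.1
        unfold Z
        congr 1
        refine Subtype.ext ?_
        rw [one_mul, add_zero, div_self hl.ne', coe_cl zero_le_one le_rfl]
        rfl
      rw [Measure.map_congr e, ← hP.map1]
      exact Measure.map_mono Measure.restrict_le_self (eval_measurable 1)
    have hle' := hle.trans Measure.restrict_le_self
    have c0' := hle'.absolutelyContinuous
    have fA : IsFiniteMeasure (m.restrict A) := by rw [← hP.map1]; infer_instance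
    have r0 : ∀ᵐ z ∂m, ((P.restrict (len ⁻¹' Ici a)).map
        (fun γ => Z γ (1 * len γ + 0))).rnDeriv m z ≤ 1 := by
      filter_upwards [rnDeriv_mono_left (m := m) hle, Measure.rnDeriv_restrict_self m hP.hA]
        with z z1 z2
      refine z1.trans ?_
      rw [z2]
      exact indicator_le (fun _ _ => le_rfl) z |>.trans le_rfl
    have r1 := ae_of_ae_map (Zaff_meas 1 0).aemeasurable (c0'.ae_le r0)
    have key := radial_key H hP one_pos one_pos hT d0
      (fun θ h => ⟨(dk θ h).1, (dk θ h).2.le⟩) c0' ck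
      (l := ⟨1 / (k:ℝ), ik0.le, by linarith⟩) ⟨ik0, by change 1 / (k:ℝ) < 1; linarith⟩
      (α := 1) (β := β) (by ring) (by
        change β = (1 - 1 / (k:ℝ)) * 0 + 1 / (k:ℝ) * (k * β)
        field_simp; ring) hN' hN1
    have key2 := (ae_restrict_iff' (hlm hT)).1 (key.and (r1.and el))
    filter_upwards [key2, hP.len] with γ hγ hlen p1 p2
    obtain ⟨q, z1, z2⟩ := hγ hlen.1
    have q2 := le_self_add.trans q
    rw [z2] at q2
    have e1 : 1 * len γ + β = β + len γ := by ring
    rw [e1, inv_one, ENNReal.ofReal_one, one_mul (Qh m P γ _)] at q2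
    refine le_trans ?_ q2
    have e2 : |1 * len γ + 0 - (1 * len γ + k * β)| = -(k * β) := by
      rw [abs_of_pos] <;> linarith
    rw [e2]
    have s1 : c0 ≤ sigmaCoeff K N' (1 - 1 / (k:ℝ)) (-(k * β)) := by
      refine le_trans ?_ (sigma_lb N0 (by linarith) (by linarith) (by linarith))
      refine ENNReal.ofReal_le_ofReal ?_
      refine mul_le_mul_of_nonneg_left (Real.exp_le_exp.2 ?_) (by linarith)
      have hs := Real.sqrt_nonneg (|K| / N')
      have : -(k * β) * Real.sqrt (|K| / N') ≤ a * Real.sqrt (|K| / N') :=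
        mul_le_mul_of_nonneg_right (by linarith) hs
      have e3 : -(1 - (1 - 1 / (k:ℝ))) = -(1 / k) := by ring
      rw [e3]
      nlinarith
    have s2 := rpow_neg_anti (z := -(1 / N')) (by
      have : 0 < 1 / N' := by positivity
      linarith) z1
    rw [ENNReal.one_rpow] at s2
    calc c0 = c0 * 1 := (mul_one _).symm
      _ ≤ _ := mul_le_mul' s1 s2
  rw [Measure.ae_ae_comm] at s1
  · filter_upwards [s1] with γ hγ
    have := ae_shift hγ (-len γ)
    filter_upwards [this] with v hv
    rwa [neg_add_cancel_right] at hv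
  · have hl2 : Measurable fun z : ℝ × Geo X => len z.2 := hlm.comp measurable_snd
    have hs : Measurable fun z : ℝ × Geo X => z.1 + len z.2 := measurable_fst.add hl2
    exact (measurableSet_lt (hl2.sub measurable_const) hs).imp ((measurableSet_lt hs hl2).imp
      (measurableSet_le measurable_const ((Qh_meas' m P measurable_snd hs).pow_const _)))

lemma dens_bound {K N : ℝ} {m : Measure X} [SigmaFinite m] (H : Hyp K N m) {x : X} {a b : ℝ}
    {A : Set X} {P : Measure (Geo X)} (hP : FP m x a b A P)
    {N' : ℝ} (hN' : N ≤ N') (hN1 : 1 < N') {K' : ℝ} (hK : K' < K) (hK0 : K' ≠ 0)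
    (hKp : 0 < K → 0 < K') (hb : 0 < K' → Real.sqrt (K' / (N' - 1)) * b < Real.pi) :
    ∀ᵐ γ ∂P, ∀ᵐ u : ℝ, 0 < u → u < len γ →
      ENNReal.ofReal ((sn (K' / (N' - 1)) u / sn (K' / (N' - 1)) (len γ)) ^ (N' - 1)) *
        Qh m P γ u ≤ 1 := by
  have := hP.fin
  have ha := hP.ha
  have n1 : 0 < N' - 1 := by linarith
  have n0 : 0 < N' := by linarith
  obtain ⟨δ, hδ, hsig⟩ := sig_local hN1 hK hK0 hKp
  set κ := K' / (N' - 1) with hκ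
  have κ0 : κ ≠ 0 := div_ne_zero hK0 n1.ne'
  have κp : 0 < κ → 0 < K' := fun h => by
    rw [hκ, lt_div_iff₀ n1, zero_mul] at h; exact h
  have M : ∀ᵐ γ ∂P, ∀ q0 q1 : ℚ, ∀ᵐ h : ℝ, ∀ᵐ c : ℝ,
      MidIneq K N' m P (Real.exp q0) (Real.exp q1) γ c h :=
    ae_all_iff.2 fun q0 => ae_all_iff.2 fun q1 =>
      mid_ae H hP (Real.exp_pos _) (Real.exp_pos _) hN' hN1
  have An : ∀ᵐ γ ∂P, ∀ k : ℕ, ∀ᵐ v : ℝ, len γ - a / ((k + 2 : ℕ) : ℝ) < v → v < len γ →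
      ENNReal.ofReal ((1 - 1 / ((k + 2 : ℕ) : ℝ)) *
        Real.exp (-(1 / ((k + 2 : ℕ) : ℝ)) * (a * Real.sqrt (|K| / N')))) ≤
        Qh m P γ v ^ (-(1 / N')) :=
    ae_all_iff.2 fun k => anchor_fixed H hP hN' hN1 (by omega)
  filter_upwards [M, An, Qh_pos_fin hP, hP.len] with γ hM hAn hpf hlen
  have hθ : 0 < len γ := ha.trans_le hlen.1
  have spos : ∀ y, 0 < y → y ≤ len γ → 0 < sn κ y := by
    intro y y0 y1
    refine sn_pos κ0 y0 fun hk => lt_of_le_of_lt ?_ (hb (κp hk))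
    exact mul_le_mul_of_nonneg_left (y1.trans hlen.2) (Real.sqrt_nonneg _)
  have main : ∀ᵐ u : ℝ, 0 < u → u < len γ → sn κ u / sn κ (len γ) ≤
      (Qh m P γ u).toReal ^ (-(1 / (N' - 1))) := by
    refine one_dim (g := fun u => (Qh m P γ u).toReal ^ (-(1 / (N' - 1)))) (C := cs κ) hθ hδ
      (sn_cont κ) (sn_zero κ) (sn_add κ) spos (fun y => by positivity) ?_ ?_
    · have hM' : ∀ᵐ h : ℝ, ∀ q0 q1 : ℚ, ∀ᵐ c : ℝ,
          MidIneq K N' m P (Real.exp q0) (Real.exp q1) γ c h :=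
        ae_all_iff.2 fun q0 => ae_all_iff.2 fun q1 => hM q0 q1
      filter_upwards [hM'] with h hh h0 h1
      have hh' : ∀ᵐ c : ℝ, ∀ q0 q1 : ℚ, MidIneq K N' m P (Real.exp q0) (Real.exp q1) γ c h :=
        ae_all_iff.2 fun q0 => ae_all_iff.2 fun q1 => hh q0 q1
      filter_upwards [hh', hpf, ae_shift hpf h, ae_shift hpf (-h)] with c c1 c2 c3 c4 p1 p2
      obtain ⟨cp, cq⟩ := hsig h h0 h1
      refine mid_real hN1 cp (c4 p1 (by linarith)) (c3 (by linarith) p2)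
        (c2 (by linarith) (by linarith)) cq fun q0 q1 => c1 q0 q1 h0 p1 p2
    · intro ε hε
      have L : Tendsto (fun k : ℕ => ((1 - 1 / ((k + 2 : ℕ) : ℝ)) *
          Real.exp (-(1 / ((k + 2 : ℕ) : ℝ)) * (a * Real.sqrt (|K| / N')))) ^ (N' / (N' - 1)))
          atTop (𝓝 1) := by
        have l1 : Tendsto (fun k : ℕ => 1 / ((k + 2 : ℕ) : ℝ)) atTop (𝓝 0) :=
          (tendsto_one_div_atTop_nhds_zero_nat (𝕜 := ℝ)).comp (tendsto_add_atTop_nat 2)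
        have l2 : ContinuousAt (fun y : ℝ => ((1 - y) *
          Real.exp (-y * (a * Real.sqrt (|K| / N')))) ^ (N' / (N' - 1))) 0 := by
          refine ContinuousAt.rpow_const (by fun_prop) (Or.inl ?_)
          simp
        have l3 := l2.tendsto.comp l1
        simpa [Function.comp_def] using l3
      obtain ⟨k, hk⟩ := (L.eventually_const_lt (by linarith : 1 - ε < 1)).exists
      refine ⟨a / ((k + 2 : ℕ) : ℝ), by positivity, ?_⟩
      filter_upwards [hAn k, hpf] with v v1 v2 p1 p2
      have kk : (1:ℝ) ≤ ((k + 2 : ℕ) : ℝ) := by push_cast; linarith [(Nat.cast_nonneg k : (0:ℝ) ≤ k)]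
      have ika : a / ((k + 2 : ℕ) : ℝ) ≤ a := div_le_self ha.le kk
      have ik1 : 1 / ((k + 2 : ℕ) : ℝ) ≤ 1 := by rw [div_le_one] <;> linarith
      obtain ⟨q1, q2⟩ := v2 (by linarith [hlen.1]) p2
      have v3 := v1 p1 p2
      have qp := ENNReal.toReal_pos q1.ne' q2.ne
      rw [← ENNReal.ofReal_toReal q2.ne, ENNReal.ofReal_rpow_of_pos qp,
        ENNReal.ofReal_le_ofReal_iff (by positivity)] at v3
      have v4 := Real.rpow_le_rpow (mul_nonneg (by linarith) (Real.exp_pos _).le) v3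
        (by positivity : 0 ≤ N' / (N' - 1))
      rw [← Real.rpow_mul qp.le] at v4
      have e : -(1 / N') * (N' / (N' - 1)) = -(1 / (N' - 1)) := by field_simp
      rw [e] at v4
      exact hk.le.trans v4
  filter_upwards [main, hpf] with u hu hu2 p1 p2
  obtain ⟨q1, q2⟩ := hu2 p1 p2
  have qp := ENNReal.toReal_pos q1.ne' q2.ne
  have h3 := hu p1 p2
  have rp : 0 < sn κ u / sn κ (len γ) := div_pos (spos u p1 p2.le) (spos _ hθ le_rfl)
  have h4 := Real.rpow_le_rpow rp.le h3 n1.le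
  rw [← Real.rpow_mul qp.le] at h4
  have e : -(1 / (N' - 1)) * (N' - 1) = -1 := by field_simp
  rw [e, Real.rpow_neg_one] at h4
  rw [← ENNReal.ofReal_toReal q2.ne, ← ENNReal.ofReal_mul (by positivity), ENNReal.ofReal_le_one]
  calc _ ≤ (Qh m P γ u).toReal⁻¹ * (Qh m P γ u).toReal := mul_le_mul_of_nonneg_right h4 qp.le
    _ = 1 := inv_mul_cancel₀ qp.ne'
end P16

section P17
variable [ProperSpace X] [BorelSpace X]

lemma wt_beta {K N : ℝ} {m : Measure X} [SigmaFinite m] (H : Hyp K N m) {x : X} {a b : ℝ}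
    {A : Set X} {P : Measure (Geo X)} (hP : FP m x a b A P)
    {N' : ℝ} (hN' : N ≤ N') (hN1 : 1 < N') {K' : ℝ} (hK : K' < K) (hK0 : K' ≠ 0)
    (hKp : 0 < K → 0 < K') (hb : 0 < K' → Real.sqrt (K' / (N' - 1)) * b < Real.pi)
    {t : ℝ} (ht : 0 < t) :
    ∀ᵐ β : ℝ, ((P.restrict {γ | 0 < t * len γ + β ∧ t * len γ + β < len γ}).withDensity
        (fun γ => ENNReal.ofReal (t * (sn (K' / (N' - 1)) (t * len γ + β) /
          sn (K' / (N' - 1)) (len γ)) ^ (N' - 1)))).map (fun γ => Z γ (t * len γ + β)) ≤ m := by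
  have := hP.fin
  have hlm : Measurable (len : Geo X → ℝ) := len_measurable
  set κ := K' / (N' - 1) with hκ
  have snm : Measurable (sn κ) := (sn_cont κ).measurable
  have B0 := dens_bound H hP hN' hN1 hK hK0 hKp hb
  have B1 : ∀ᵐ γ ∂P, ∀ᵐ β : ℝ, 0 < t * len γ + β → t * len γ + β < len γ →
      ENNReal.ofReal ((sn κ (t * len γ + β) / sn κ (len γ)) ^ (N' - 1)) *
        Qh m P γ (t * len γ + β) ≤ 1 := by
    filter_upwards [B0] with γ hγ
    have := ae_shift hγ (t * len γ)
    filter_upwards [this] with β hβ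
    rwa [add_comm] at hβ
  rw [Measure.ae_ae_comm] at B1
  swap
  · have hl2 : Measurable fun z : Geo X × ℝ => len z.1 := hlm.comp measurable_fst
    have hs : Measurable fun z : Geo X × ℝ => t * len z.1 + z.2 :=
      (measurable_const.mul hl2).add measurable_snd
    refine (measurableSet_lt measurable_const hs).imp ((measurableSet_lt hs hl2).imp
      (measurableSet_le (Measurable.mul ?_ (Qh_meas' m P measurable_fst hs)) measurable_const))
    exact (((snm.comp hs).div (snm.comp hl2)).pow_const _).ennreal_ofReal
  have g : ∀ᵐ β : ℝ, GoodLaw m x P t β := law_eq hP ht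
  filter_upwards [B1, g] with β hB hg
  set D : Set (Geo X) := {γ | 0 < t * len γ + β ∧ t * len γ + β < len γ} with hD
  have hDm : MeasurableSet D := (measurableSet_lt measurable_const
    ((measurable_const.mul hlm).add measurable_const)).inter
    (measurableSet_lt ((measurable_const.mul hlm).add measurable_const) hlm)
  let W : X → ℝ≥0∞ := fun z => ENNReal.ofReal (t * (sn κ (dist x z) /
    sn κ ((dist x z - β) / t)) ^ (N' - 1))
  have hrm : Measurable fun z : X => dist x z := by fun_prop
  have hWm : Measurable W := by
    refine ((((snm.comp hrm).div (snm.comp ((hrm.sub measurable_const).div measurable_const))).pow_const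
      _).const_mul t).ennreal_ofReal
  have hd : ∀ᵐ γ ∂(P.restrict D), dist x (Z γ (t * len γ + β)) = t * len γ + β := by
    filter_upwards [ae_restrict_of_ae hP.start, ae_restrict_of_ae hP.len, ae_restrict_mem hDm]
      with γ h1 h2 h3
    exact dist_Z h1 h3.1.le (hP.ha.trans_le h2.1) h3.2.le
  have hdiv : ∀ y : ℝ, (t * y + β - β) / t = y := by intro y; field_simp; ring
  have hw : (fun γ => ENNReal.ofReal (t * (sn κ (t * len γ + β) / sn κ (len γ)) ^ (N' - 1)))
      =ᵐ[P.restrict D] fun γ => W (Z γ (t * len γ + β)) := by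
    filter_upwards [hd] with γ h1
    simp only [W, h1, hdiv]
  rw [withDensity_congr_ae hw, map_withDensity_comp (Zaff_meas t β) hWm]
  set q : X → ℝ≥0∞ := fun z => ENNReal.ofReal t⁻¹ * Qd m P (z, (dist x z - β) / t) with hq
  have hqm : Measurable q := measurable_const.mul ((Qd_meas m P).comp (by fun_prop))
  have hg' : (P.restrict D).map (fun γ => Z γ (t * len γ + β)) = m.withDensity q := hg
  have hle : ∀ᵐ z ∂m, q z ≠ 0 → q z * W z ≤ 1 := by
    rw [← ae_withDensity_iff (p := fun z => q z * W z ≤ 1) hqm, ← hg',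
      ae_map_iff (p := fun z => q z * W z ≤ 1) (Zaff_meas t β).aemeasurable
      (measurableSet_le (hqm.mul hWm) measurable_const)]
    filter_upwards [hd, ae_restrict_of_ae hB, ae_restrict_mem hDm] with γ h1 h2 h3
    have h4 := h2 h3.1 h3.2
    simp only [hq, W, h1, hdiv]
    rw [ENNReal.ofReal_mul ht.le]
    have e : ENNReal.ofReal t⁻¹ * ENNReal.ofReal t = 1 := by
      rw [← ENNReal.ofReal_mul (by positivity), inv_mul_cancel₀ ht.ne', ENNReal.ofReal_one]
    calc _ = (ENNReal.ofReal t⁻¹ * ENNReal.ofReal t) * (ENNReal.ofReal ((sn κ (t * len γ + β) /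
          sn κ (len γ)) ^ (N' - 1)) * Qd m P (Z γ (t * len γ + β), len γ)) := by ring
      _ ≤ 1 := by rw [e, one_mul]; exact h4
  rw [hg', ← withDensity_mul _ hqm hWm]
  calc m.withDensity (q * W) ≤ m.withDensity 1 := withDensity_mono (by
        filter_upwards [hle] with z hz
        by_cases h0 : q z = 0
        · simp [h0]
        · exact hz h0)
    _ = m := withDensity_one

lemma exists_seq_ae {p : ℝ → Prop} (h : ∀ᵐ β : ℝ, p β) :
    ∃ β : ℕ → ℝ, (∀ k, 0 < β k) ∧ (∀ k, p (β k)) ∧ Tendsto β atTop (𝓝 0) := by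
  have exh : ∀ k : ℕ, ∃ b : ℝ, 0 < b ∧ b < 1 / ((k:ℝ) + 1) ∧ p b := by
    intro k
    have hpos : 0 < 1 / ((k:ℝ) + 1) := by positivity
    have hne : (volume.restrict (Ioo (0:ℝ) (1 / ((k:ℝ) + 1)))) ≠ 0 := by
      intro h
      rw [Measure.restrict_eq_zero, Real.volume_Ioo, ENNReal.ofReal_eq_zero] at h
      linarith
    have : NeBot (ae (volume.restrict (Ioo (0:ℝ) (1 / ((k:ℝ) + 1))))) := ae_neBot.2 hne
    obtain ⟨b, h1, h2⟩ := ((ae_restrict_of_ae h).and (ae_restrict_mem (μ := volume)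
      (measurableSet_Ioo (a := (0:ℝ)) (b := 1 / ((k:ℝ) + 1))))).exists
    exact ⟨b, h2.1, h2.2, h1⟩
  choose β b1 b2 b3 using exh
  exact ⟨β, b1, b3, squeeze_zero (fun k => (b1 k).le) (fun k => (b2 k).le)
    tendsto_one_div_add_atTop_nhds_zero_nat⟩

/-- the Fatou passage -/
lemma fatou_le {m : Measure X} [m.OuterRegular] {P : Measure (Geo X)} {F : ℕ → Geo X → X}
    {G : Geo X → X} {w : ℕ → Geo X → ℝ≥0∞} {w0 : Geo X → ℝ≥0∞} (hF : ∀ k, Measurable (F k))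
    (hG : Measurable G) (hw : ∀ k, Measurable (w k))
    (hle : ∀ k, (P.withDensity (w k)).map (F k) ≤ m)
    (hFG : ∀ᵐ γ ∂P, Tendsto (fun k => F k γ) atTop (𝓝 (G γ)))
    (hww : ∀ᵐ γ ∂P, w0 γ ≤ liminf (fun k => w k γ) atTop) :
    (P.withDensity w0).map G ≤ m := by
  refine le_of_open fun U hU => ?_
  rw [Measure.map_apply hG hU.measurableSet, withDensity_apply _ (hG hU.measurableSet),
    ← lintegral_indicator (hG hU.measurableSet)]
  have hm : ∀ k, Measurable ((F k ⁻¹' U).indicator (w k)) := fun k =>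
    (hw k).indicator (hF k hU.measurableSet)
  calc ∫⁻ γ, (G ⁻¹' U).indicator w0 γ ∂P
      ≤ ∫⁻ γ, liminf (fun k => (F k ⁻¹' U).indicator (w k) γ) atTop ∂P := by
        refine lintegral_mono_ae ?_
        filter_upwards [hFG, hww] with γ h1 h2
        by_cases hγ : γ ∈ G ⁻¹' U
        · rw [indicator_of_mem hγ]
          refine h2.trans (le_of_eq ?_)
          refine liminf_congr ?_
          filter_upwards [h1.eventually (hU.mem_nhds hγ)] with k hk
          rw [indicator_of_mem]
          exact hk
        · rw [indicator_of_notMem hγ]; exact zero_le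
    _ ≤ liminf (fun k => ∫⁻ γ, (F k ⁻¹' U).indicator (w k) γ ∂P) atTop :=
        lintegral_liminf_le hm
    _ ≤ m U := by
        refine liminf_le_of_frequently_le' (Frequently.of_forall fun k => ?_)
        rw [lintegral_indicator (hF k hU.measurableSet), ← withDensity_apply _ (hF k hU.measurableSet),
          ← Measure.map_apply (hF k) hU.measurableSet]
        exact hle k U

lemma tau_approx {K N : ℝ} {m : Measure X} [SigmaFinite m] [m.OuterRegular] (H : Hyp K N m) {x : X}
    {a b : ℝ} {A : Set X} {P : Measure (Geo X)} (hP : FP m x a b A P)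
    {N' : ℝ} (hN' : N ≤ N') (hN1 : 1 < N') {K' : ℝ} (hK : K' < K) (hK0 : K' ≠ 0)
    (hKp : 0 < K → 0 < K') (hb : 0 < K' → Real.sqrt (K' / (N' - 1)) * b < Real.pi)
    {t : unitInterval} (ht : (0:ℝ) < t) (ht1 : (t:ℝ) < 1) :
    (P.withDensity (fun γ => ENNReal.ofReal (t * (sn (K' / (N' - 1)) (t * len γ) /
          sn (K' / (N' - 1)) (len γ)) ^ (N' - 1)))).map (eval t) ≤ m := by
  have hlm : Measurable (len : Geo X → ℝ) := len_measurable
  obtain ⟨β, b0, b1, b2⟩ := exists_seq_ae (wt_beta H hP hN' hN1 hK hK0 hKp hb ht)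
  set κ := K' / (N' - 1) with hκ
  have snm : Measurable (sn κ) := (sn_cont κ).measurable
  let D : ℕ → Set (Geo X) := fun k => {γ | 0 < t * len γ + β k ∧ t * len γ + β k < len γ}
  have hDm : ∀ k, MeasurableSet (D k) := fun k => (measurableSet_lt measurable_const
    ((measurable_const.mul hlm).add measurable_const)).inter
    (measurableSet_lt ((measurable_const.mul hlm).add measurable_const) hlm)
  let w : ℕ → Geo X → ℝ≥0∞ := fun k γ => ENNReal.ofReal (t * (sn κ (t * len γ + β k) /
          sn κ (len γ)) ^ (N' - 1))
  have hwm : ∀ k, Measurable (w k) := fun k => (((snm.comp ((measurable_const.mul hlm).add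
    measurable_const)).div (snm.comp hlm)).pow_const _ |>.const_mul _).ennreal_ofReal
  refine fatou_le (F := fun k γ => Z γ (t * len γ + β k)) (w := fun k => (D k).indicator (w k))
    (fun k => Zaff_meas t (β k)) (eval_measurable t) (fun k => (hwm k).indicator (hDm k)) ?_ ?_ ?_
  · intro k
    rw [withDensity_indicator (hDm k)]
    exact b1 k
  · filter_upwards [hP.len] with γ hγ
    have hl : 0 < len γ := hP.ha.trans_le hγ.1
    have e : eval t γ = Z γ (t * len γ + 0) := by
      unfold Z
      congr 1
      refine Subtype.ext ?_
      rw [add_zero, mul_div_cancel_right₀ _ hl.ne', coe_cl t.2.1 t.2.2]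
    rw [e]
    have hc : Continuous fun y : ℝ => Z γ (t * len γ + y) := by
      unfold Z
      exact γ.1.continuous.comp (cl_continuous.comp (by fun_prop))
    exact (hc.tendsto 0).comp b2
  · filter_upwards [hP.len] with γ hγ
    have hl : 0 < len γ := hP.ha.trans_le hγ.1
    have hc : Continuous fun y : ℝ => ENNReal.ofReal (t * (sn κ (t * len γ + y) /
          sn κ (len γ)) ^ (N' - 1)) := by
      refine ENNReal.continuous_ofReal.comp (continuous_const.mul (Continuous.rpow_const
        (((sn_cont κ).comp (by fun_prop)).div_const _) fun y => Or.inr (by linarith)))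
    have hlim : Tendsto (fun k => w k γ) atTop (𝓝 (ENNReal.ofReal (t * (sn κ (t * len γ + 0) /
          sn κ (len γ)) ^ (N' - 1)))) := (hc.tendsto 0).comp b2
    rw [add_zero] at hlim
    rw [← hlim.liminf_eq]
    refine le_of_eq (liminf_congr ?_)
    have : 0 < (1 - (t:ℝ)) * len γ := mul_pos (by linarith) hl
    filter_upwards [b2.eventually_lt_const this] with k hk
    have hk0 := b0 k
    rw [indicator_of_mem]
    refine ⟨by positivity, ?_⟩
    change (t:ℝ) * len γ + β k < len γ
    linarith
end P17

section P18

lemma tau_pow {K N t θ : ℝ} (hN : 1 < N) : tauCoeff K N t θ ^ N =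
    ENNReal.ofReal t * sigmaCoeff K (N - 1) t θ ^ (N - 1) := by
  unfold tauCoeff
  have h0 : N ≠ 0 := by linarith
  rw [if_neg (by linarith), ENNReal.mul_rpow_of_nonneg _ _ (by linarith), ← ENNReal.rpow_mul,
    ← ENNReal.rpow_mul, one_div_mul_cancel h0, div_mul_cancel₀ _ h0, ENNReal.rpow_one]

/-- admissible approximating parameters -/
def Adm (K N b K' N' : ℝ) : Prop :=
  N ≤ N' ∧ 1 < N' ∧ K' < K ∧ K' ≠ 0 ∧ (0 < K → 0 < K') ∧
    (0 < K' → Real.sqrt (K' / (N' - 1)) * b < Real.pi)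

lemma seq_tendsto : Tendsto (fun k : ℕ => 1 / ((k:ℝ) + 1)) atTop (𝓝 0) :=
  tendsto_one_div_add_atTop_nhds_zero_nat

lemma seq_pos (k : ℕ) : 0 < 1 / ((k:ℝ) + 1) := by positivity

lemma seq_le (k : ℕ) : 1 / ((k:ℝ) + 1) ≤ 1 := by
  rw [div_le_one] <;> linarith [(Nat.cast_nonneg k : (0:ℝ) ≤ k)]

lemma ofReal_mul_rpow {t r p : ℝ} (ht : 0 ≤ t) (hr : 0 ≤ r) (hp : 0 ≤ p) :
    ENNReal.ofReal (t * r ^ p) = ENNReal.ofReal t * ENNReal.ofReal r ^ p := by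
  rw [ENNReal.ofReal_mul ht, ENNReal.ofReal_rpow_of_nonneg hr hp]

lemma adm_pos {K N b t : ℝ} (hN : 1 < N) (hK : 0 < K) (hb : 0 < b)
    (hbR : b ≤ Real.pi * Real.sqrt ((N - 1) / K)) (ht0 : 0 < t) (ht1 : t < 1) :
    ∃ Ks Ns : ℕ → ℝ, (∀ k, Adm K N b (Ks k) (Ns k)) ∧ ∀ θ, 0 < θ → θ ≤ b →
      tauCoeff K N t θ ^ N ≤ liminf (fun k => ENNReal.ofReal (t * (sn (Ks k / (Ns k - 1)) (t * θ) /
          sn (Ks k / (Ns k - 1)) θ) ^ (Ns k - 1))) atTop := by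
  have n1 : 0 < N - 1 := by linarith
  let Ks : ℕ → ℝ := fun k => K * (1 - 1 / ((k:ℝ) + 1) / 2)
  have Kpos : ∀ k, 0 < Ks k := fun k => mul_pos hK (by linarith [seq_le k])
  have Klt : ∀ k, Ks k < K := fun k => mul_lt_of_lt_one_right hK (by linarith [seq_pos k])
  have Klim : Tendsto Ks atTop (𝓝 K) := by
    have := (((seq_tendsto.div_const 2).const_sub 1).const_mul K)
    simpa [Ks] using this
  have hsq : Real.sqrt (K / (N - 1)) * b ≤ Real.pi := by
    calc Real.sqrt (K / (N - 1)) * b ≤ Real.sqrt (K / (N - 1)) *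
          (Real.pi * Real.sqrt ((N - 1) / K)) := mul_le_mul_of_nonneg_left hbR (Real.sqrt_nonneg _)
      _ = Real.pi * Real.sqrt (K / (N - 1) * ((N - 1) / K)) := by
        rw [Real.sqrt_mul (by positivity)]; ring
      _ = Real.pi := by
        rw [div_mul_div_cancel₀ n1.ne', div_self hK.ne', Real.sqrt_one, mul_one]
  have slt : ∀ k, Real.sqrt (Ks k / (N - 1)) < Real.sqrt (K / (N - 1)) := fun k =>
    Real.sqrt_lt_sqrt (div_nonneg (Kpos k).le n1.le) (div_lt_div_of_pos_right (Klt k) n1)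
  have sltpi : ∀ k θ, 0 < θ → θ ≤ b → Real.sqrt (Ks k / (N - 1)) * θ < Real.pi := by
    intro k θ h0 hθ
    calc _ < Real.sqrt (K / (N - 1)) * θ := mul_lt_mul_of_pos_right (slt k) h0
      _ ≤ Real.sqrt (K / (N - 1)) * b := mul_le_mul_of_nonneg_left hθ (Real.sqrt_nonneg _)
      _ ≤ _ := hsq
  refine ⟨Ks, fun _ => N, fun k => ⟨le_rfl, hN, Klt k, (Kpos k).ne', fun _ => Kpos k,
    fun _ => sltpi k b hb le_rfl⟩, ?_⟩
  intro θ h0 hθ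
  have hsn : ∀ k y, sn (Ks k / (N - 1)) y = Real.sin (Real.sqrt (Ks k / (N - 1)) * y) := by
    intro k y; unfold sn; rw [if_pos (div_pos (Kpos k) n1)]
  simp only [hsn]
  set w := Real.sqrt (K / (N - 1)) with hw
  have wp : 0 < w := Real.sqrt_pos.2 (by positivity)
  have wlim : Tendsto (fun k => Real.sqrt (Ks k / (N - 1))) atTop (𝓝 w) :=
    (Real.continuous_sqrt.tendsto _).comp (Klim.div_const _)
  have numl : Tendsto (fun k => Real.sin (Real.sqrt (Ks k / (N - 1)) * (t * θ))) atTop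
      (𝓝 (Real.sin (w * (t * θ)))) := (Real.continuous_sin.tendsto _).comp (wlim.mul_const _)
  have denl : Tendsto (fun k => Real.sin (Real.sqrt (Ks k / (N - 1)) * θ)) atTop
      (𝓝 (Real.sin (w * θ))) := (Real.continuous_sin.tendsto _).comp (wlim.mul_const _)
  have w2 : (w * θ) ^ 2 * (N - 1) = K * θ ^ 2 := by
    rw [mul_pow, hw, Real.sq_sqrt (by positivity)]; field_simp
  have wle : w * θ ≤ Real.pi := (mul_le_mul_of_nonneg_left hθ wp.le).trans hsq
  have wpos : 0 < w * θ := by positivity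
  have denp : ∀ k, 0 < Real.sin (Real.sqrt (Ks k / (N - 1)) * θ) := fun k =>
    Real.sin_pos_of_pos_of_lt_pi (mul_pos (Real.sqrt_pos.2 (div_pos (Kpos k) n1)) h0)
      (sltpi k θ h0 hθ)
  have nump : 0 < Real.sin (w * (t * θ)) := by
    refine Real.sin_pos_of_pos_of_lt_pi (by positivity) ?_
    have : w * (t * θ) = t * (w * θ) := by ring
    rw [this]; nlinarith
  rw [tau_pow hN]
  unfold sigmaCoeff
  rcases lt_or_eq_of_le wle with hlt | heq
  · have c1 : ¬ ((N - 1) * Real.pi ^ 2 ≤ K * θ ^ 2) := by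
      rw [not_le, ← w2, mul_comm]
      exact mul_lt_mul_of_pos_left (pow_lt_pow_left₀ hlt wpos.le (by norm_num)) n1
    rw [if_neg c1, if_pos (by positivity)]
    have dp : 0 < Real.sin (w * θ) := Real.sin_pos_of_pos_of_lt_pi wpos hlt
    have e1 : t * θ * w = w * (t * θ) := by ring
    rw [e1, mul_comm θ w, ← ofReal_mul_rpow ht0.le (div_pos nump dp).le n1.le]
    have L := (((numl.div denl dp.ne').rpow_const (p := N - 1) (Or.inr n1.le)).const_mul t)
    exact (((ENNReal.continuous_ofReal.tendsto _).comp L).liminf_eq).ge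
  · rw [if_pos (by rw [← w2, heq, mul_comm])]
    rw [heq, Real.sin_pi] at denl
    have den' : Tendsto (fun k => Real.sin (Real.sqrt (Ks k / (N - 1)) * θ)) atTop (𝓝[>] 0) :=
      tendsto_nhdsWithin_iff.2 ⟨denl, Eventually.of_forall denp⟩
    have L : Tendsto (fun k => t * (Real.sin (Real.sqrt (Ks k / (N - 1)) * (t * θ)) /
        Real.sin (Real.sqrt (Ks k / (N - 1)) * θ)) ^ (N - 1)) atTop atTop := by
      refine Tendsto.const_mul_atTop ht0 ((_root_.tendsto_rpow_atTop n1).comp ?_)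
      simp only [div_eq_mul_inv]
      exact numl.pos_mul_atTop nump den'.inv_tendsto_nhdsGT_zero
    have L2 := ENNReal.tendsto_ofReal_atTop.comp L
    exact le_top.trans (L2.liminf_eq).ge

lemma adm_nonpos {K N b t : ℝ} (hN : 1 < N) (hK : K ≤ 0) (ht0 : 0 < t) (ht1 : t < 1) :
    ∃ Ks Ns : ℕ → ℝ, (∀ k, Adm K N b (Ks k) (Ns k)) ∧ ∀ θ, 0 < θ →
      tauCoeff K N t θ ^ N ≤ liminf (fun k => ENNReal.ofReal (t * (sn (Ks k / (Ns k - 1)) (t * θ) /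
          sn (Ks k / (Ns k - 1)) θ) ^ (Ns k - 1))) atTop := by
  have n1 : 0 < N - 1 := by linarith
  let Ks : ℕ → ℝ := fun k => K - 1 / ((k:ℝ) + 1)
  have Klt : ∀ k, Ks k < K := fun k => sub_lt_self _ (seq_pos k)
  have Kneg : ∀ k, Ks k < 0 := fun k => (Klt k).trans_le hK
  have Klim : Tendsto Ks atTop (𝓝 K) := by
    have := seq_tendsto.const_sub K
    simpa [Ks] using this
  refine ⟨Ks, fun _ => N, fun k => ⟨le_rfl, hN, Klt k, (Kneg k).ne, fun h => by linarith,
    fun h => by linarith [Kneg k]⟩, ?_⟩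
  intro θ h0
  have hsn : ∀ k y, sn (Ks k / (N - 1)) y = Real.sinh (Real.sqrt (-Ks k / (N - 1)) * y) := by
    intro k y; unfold sn
    rw [if_neg (not_lt.2 (div_nonpos_of_nonpos_of_nonneg (Kneg k).le n1.le)), neg_div]
  simp only [hsn]
  set w := Real.sqrt (-K / (N - 1)) with hw
  have wlim : Tendsto (fun k => Real.sqrt (-Ks k / (N - 1))) atTop (𝓝 w) :=
    (Real.continuous_sqrt.tendsto _).comp (Klim.neg.div_const _)
  have pp : 0 < (N - 1) * Real.pi ^ 2 := by positivity
  have nn : K * θ ^ 2 ≤ 0 := mul_nonpos_of_nonpos_of_nonneg hK (by positivity)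
  rw [tau_pow hN]
  unfold sigmaCoeff
  rw [if_neg (by linarith), if_neg (by linarith)]
  rcases lt_or_eq_of_le hK with hlt | heq
  · have wp : 0 < w := Real.sqrt_pos.2 (div_pos (by linarith) n1)
    rw [if_neg (by have := mul_neg_of_neg_of_pos hlt (by positivity : 0 < θ ^ 2); linarith)]
    have dp : 0 < Real.sinh (w * θ) := Real.sinh_pos_iff.2 (by positivity)
    have nump : 0 < Real.sinh (w * (t * θ)) := Real.sinh_pos_iff.2 (by positivity)
    have e1 : t * θ * w = w * (t * θ) := by ring
    rw [e1, mul_comm θ w, ← ofReal_mul_rpow ht0.le (div_pos nump dp).le n1.le]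
    have numl : Tendsto (fun k => Real.sinh (Real.sqrt (-Ks k / (N - 1)) * (t * θ))) atTop
      (𝓝 (Real.sinh (w * (t * θ)))) := (Real.continuous_sinh.tendsto _).comp (wlim.mul_const _)
    have denl : Tendsto (fun k => Real.sinh (Real.sqrt (-Ks k / (N - 1)) * θ)) atTop
      (𝓝 (Real.sinh (w * θ))) := (Real.continuous_sinh.tendsto _).comp (wlim.mul_const _)
    have L := (((numl.div denl dp.ne').rpow_const (p := N - 1) (Or.inr n1.le)).const_mul t)
    exact (((ENNReal.continuous_ofReal.tendsto _).comp L).liminf_eq).ge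
  · rw [if_pos (by rw [heq]; ring), ← ofReal_mul_rpow ht0.le ht0.le n1.le]
    have w0 : w = 0 := by rw [hw, heq]; simp
    rw [w0] at wlim
    have L1 : Tendsto (fun k => t * (t * Real.exp (-(1 - t) *
        (Real.sqrt (-Ks k / (N - 1)) * θ))) ^ (N - 1)) atTop
        (𝓝 (t * (t * Real.exp (-(1 - t) * (0 * θ))) ^ (N - 1))) := by
      refine Tendsto.const_mul t (Tendsto.rpow_const (Tendsto.const_mul t
        ((Real.continuous_exp.tendsto _).comp ((wlim.mul_const θ).const_mul _))) (Or.inr n1.le))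
    rw [zero_mul, mul_zero, Real.exp_zero, mul_one] at L1
    have L2 := ((ENNReal.continuous_ofReal.tendsto _).comp L1).liminf_eq
    rw [← L2]
    refine liminf_le_liminf (Eventually.of_forall fun k => ?_)
    simp only [Function.comp]
    refine ENNReal.ofReal_le_ofReal (mul_le_mul_of_nonneg_left
      (Real.rpow_le_rpow (by positivity) ?_ n1.le) ht0.le)
    have hx : 0 < Real.sqrt (-Ks k / (N - 1)) * θ :=
      mul_pos (Real.sqrt_pos.2 (div_pos (by linarith [Kneg k]) n1)) h0
    have := sinh_ratio_lb ht0.le ht1.le hx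
    have e : t * (Real.sqrt (-Ks k / (N - 1)) * θ) = Real.sqrt (-Ks k / (N - 1)) * (t * θ) := by ring
    rwa [e] at this

lemma adm_one {K b t : ℝ} (hK : K ≤ 0) (ht0 : 0 < t) (ht1 : t < 1) :
    ∃ Ks Ns : ℕ → ℝ, (∀ k, Adm K 1 b (Ks k) (Ns k)) ∧ ∀ θ, 0 < θ →
      tauCoeff K 1 t θ ^ (1:ℝ) ≤ liminf (fun k => ENNReal.ofReal (t *
        (sn (Ks k / (Ns k - 1)) (t * θ) / sn (Ks k / (Ns k - 1)) θ) ^ (Ns k - 1))) atTop := by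
  have K1 : K - 1 < 0 := by linarith
  refine ⟨fun _ => K - 1, fun k => 1 + 1 / ((k:ℝ) + 1), fun k => ⟨by linarith [seq_pos k],
    by linarith [seq_pos k], by linarith, K1.ne, fun h => by linarith, fun h => by linarith⟩, ?_⟩
  intro θ h0
  unfold tauCoeff
  rw [if_pos rfl, if_pos hK, ENNReal.rpow_one]
  simp only [add_sub_cancel_left]
  set c := Real.sqrt (-(K - 1)) with hc
  have cp : 0 < c := Real.sqrt_pos.2 (by linarith)
  have L1 : Tendsto (fun k : ℕ => t * (t ^ (1 / ((k:ℝ) + 1)) *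
      Real.exp (-(1 - t) * (c * θ) * Real.sqrt (1 / ((k:ℝ) + 1))))) atTop
      (𝓝 (t * (t ^ (0:ℝ) * Real.exp (-(1 - t) * (c * θ) * Real.sqrt 0)))) := by
    refine Tendsto.const_mul t (Tendsto.mul ?_ ((Real.continuous_exp.tendsto _).comp
      (((Real.continuous_sqrt.tendsto _).comp seq_tendsto).const_mul _)))
    exact tendsto_const_nhds.rpow seq_tendsto (Or.inl ht0.ne')
  rw [Real.rpow_zero, Real.sqrt_zero, mul_zero, Real.exp_zero, mul_one, mul_one] at L1
  have L2 := ((ENNReal.continuous_ofReal.tendsto _).comp L1).liminf_eq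
  rw [← L2]
  refine liminf_le_liminf (Eventually.of_forall fun k => ?_)
  simp only [Function.comp]
  set y := 1 / ((k:ℝ) + 1) with hy
  have yp : 0 < y := seq_pos k
  have hsn : ∀ z, sn ((K - 1) / y) z = Real.sinh (Real.sqrt (-((K - 1) / y)) * z) := by
    intro z; unfold sn
    rw [if_neg (not_lt.2 (div_nonpos_of_nonpos_of_nonneg K1.le yp.le))]
  rw [hsn, hsn]
  have sy : 0 < Real.sqrt y := Real.sqrt_pos.2 yp
  have es : Real.sqrt (-((K - 1) / y)) = c / Real.sqrt y := by
    rw [← neg_div, Real.sqrt_div (by linarith)]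
  rw [es]
  refine ENNReal.ofReal_le_ofReal (mul_le_mul_of_nonneg_left ?_ ht0.le)
  have hx : 0 < c / Real.sqrt y * θ := by positivity
  have hr := sinh_ratio_lb ht0.le ht1.le hx
  have e : t * (c / Real.sqrt y * θ) = c / Real.sqrt y * (t * θ) := by ring
  rw [e] at hr
  refine le_trans (le_of_eq ?_) (Real.rpow_le_rpow (by positivity) hr yp.le)
  rw [Real.mul_rpow ht0.le (Real.exp_pos _).le, ← Real.exp_mul]
  congr 2
  have : y = Real.sqrt y * Real.sqrt y := (Real.mul_self_sqrt yp.le).symm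
  calc -(1 - t) * (c * θ) * Real.sqrt y =
      -(1 - t) * (c / Real.sqrt y * θ) * (Real.sqrt y * Real.sqrt y) := by field_simp
    _ = _ := by rw [← this]
end P18

section P19
variable [ProperSpace X] [BorelSpace X]

lemma tau_measurable (K N t : ℝ) : Measurable (fun γ : Geo X => tauCoeff K N t (len γ) ^ N) := by
  have hl : Measurable (len : Geo X → ℝ) := len_measurable
  refine Measurable.pow_const ?_ _
  unfold tauCoeff
  by_cases h : N = 1
  · simp only [if_pos h]
    by_cases h2 : K ≤ 0
    · simp only [if_pos h2]; exact measurable_const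
    · simp only [if_neg h2]
      exact Measurable.ite (hl (measurableSet_singleton 0)) measurable_const measurable_const
  · simp only [if_neg h]
    exact (((sigma_measurable K (N - 1) t).comp hl).pow_const _).const_mul _

lemma tau_t0 {K N θ : ℝ} (hN : 1 ≤ N) (h : N = 1 → 0 < K → θ = 0) : tauCoeff K N 0 θ ^ N = 0 := by
  rcases hN.eq_or_lt with rfl | h1
  · unfold tauCoeff
    by_cases hK : K ≤ 0
    · simp [hK]
    · simp [hK, h rfl (not_le.1 hK)]
  · rw [tau_pow h1]; simp

lemma sigma_one {K N θ : ℝ} (hN : 0 < N) (hθ : 0 ≤ θ) (h : ¬ N * Real.pi ^ 2 ≤ K * θ ^ 2) :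
    sigmaCoeff K N 1 θ ≤ 1 := by
  unfold sigmaCoeff
  rw [if_neg h]
  split_ifs with h1 h2
  · rw [one_mul]
    exact ENNReal.ofReal_le_one.2 (div_self_le_one _)
  · simp
  · rw [one_mul]
    exact ENNReal.ofReal_le_one.2 (div_self_le_one _)

lemma tau_one_le {K N θ : ℝ} (hN : 1 ≤ N) (hθ : 0 ≤ θ) (h0 : N = 1 → 0 < K → θ = 0)
    (h : 1 < N → ¬ (N - 1) * Real.pi ^ 2 ≤ K * θ ^ 2) : tauCoeff K N 1 θ ^ N ≤ 1 := by
  rcases hN.eq_or_lt with rfl | h1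
  · unfold tauCoeff
    by_cases hK : K ≤ 0
    · simp [hK]
    · simp [hK, h0 rfl (not_le.1 hK)]
  · rw [tau_pow h1, ENNReal.ofReal_one, one_mul]
    exact ENNReal.rpow_le_one (sigma_one (by linarith) hθ (h h1)) (by linarith)

lemma tau_piece_mid {K N : ℝ} {m : Measure X} [IsLocallyFiniteMeasure m] (H : Hyp K N m) {x : X}
    {a b : ℝ} {A : Set X} {P : Measure (Geo X)} (hP : FP m x a b A P)
    (hbR : 0 < K → b ≤ Real.pi * Real.sqrt ((N - 1) / K)) (hne : ¬ (N = 1 ∧ 0 < K)) (hab : a ≤ b)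
    {t : unitInterval} (ht : (0:ℝ) < t) (ht1 : (t:ℝ) < 1) :
    (P.withDensity (fun γ => tauCoeff K N t (len γ) ^ N)).map (eval t) ≤ m := by
  have := hP.fin
  have hb : 0 < b := hP.ha.trans_le hab
  have key : ∃ Ks Ns : ℕ → ℝ, (∀ k, Adm K N b (Ks k) (Ns k)) ∧ ∀ θ, 0 < θ → θ ≤ b →
      tauCoeff K N t θ ^ N ≤ liminf (fun k => ENNReal.ofReal (t * (sn (Ks k / (Ns k - 1)) (t * θ) /
          sn (Ks k / (Ns k - 1)) θ) ^ (Ns k - 1))) atTop := by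
    rcases H.hN.eq_or_lt with h1 | h1
    · subst h1
      have hK : K ≤ 0 := by
        by_contra hK
        exact hne ⟨rfl, not_le.1 hK⟩
      obtain ⟨Ks, Ns, h1, h2⟩ := adm_one (b := b) hK ht ht1
      exact ⟨Ks, Ns, h1, fun θ h _ => h2 θ h⟩
    · rcases le_or_gt K 0 with hK | hK
      · obtain ⟨Ks, Ns, h1, h2⟩ := adm_nonpos (b := b) h1 hK ht ht1
        exact ⟨Ks, Ns, h1, fun θ h _ => h2 θ h⟩
      · exact adm_pos h1 hK hb (hbR hK) ht ht1
  obtain ⟨Ks, Ns, hadm, hlim⟩ := key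
  have hlm : Measurable (len : Geo X → ℝ) := len_measurable
  refine fatou_le (m := m) (P := P) (F := fun _ => eval t) (G := eval t)
    (w := fun k γ => ENNReal.ofReal (t * (sn (Ks k / (Ns k - 1)) (t * len γ) /
          sn (Ks k / (Ns k - 1)) (len γ)) ^ (Ns k - 1)))
    (fun _ => eval_measurable t) (eval_measurable t) ?_ ?_ ?_ ?_
  · intro k
    have snm : Measurable (sn (Ks k / (Ns k - 1))) := (sn_cont _).measurable
    exact ((((snm.comp (hlm.const_mul _)).div (snm.comp hlm)).pow_const _).const_mul _).ennreal_ofReal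
  · intro k
    obtain ⟨h1, h2, h3, h4, h5, h6⟩ := hadm k
    exact tau_approx H hP h1 h2 h3 h4 h5 h6 ht ht1
  · exact Eventually.of_forall fun γ => tendsto_const_nhds
  · filter_upwards [hP.len] with γ hγ
    exact hlim _ (hP.ha.trans_le hγ.1) hγ.2

lemma tau_half_top {K N θ : ℝ} (hN : 1 < N) (h : (N - 1) * Real.pi ^ 2 ≤ K * θ ^ 2) :
    tauCoeff K N (1/2) θ ^ N = ⊤ := by
  rw [tau_pow hN]
  unfold sigmaCoeff
  rw [if_pos h, ENNReal.top_rpow_of_pos (by linarith), ENNReal.mul_top]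
  simp

lemma tau_piece {K N : ℝ} {m : Measure X} [IsLocallyFiniteMeasure m] (H : Hyp K N m) {x : X}
    {a b : ℝ} {A : Set X} {P : Measure (Geo X)} (hP : FP m x a b A P)
    (hbR : 0 < K → b ≤ Real.pi * Real.sqrt ((N - 1) / K)) (t : unitInterval) :
    (P.withDensity (fun γ => tauCoeff K N t (len γ) ^ N)).map (eval t) ≤ m ∧
    (t = 0 → (P.withDensity (fun γ => tauCoeff K N t (len γ) ^ N)).map (eval t) = 0) := by
  have := hP.fin
  by_cases hPz : P = 0
  · subst hPz
    simp [Measure.zero_le m]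
  have hne : (ae P).NeBot := ae_neBot.2 hPz
  obtain ⟨γ0, hγ0⟩ := hP.len.exists
  have hab : a ≤ b := hγ0.1.trans hγ0.2
  have hnn : ¬ (N = 1 ∧ 0 < K) := by
    rintro ⟨rfl, hK⟩
    have := hbR hK
    simp at this
    linarith [hP.ha]
  have z : t = 0 → (P.withDensity (fun γ => tauCoeff K N t (len γ) ^ N)).map (eval t) = 0 := by
    rintro rfl
    have e : (fun γ : Geo X => tauCoeff K N ((0:unitInterval):ℝ) (len γ) ^ N) = fun _ => 0 := by
      funext γ
      exact tau_t0 H.hN (fun h1 h2 => absurd ⟨h1, h2⟩ hnn)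
    rw [e]
    simp
  refine ⟨?_, z⟩
  rcases t.2.1.eq_or_lt with h0 | h0
  · rw [z (Subtype.ext h0.symm)]
    exact Measure.zero_le _
  rcases t.2.2.lt_or_eq with h1 | h1
  · exact tau_piece_mid H hP hbR hnn hab h0 h1
  have ht : t = 1 := Subtype.ext h1
  subst ht
  let hf : unitInterval := ⟨1/2, by norm_num, by norm_num⟩
  have mid := tau_piece_mid H hP hbR hnn hab (t := hf) (by norm_num [hf]) (by norm_num [hf])
  have hm : ∫⁻ γ, tauCoeff K N (1/2) (len γ) ^ N ∂P ≠ ⊤ := by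
    have e1 := mid (closedBall x b)
    rw [Measure.map_apply (eval_measurable _) isClosed_closedBall.measurableSet,
      withDensity_apply _ (eval_measurable hf isClosed_closedBall.measurableSet)] at e1
    rw [Measure.restrict_eq_self_of_ae_mem] at e1
    · exact ne_top_of_le_ne_top (H.bdd _ isBounded_closedBall) e1
    · filter_upwards [hP.len, hP.start] with γ h1 h2
      rw [mem_preimage, mem_closedBall, dist_comm, dist_eval_start h2]
      exact (mul_le_of_le_one_left (len_nonneg γ) hf.2.2).trans h1.2
  have fin := ae_lt_top (tau_measurable K N (1/2)) hm
  calc (P.withDensity (fun γ => tauCoeff K N ((1:unitInterval):ℝ) (len γ) ^ N)).map (eval 1)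
      ≤ (P.withDensity 1).map (eval 1) := by
        refine Measure.map_mono (withDensity_mono ?_) (eval_measurable 1)
        filter_upwards [fin] with γ hγ
        refine tau_one_le H.hN (len_nonneg γ) (fun h1 h2 => absurd ⟨h1, h2⟩ hnn) ?_
        intro hN hc
        rw [tau_half_top hN hc] at hγ
        exact lt_irrefl _ hγ
    _ = m.restrict A := by rw [withDensity_one, hP.map1]
    _ ≤ m := Measure.restrict_le_self

end P19

section P20
variable [ProperSpace X] [BorelSpace X]

open Classical in
/-- radial index -/
def idx (r : ℝ) : Option ℤ := if r ≤ 0 then none else some ⌊Real.log r⌋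

lemma idx_none {r : ℝ} : idx r = none ↔ r ≤ 0 := by
  unfold idx; split_ifs with h <;> simp [h]

lemma idx_some {r : ℝ} {k : ℤ} : idx r = some k ↔ Real.exp k ≤ r ∧ r < Real.exp (k + 1) := by
  unfold idx
  split_ifs with h
  · simp only [reduceCtorEq, false_iff, not_and]
    intro h2
    linarith [Real.exp_pos k]
  · push Not at h
    rw [Option.some_inj, Int.floor_eq_iff, Real.le_log_iff_exp_le h, Real.log_lt_iff_lt_exp h]

lemma idx_meas (i : Option ℤ) : MeasurableSet {r : ℝ | idx r = i} := by
  cases i with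
  | none => simp only [idx_none]; exact measurableSet_Iic
  | some k => simp only [idx_some]; exact measurableSet_Ico

lemma tau_zero_le {K N t : ℝ} (hN : 1 ≤ N) (ht0 : 0 ≤ t) (ht1 : t ≤ 1) :
    tauCoeff K N t 0 ^ N ≤ 1 := by
  have h1t : ENNReal.ofReal t ≤ 1 := ENNReal.ofReal_le_one.2 ht1
  rcases hN.eq_or_lt with rfl | h1
  · unfold tauCoeff
    simp [h1t]
  · rw [tau_pow h1]
    have e : sigmaCoeff K (N - 1) t 0 = ENNReal.ofReal t := by
      unfold sigmaCoeff
      rw [if_neg]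
      · simp
      · have := Real.pi_pos
        have : 0 < N - 1 := by linarith
        simp; positivity
    rw [e]
    exact mul_le_one' h1t (ENNReal.rpow_le_one h1t (by linarith))

lemma len_constGeo (x : X) : len (constGeo x) = 0 := by
  unfold len; rw [eval_constGeo, eval_constGeo, dist_self]

lemma piece {K N : ℝ} {m : Measure X} [IsLocallyFiniteMeasure m] (H : Hyp K N m) (x : X)
    {B : Set X} (hB : MeasurableSet B) {i : Option ℤ} (hi : ∀ z ∈ B, idx (dist x z) = i)
    (hBR : 0 < K → B ⊆ closedBall x (Real.pi * Real.sqrt ((N - 1) / K))) :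
    ∃ P : Measure (Geo X), (∀ᵐ γ ∂P, eval 0 γ = x) ∧ P.map (eval 1) = m.restrict B ∧
      ∀ t : unitInterval,
        (P.withDensity (fun γ => tauCoeff K N t (len γ) ^ N)).map (eval t) ≤ m ∧
        (t = 0 → (P.withDensity (fun γ => tauCoeff K N t (len γ) ^ N)).map (eval t) = 0) := by
  by_cases hm0 : m B = 0
  · refine ⟨0, by simp, ?_, fun t => ?_⟩
    · rw [Measure.map_zero, eq_comm, Measure.restrict_eq_zero]; exact hm0
    · simp [Measure.zero_le m]
  have hBne : B.Nonempty := nonempty_of_measure_ne_zero hm0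
  cases i with
  | none =>
    have hBx : B = {x} := by
      refine (subset_singleton_iff_eq.1 ?_).resolve_left hBne.ne_empty
      intro z hz
      have := idx_none.1 (hi z hz)
      exact (dist_le_zero.1 this).symm
    subst hBx
    have mp : ∀ t : unitInterval, (m {x} • Measure.dirac (constGeo x)).map (eval t)
        = m.restrict {x} := by
      intro t
      rw [Measure.map_smul, Measure.map_dirac' (eval_measurable t), eval_constGeo,
        Measure.restrict_singleton]
    refine ⟨m {x} • Measure.dirac (constGeo x), ?_, mp 1, fun t => ⟨?_, ?_⟩⟩
    · refine Measure.ae_smul_measure ?_ _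
      exact (ae_dirac_iff (p := fun γ => eval 0 γ = x)
        (eval_measurable 0 (measurableSet_singleton x))).2 (eval_constGeo x 0)
    · calc _ ≤ ((m {x} • Measure.dirac (constGeo x)).withDensity 1).map (eval t) := by
            refine Measure.map_mono (withDensity_mono ?_) (eval_measurable t)
            refine Measure.ae_smul_measure ?_ _
            refine (ae_dirac_iff (p := fun γ => tauCoeff K N t (len γ) ^ N ≤ 1)
              (tau_measurable K N t measurableSet_Iic)).2 ?_
            rw [len_constGeo]
            exact tau_zero_le H.hN t.2.1 t.2.2
        _ = m.restrict {x} := by rw [withDensity_one, mp]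
        _ ≤ m := Measure.restrict_le_self
    · rintro rfl
      rw [withDensity_congr_ae (g := 0)]
      · simp
      · refine Measure.ae_smul_measure ?_ _
        refine (ae_dirac_iff (p := fun γ => tauCoeff K N ((0:unitInterval):ℝ) (len γ) ^ N = 0)
              (tau_measurable K N _ (measurableSet_singleton 0))).2 ?_
        rw [len_constGeo]
        exact tau_t0 H.hN (fun _ _ => rfl)
  | some k =>
    let R := Real.pi * Real.sqrt ((N - 1) / K)
    obtain ⟨b, hb0, hbB, hbR⟩ : ∃ b : ℝ, 0 ≤ b ∧ B ⊆ closedBall x b ∧ (0 < K → b ≤ R) := by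
      have h1 : B ⊆ closedBall x (Real.exp (k + 1)) := fun z hz => by
        rw [mem_closedBall, dist_comm]
        exact (idx_some.1 (hi z hz)).2.le
      by_cases hK : 0 < K
      · refine ⟨R, ?_, hBR hK, fun _ => le_rfl⟩
        have := Real.pi_pos
        positivity
      · exact ⟨_, (Real.exp_pos _).le, h1, fun h => absurd h hK⟩
    obtain ⟨P, f1, f2, f3, f4⟩ := foundation H x hB (pos_iff_ne_zero.2 hm0) hb0 hbB
    have hl : ∀ᵐ γ ∂P, Real.exp k ≤ len γ ∧ len γ ≤ b := by
      have h1 : ∀ᵐ y ∂(P.map (eval 1)), y ∈ B := by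
        rw [f3]; exact ae_restrict_mem hB
      have h2 := ae_of_ae_map (eval_measurable 1).aemeasurable h1
      filter_upwards [h2, f2] with γ hγ h0
      have e := dist_eval_start h0 1
      simp only [Icc.coe_one, one_mul] at e
      rw [← e]
      refine ⟨(idx_some.1 (hi _ hγ)).1, ?_⟩
      have := hbB hγ
      rwa [mem_closedBall, dist_comm] at this
    have hP : FP m x (Real.exp k) b B P := ⟨f1, f2, f3, f4, hl, Real.exp_pos _, hB⟩
    exact ⟨P, f2, f3, fun t => tau_piece H hP hbR t⟩

lemma sum_le_of_disjoint {ι : Type*} [Countable ι] {m : Measure X} {ν : ι → Measure X}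
    {S : ι → Set X}
    (hS : ∀ i, MeasurableSet (S i)) (hd : Pairwise (Function.onFun Disjoint S))
    (hν : ∀ i, ν i (S i)ᶜ = 0) (h : ∀ i, ν i ≤ m) : Measure.sum ν ≤ m := by
  rw [Measure.le_iff]
  intro E hE
  rw [Measure.sum_apply _ hE]
  calc ∑' i, ν i E ≤ ∑' i, m (E ∩ S i) := by
        refine ENNReal.tsum_le_tsum fun i => ?_
        rw [← measure_inter_add_sdiff E (hS i)]
        have : ν i (E \ S i) = 0 := measure_mono_null (fun z hz => hz.2) (hν i)
        rw [this, add_zero]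
        exact h i _
    _ = m (⋃ i, E ∩ S i) := by
        rw [measure_iUnion _ (fun i => hE.inter (hS i))]
        intro i j hij
        exact (hd hij).mono inter_subset_right inter_subset_right
    _ ≤ m E := measure_mono (iUnion_subset fun i => inter_subset_left)

lemma cost_eq {x : X} {π : Measure (Geo X)} {ν : Measure X} (h0 : ∀ᵐ γ ∂π, eval 0 γ = x)
    (h1 : π.map (eval 1) = ν) :
    transportCost π = ∫⁻ y, ENNReal.ofReal (dist x y ^ 2) ∂ν := by
  rw [← h1, lintegral_map (by fun_prop) (eval_measurable 1)]
  unfold transportCost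
  refine lintegral_congr_ae ?_
  filter_upwards [h0] with γ hγ
  simp only [hγ]

lemma main_aux {K N : ℝ} {m : Measure X} [IsLocallyFiniteMeasure m] (H : Hyp K N m) (x : X)
    {A : Set X} (hA : MeasurableSet A) (hA0 : 0 < m A) (hAt : m A ≠ ⊤)
    (hAR : 0 < K → A ⊆ closedBall x (Real.pi * Real.sqrt ((N - 1) / K))) :
    ∃ π : Measure (Geo X),
      IsOptGeo (Measure.dirac x) ((m A)⁻¹ • m.restrict A) π ∧
      ∀ t : unitInterval,
        (π.withDensity fun γ =>
            tauCoeff K N (t : ℝ) (dist (eval 0 γ) (eval 1 γ)) ^ N * m A).map (eval t) ≤ m := by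
  have hdm : Measurable (fun z => dist x z) := by fun_prop
  let B : Option ℤ → Set X := fun i => A ∩ {z | idx (dist x z) = i}
  have hB : ∀ i, MeasurableSet (B i) := fun i => hA.inter (hdm (idx_meas i))
  have hBU : ⋃ i, B i = A := by
    ext z
    simp [B]
  have hBd : Pairwise (Function.onFun Disjoint B) := by
    intro i j hij
    refine disjoint_left.2 fun z hz hz' => hij ?_
    exact hz.2.symm.trans hz'.2
  choose P p0 p1 p2 using fun i => piece H x (hB i) (i := i) (fun z hz => hz.2)
    (fun h => inter_subset_left.trans (hAR h))
  have hsum1 : (Measure.sum P).map (eval 1) = m.restrict A := by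
    rw [Measure.map_sum (eval_measurable 1).aemeasurable]
    simp_rw [p1]
    rw [← Measure.restrict_iUnion hBd hB, hBU]
  have hs0 : ∀ᵐ γ ∂(Measure.sum P), eval 0 γ = x := by
    rw [Measure.ae_sum_iff]
    exact p0
  set π : Measure (Geo X) := (m A)⁻¹ • Measure.sum P with hπ
  have hπ1 : π.map (eval 1) = (m A)⁻¹ • m.restrict A := by
    rw [hπ, Measure.map_smul, hsum1]
  have hπ0 : ∀ᵐ γ ∂π, eval 0 γ = x := Measure.ae_smul_measure hs0 _
  have hprob : IsProbabilityMeasure π := by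
    constructor
    have : π.map (eval 1) univ = 1 := by
      rw [hπ1]
      simp [ENNReal.inv_mul_cancel hA0.ne' hAt]
    rwa [Measure.map_apply (eval_measurable 1) MeasurableSet.univ, preimage_univ] at this
  refine ⟨π, ⟨hprob, ?_, hπ1, ?_⟩, ?_⟩
  · rw [Measure.map_congr (g := fun _ => x) hπ0, Measure.map_const]
    simp
  · intro π' _ h0 h1
    have h0' : ∀ᵐ γ ∂π', eval 0 γ = x := by
      refine ae_of_ae_map (p := fun y => y = x) (eval_measurable 0).aemeasurable ?_
      rw [h0]
      exact (ae_dirac_iff (measurableSet_singleton x)).2 rfl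
    rw [cost_eq hπ0 hπ1, cost_eq h0' h1]
  · intro t
    have e : (π.withDensity fun γ =>
        tauCoeff K N (t : ℝ) (dist (eval 0 γ) (eval 1 γ)) ^ N * m A).map (eval t) =
        Measure.sum (fun i =>
          ((P i).withDensity (fun γ => tauCoeff K N t (len γ) ^ N)).map (eval t)) := by
      have e1 : (fun γ : Geo X => tauCoeff K N (t : ℝ) (dist (eval 0 γ) (eval 1 γ)) ^ N * m A) =
          m A • (fun γ => tauCoeff K N t (len γ) ^ N) := by
        funext γ
        simp [len, mul_comm]
      rw [e1, withDensity_smul _ (tau_measurable K N t), hπ, withDensity_smul_measure, smul_smul,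
        ENNReal.mul_inv_cancel hA0.ne' hAt, one_smul, withDensity_sum,
        Measure.map_sum (eval_measurable t).aemeasurable]
    rw [e]
    rcases t.2.1.eq_or_lt with h0 | h0
    · have ht : t = 0 := Subtype.ext h0.symm
      have : (fun i => ((P i).withDensity (fun γ => tauCoeff K N t (len γ) ^ N)).map (eval t))
          = fun _ => 0 := by
        funext i
        exact (p2 i t).2 ht
      rw [this]
      simp [Measure.zero_le m]
    · refine sum_le_of_disjoint (S := fun i => {z | idx (dist x z / t) = i})
        (fun i => (hdm.div_const _) (idx_meas i)) ?_ ?_ (fun i => (p2 i t).1)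
      · intro i j hij
        exact disjoint_left.2 fun z hz hz' => hij (hz.symm.trans hz')
      · intro i
        have hme : MeasurableSet {z | idx (dist x z / t) = i} := (hdm.div_const _) (idx_meas i)
        rw [Measure.map_apply (eval_measurable t) hme.compl]
        refine withDensity_absolutelyContinuous _ _ ?_
        have h1 : ∀ᵐ y ∂((P i).map (eval 1)), y ∈ B i := by
          rw [p1]; exact ae_restrict_mem (hB i)
        have h2 := ae_of_ae_map (eval_measurable 1).aemeasurable h1
        have h3 : ∀ᵐ γ ∂(P i), γ ∉ (eval t) ⁻¹' {z | idx (dist x z / t) = i}ᶜ := by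
          filter_upwards [h2, p0 i] with γ hγ hs
          have e1 := dist_eval_start hs 1
          simp only [Icc.coe_one, one_mul] at e1
          have := hγ.2
          have e2 : dist x (eval t γ) / t = dist x (eval 1 γ) := by
            rw [dist_eval_start hs, e1]; field_simp
          intro hc
          apply hc
          show idx (dist x (eval t γ) / t) = i
          rw [e2]
          exact this
        exact measure_eq_zero_iff_ae_notMem.2 h3

end P20

end Proofs

/-- **Corollary 1.5**: a `CD*(K,N)` space with the good transport property satisfies the
measure contraction property `MCP(K,N)`. -/
theorem mcp_of_cdStar
    [CompleteSpace X] [TopologicalSpace.SeparableSpace X] [ProperSpace X] [BorelSpace X]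
    (hX : IsGeodesicSpace X) (m : Measure X)
    (hm_bdd : ∀ s : Set X, Bornology.IsBounded s → m s ≠ ⊤)
    (hm_supp : ∀ x : X, ∀ r : ℝ, 0 < r → 0 < m (ball x r))
    (K N : ℝ) (hN : 1 ≤ N) (hCD : IsCDStar K N m) (hGT : GoodTransport m) :
    ∀ x : X, ∀ A : Set X, MeasurableSet A → 0 < m A → m A ≠ ⊤ →
      (0 < K → A ⊆ closedBall x (Real.pi * Real.sqrt ((N - 1) / K))) →
      ∃ π : Measure (Geo X),
        IsOptGeo (Measure.dirac x) ((m A)⁻¹ • m.restrict A) π ∧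
        ∀ t : unitInterval,
          (π.withDensity fun γ =>
              tauCoeff K N (t : ℝ) (dist (eval 0 γ) (eval 1 γ)) ^ N * m A).map (eval t) ≤ m := by
  intro x A hA hA0 hAt hAR
  have : IsLocallyFiniteMeasure m := ⟨fun x => ⟨ball x 1, ball_mem_nhds x one_pos,
    lt_top_iff_ne_top.2 (hm_bdd _ isBounded_ball)⟩⟩
  exact main_aux ⟨hm_bdd, hm_supp, hN, hCD, hGT⟩ x hA hA0 hAt hAR

end
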